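/- Let T be any consistent recursively enumerable extension of PA(K). (1) If T ⊬ □⊥, then T has (ΔB, Σ₁)-DP if and only if T is ΔB-DC. (2) T has (B, Σ₁)-DP if and only if T is B-DC. -/

import Mathlib

namespace ModalArith

/-- Terms of the language of arithmetic L_A = {0, S, +, ×, ≤, =}. -/
inductive Term : Type
  | var : ℕ → Term
  | zero : Term
  | succ : Term → Term
  | add : Term → Term → Term
  | mul : Term → Term → Term
  deriving DecidableEq

namespace Term

/-- Free variables of a term. -/
def fv : Term → Finset ℕ
  | var x => {x}
  | zero => ∅
  | succ t => fv t
  | add t u => fv t ∪ fv u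
  | mul t u => fv t ∪ fv u

/-- Simultaneous substitution of terms for variables. -/
def substAll : Term → (ℕ → Term) → Term
  | var x, v => v x
  | zero, _ => zero
  | succ t, v => succ (substAll t v)
  | add t u, v => add (substAll t v) (substAll u v)
  | mul t u, v => mul (substAll t v) (substAll u v)

/-- Substitution of the term `s` for the variable `x`. -/
def subst (x : ℕ) (s : Term) (t : Term) : Term :=
  substAll t (Function.update Term.var x s)

/-- The numeral `n̄`. -/
def numeral : ℕ → Term
  | 0 => zero
  | n + 1 => succ (numeral n)

/-- Value of a term in the standard model under a valuation. -/
def val : Term → (ℕ → ℕ) → ℕ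
  | var x, v => v x
  | zero, _ => 0
  | succ t, v => val t v + 1
  | add t u, v => val t v + val u v
  | mul t u, v => val t v * val u v

/-- A Gödel numbering of terms. -/
def code : Term → ℕ
  | var x => Nat.pair 0 x
  | zero => Nat.pair 1 0
  | succ t => Nat.pair 2 (code t)
  | add t u => Nat.pair 3 (Nat.pair (code t) (code u))
  | mul t u => Nat.pair 4 (Nat.pair (code t) (code u))

end Term

/-- Formulas of the language L_□ of modal arithmetic. -/
inductive Formula : Type
  | falsum : Formula
  | eq : Term → Term → Formula
  | le : Term → Term → Formula
  | and : Formula → Formula → Formula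
  | or : Formula → Formula → Formula
  | imp : Formula → Formula → Formula
  | neg : Formula → Formula
  | all : ℕ → Formula → Formula
  | ex : ℕ → Formula → Formula
  | box : Formula → Formula
  deriving DecidableEq

namespace Formula

/-- Free variables of a formula. -/
def fv : Formula → Finset ℕ
  | falsum => ∅
  | eq t u => t.fv ∪ u.fv
  | le t u => t.fv ∪ u.fv
  | and φ ψ => fv φ ∪ fv ψ
  | or φ ψ => fv φ ∪ fv ψ
  | imp φ ψ => fv φ ∪ fv ψ
  | neg φ => fv φ
  | all x φ => (fv φ).erase x
  | ex x φ => (fv φ).erase x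
  | box φ => fv φ

/-- Simultaneous substitution of terms for the free variables of a formula. -/
def substAll : Formula → (ℕ → Term) → Formula
  | falsum, _ => falsum
  | eq t u, v => eq (t.substAll v) (u.substAll v)
  | le t u, v => le (t.substAll v) (u.substAll v)
  | and φ ψ, v => and (substAll φ v) (substAll ψ v)
  | or φ ψ, v => or (substAll φ v) (substAll ψ v)
  | imp φ ψ, v => imp (substAll φ v) (substAll ψ v)
  | neg φ, v => neg (substAll φ v)
  | all x φ, v => all x (substAll φ (Function.update v x (Term.var x)))
  | ex x φ, v => ex x (substAll φ (Function.update v x (Term.var x)))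
  | box φ, v => box (substAll φ v)

/-- Substitution of the term `s` for the free occurrences of the variable `x`. -/
def subst (x : ℕ) (s : Term) (φ : Formula) : Formula :=
  substAll φ (Function.update Term.var x s)

/-- The term `s` is substitutable (free) for the variable `x` in the formula. -/
def freeFor (s : Term) (x : ℕ) : Formula → Prop
  | falsum => True
  | eq _ _ => True
  | le _ _ => True
  | and φ ψ => freeFor s x φ ∧ freeFor s x ψ
  | or φ ψ => freeFor s x φ ∧ freeFor s x ψ
  | imp φ ψ => freeFor s x φ ∧ freeFor s x ψ
  | neg φ => freeFor s x φ
  | all y φ => x = y ∨ x ∉ fv φ ∨ (y ∉ s.fv ∧ freeFor s x φ)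
  | ex y φ => x = y ∨ x ∉ fv φ ∨ (y ∉ s.fv ∧ freeFor s x φ)
  | box φ => freeFor s x φ

/-- The formula is an L_A-formula (contains no □). -/
def noBox : Formula → Prop
  | falsum => True
  | eq _ _ => True
  | le _ _ => True
  | and φ ψ => noBox φ ∧ noBox ψ
  | or φ ψ => noBox φ ∧ noBox ψ
  | imp φ ψ => noBox φ ∧ noBox ψ
  | neg φ => noBox φ
  | all _ φ => noBox φ
  | ex _ φ => noBox φ
  | box _ => False

/-- Truth in the standard model ℕ under a valuation (meaningful for L_A-formulas;
boxed formulas are given the dummy value `False`). -/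
def val : Formula → (ℕ → ℕ) → Prop
  | falsum, _ => False
  | eq t u, v => t.val v = u.val v
  | le t u, v => t.val v ≤ u.val v
  | and φ ψ, v => val φ v ∧ val ψ v
  | or φ ψ, v => val φ v ∨ val ψ v
  | imp φ ψ, v => val φ v → val ψ v
  | neg φ, v => ¬ val φ v
  | all x φ, v => ∀ n : ℕ, val φ (Function.update v x n)
  | ex x φ, v => ∃ n : ℕ, val φ (Function.update v x n)
  | box _, _ => False

/-- Biconditional, as an abbreviation. -/
def iff (φ ψ : Formula) : Formula := (φ.imp ψ).and (ψ.imp φ)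

/-- `t < u` abbreviates `S t ≤ u`. -/
def lt (t u : Term) : Formula := le (Term.succ t) u

/-- Bounded universal quantification `∀ x < t, φ`. -/
def ball (x : ℕ) (t : Term) (φ : Formula) : Formula :=
  all x ((lt (Term.var x) t).imp φ)

/-- Bounded existential quantification `∃ x < t, φ`. -/
def bex (x : ℕ) (t : Term) (φ : Formula) : Formula :=
  ex x ((lt (Term.var x) t).and φ)

/-- A Gödel numbering of formulas. -/
def code : Formula → ℕ
  | falsum => Nat.pair 0 0
  | eq t u => Nat.pair 1 (Nat.pair t.code u.code)
  | le t u => Nat.pair 2 (Nat.pair t.code u.code)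
  | and φ ψ => Nat.pair 3 (Nat.pair (code φ) (code ψ))
  | or φ ψ => Nat.pair 4 (Nat.pair (code φ) (code ψ))
  | imp φ ψ => Nat.pair 5 (Nat.pair (code φ) (code ψ))
  | neg φ => Nat.pair 6 (code φ)
  | all x φ => Nat.pair 7 (Nat.pair x (code φ))
  | ex x φ => Nat.pair 8 (Nat.pair x (code φ))
  | box φ => Nat.pair 9 (code φ)

end Formula

/-- A sentence is a formula with no free variables. -/
def Sentence (φ : Formula) : Prop := φ.fv = ∅

/-- Truth in the standard model ℕ (for sentences; any fixed valuation will do). -/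
def StdTrue (φ : Formula) : Prop := φ.val fun _ => 0

/-- The logical axioms of classical first-order logic with equality for L_□,
with the identity axioms only for atomic formulas. -/
inductive LogicalAxiom : Formula → Prop
  | imp1 (φ ψ : Formula) : LogicalAxiom (φ.imp (ψ.imp φ))
  | imp2 (φ ψ χ : Formula) :
      LogicalAxiom ((φ.imp (ψ.imp χ)).imp ((φ.imp ψ).imp (φ.imp χ)))
  | dne (φ : Formula) : LogicalAxiom (φ.neg.neg.imp φ)
  | negI (φ ψ : Formula) : LogicalAxiom ((φ.imp ψ).imp ((φ.imp ψ.neg).imp φ.neg))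
  | negE (φ ψ : Formula) : LogicalAxiom (φ.neg.imp (φ.imp ψ))
  | falsumE (φ : Formula) : LogicalAxiom (Formula.falsum.imp φ)
  | negIntro (φ : Formula) : LogicalAxiom ((φ.imp Formula.falsum).imp φ.neg)
  | negElimFalsum (φ : Formula) : LogicalAxiom (φ.neg.imp (φ.imp Formula.falsum))
  | andI (φ ψ : Formula) : LogicalAxiom (φ.imp (ψ.imp (φ.and ψ)))
  | andE1 (φ ψ : Formula) : LogicalAxiom ((φ.and ψ).imp φ)
  | andE2 (φ ψ : Formula) : LogicalAxiom ((φ.and ψ).imp ψ)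
  | orI1 (φ ψ : Formula) : LogicalAxiom (φ.imp (φ.or ψ))
  | orI2 (φ ψ : Formula) : LogicalAxiom (ψ.imp (φ.or ψ))
  | orE (φ ψ χ : Formula) :
      LogicalAxiom ((φ.imp χ).imp ((ψ.imp χ).imp ((φ.or ψ).imp χ)))
  | allE (x : ℕ) (t : Term) (φ : Formula) :
      φ.freeFor t x → LogicalAxiom ((Formula.all x φ).imp (φ.subst x t))
  | allImp (x : ℕ) (φ ψ : Formula) :
      x ∉ φ.fv → LogicalAxiom ((Formula.all x (φ.imp ψ)).imp (φ.imp (Formula.all x ψ)))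
  | exI (x : ℕ) (t : Term) (φ : Formula) :
      φ.freeFor t x → LogicalAxiom ((φ.subst x t).imp (Formula.ex x φ))
  | exE (x : ℕ) (φ ψ : Formula) :
      x ∉ ψ.fv → LogicalAxiom ((Formula.all x (φ.imp ψ)).imp ((Formula.ex x φ).imp ψ))
  | eqRefl (t : Term) : LogicalAxiom (Formula.eq t t)
  | eqSymm (t u : Term) : LogicalAxiom ((Formula.eq t u).imp (Formula.eq u t))
  | eqTrans (t u w : Term) :
      LogicalAxiom ((Formula.eq t u).imp ((Formula.eq u w).imp (Formula.eq t w)))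
  | eqSucc (t u : Term) :
      LogicalAxiom ((Formula.eq t u).imp (Formula.eq t.succ u.succ))
  | eqAdd (t₁ t₂ u₁ u₂ : Term) :
      LogicalAxiom ((Formula.eq t₁ t₂).imp ((Formula.eq u₁ u₂).imp
        (Formula.eq (t₁.add u₁) (t₂.add u₂))))
  | eqMul (t₁ t₂ u₁ u₂ : Term) :
      LogicalAxiom ((Formula.eq t₁ t₂).imp ((Formula.eq u₁ u₂).imp
        (Formula.eq (t₁.mul u₁) (t₂.mul u₂))))
  | eqLe (t₁ t₂ u₁ u₂ : Term) :
      LogicalAxiom ((Formula.eq t₁ t₂).imp ((Formula.eq u₁ u₂).imp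
        ((Formula.le t₁ u₁).imp (Formula.le t₂ u₂))))

/-- Provability in an L_□-theory: logical axioms, the axioms of the theory, and the
rules modus ponens, generalization, and necessitation. -/
inductive Provable (T : Set Formula) : Formula → Prop
  | ax {φ : Formula} : φ ∈ T → Provable T φ
  | logic {φ : Formula} : LogicalAxiom φ → Provable T φ
  | mp {φ ψ : Formula} : Provable T (φ.imp ψ) → Provable T φ → Provable T ψ
  | gen {φ : Formula} (x : ℕ) : Provable T φ → Provable T (Formula.all x φ)
  | nec {φ : Formula} : Provable T φ → Provable T (Formula.box φ)

/-- First-order provability (no necessitation rule); used for the non-modal theory PA. -/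
inductive FOProvable (T : Set Formula) : Formula → Prop
  | ax {φ : Formula} : φ ∈ T → FOProvable T φ
  | logic {φ : Formula} : LogicalAxiom φ → FOProvable T φ
  | mp {φ ψ : Formula} : FOProvable T (φ.imp ψ) → FOProvable T φ → FOProvable T ψ
  | gen {φ : Formula} (x : ℕ) : FOProvable T φ → FOProvable T (Formula.all x φ)

/-- Basic (Robinson-style) axioms of arithmetic. -/
def succNeZero : Formula := (Formula.eq (Term.succ (Term.var 0)) Term.zero).neg
def succInj : Formula :=
  (Formula.eq (Term.succ (Term.var 0)) (Term.succ (Term.var 1))).imp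
    (Formula.eq (Term.var 0) (Term.var 1))
def addZero : Formula := Formula.eq (Term.add (Term.var 0) Term.zero) (Term.var 0)
def addSucc : Formula :=
  Formula.eq (Term.add (Term.var 0) (Term.succ (Term.var 1)))
    (Term.succ (Term.add (Term.var 0) (Term.var 1)))
def mulZero : Formula := Formula.eq (Term.mul (Term.var 0) Term.zero) Term.zero
def mulSucc : Formula :=
  Formula.eq (Term.mul (Term.var 0) (Term.succ (Term.var 1)))
    (Term.add (Term.mul (Term.var 0) (Term.var 1)) (Term.var 0))
def leDef : Formula :=
  (Formula.le (Term.var 0) (Term.var 1)).iff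
    (Formula.ex 2 (Formula.eq (Term.add (Term.var 0) (Term.var 2)) (Term.var 1)))

def baseAxioms : Set Formula :=
  {succNeZero, succInj, addZero, addSucc, mulZero, mulSucc, leDef}

/-- The induction axiom for the formula `φ` and the variable `x`. -/
def inductionAx (x : ℕ) (φ : Formula) : Formula :=
  ((φ.subst x Term.zero).and
    (Formula.all x (φ.imp (φ.subst x (Term.succ (Term.var x)))))).imp
      (Formula.all x φ)

/-- Peano arithmetic PA: basic axioms plus induction for L_A-formulas. -/
def PA : Set Formula :=
  baseAxioms ∪ {χ | ∃ (x : ℕ) (φ : Formula), φ.noBox ∧ χ = inductionAx x φ}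

/-- PA_□ : basic axioms plus induction for all L_□-formulas. -/
def PABox : Set Formula :=
  baseAxioms ∪ {χ | ∃ (x : ℕ) (φ : Formula), χ = inductionAx x φ}

/-- The distribution axiom K. -/
def axK (φ ψ : Formula) : Formula :=
  (Formula.box (φ.imp ψ)).imp ((Formula.box φ).imp (Formula.box ψ))

/-- PA(K). -/
def PAK : Set Formula := PABox ∪ {χ | ∃ φ ψ : Formula, χ = axK φ ψ}

/-- The axiom 4. -/
def ax4 (φ : Formula) : Formula := (Formula.box φ).imp (Formula.box (Formula.box φ))

/-- PA(K4). -/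
def PAK4 : Set Formula := PAK ∪ {χ | ∃ φ : Formula, χ = ax4 φ}

/-- The axiom of Triv. -/
def axTriv (φ : Formula) : Formula := (Formula.box φ).iff φ

/-- PA(Triv). -/
def PATriv : Set Formula := PAK ∪ {χ | ∃ φ : Formula, χ = axTriv φ}

/-- PA(Ver). -/
def PAVer : Set Formula := PAK ∪ {Formula.box Formula.falsum}

/-- `T` extends `U`: every axiom of `U` is provable in `T`. -/
def Extends (T U : Set Formula) : Prop := ∀ φ ∈ U, Provable T φ

/-- Consistency. -/
def Consistent (T : Set Formula) : Prop := ¬ Provable T Formula.falsum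

/-- The class Δ₀ of bounded L_A-formulas. -/
inductive IsDelta0 : Formula → Prop
  | falsum : IsDelta0 Formula.falsum
  | eq (t u : Term) : IsDelta0 (Formula.eq t u)
  | le (t u : Term) : IsDelta0 (Formula.le t u)
  | and {φ ψ : Formula} : IsDelta0 φ → IsDelta0 ψ → IsDelta0 (φ.and ψ)
  | or {φ ψ : Formula} : IsDelta0 φ → IsDelta0 ψ → IsDelta0 (φ.or ψ)
  | imp {φ ψ : Formula} : IsDelta0 φ → IsDelta0 ψ → IsDelta0 (φ.imp ψ)
  | neg {φ : Formula} : IsDelta0 φ → IsDelta0 φ.neg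
  | ball {x : ℕ} {t : Term} {φ : Formula} :
      x ∉ t.fv → IsDelta0 φ → IsDelta0 (Formula.ball x t φ)
  | bex {x : ℕ} {t : Term} {φ : Formula} :
      x ∉ t.fv → IsDelta0 φ → IsDelta0 (Formula.bex x t φ)

/-- The class Σ₁ of L_A-formulas. -/
inductive IsSigma1 : Formula → Prop
  | delta0 {φ : Formula} : IsDelta0 φ → IsSigma1 φ
  | and {φ ψ : Formula} : IsSigma1 φ → IsSigma1 ψ → IsSigma1 (φ.and ψ)
  | or {φ ψ : Formula} : IsSigma1 φ → IsSigma1 ψ → IsSigma1 (φ.or ψ)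
  | ex {x : ℕ} {φ : Formula} : IsSigma1 φ → IsSigma1 (Formula.ex x φ)
  | ball {x : ℕ} {t : Term} {φ : Formula} :
      x ∉ t.fv → IsSigma1 φ → IsSigma1 (Formula.ball x t φ)

/-- The class B of boxed formulas. -/
def IsB (φ : Formula) : Prop := ∃ ψ : Formula, φ = Formula.box ψ

/-- The class ΔB. -/
inductive IsDeltaB : Formula → Prop
  | delta0 {φ : Formula} : IsDelta0 φ → IsDeltaB φ
  | b (ψ : Formula) : IsDeltaB (Formula.box ψ)
  | and {φ ψ : Formula} : IsDeltaB φ → IsDeltaB ψ → IsDeltaB (φ.and ψ)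
  | or {φ ψ : Formula} : IsDeltaB φ → IsDeltaB ψ → IsDeltaB (φ.or ψ)
  | ball {x : ℕ} {t : Term} {φ : Formula} :
      x ∉ t.fv → IsDeltaB φ → IsDeltaB (Formula.ball x t φ)
  | bex {x : ℕ} {t : Term} {φ : Formula} :
      x ∉ t.fv → IsDeltaB φ → IsDeltaB (Formula.bex x t φ)

/-- The class ΣB. -/
inductive IsSigmaB : Formula → Prop
  | sigma1 {φ : Formula} : IsSigma1 φ → IsSigmaB φ
  | b (ψ : Formula) : IsSigmaB (Formula.box ψ)
  | and {φ ψ : Formula} : IsSigmaB φ → IsSigmaB ψ → IsSigmaB (φ.and ψ)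
  | or {φ ψ : Formula} : IsSigmaB φ → IsSigmaB ψ → IsSigmaB (φ.or ψ)
  | ex {x : ℕ} {φ : Formula} : IsSigmaB φ → IsSigmaB (Formula.ex x φ)
  | ball {x : ℕ} {t : Term} {φ : Formula} :
      x ∉ t.fv → IsSigmaB φ → IsSigmaB (Formula.ball x t φ)

/-- Iterated disjunction (the empty disjunction is ⊥). -/
def disj : List Formula → Formula
  | [] => Formula.falsum
  | [φ] => φ
  | φ :: ψ :: l => φ.or (disj (ψ :: l))

/-- Iterated conjunction (the empty conjunction is ⊤). -/
def conj : List Formula → Formula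
  | [] => Formula.falsum.neg
  | [φ] => φ
  | φ :: ψ :: l => φ.and (conj (ψ :: l))

/-- Γ-disjunction property. -/
def HasDP (T : Set Formula) (Γ : Formula → Prop) : Prop :=
  ∀ φ ψ : Formula, Γ φ → Γ ψ → Sentence φ → Sentence ψ →
    Provable T (φ.or ψ) → Provable T φ ∨ Provable T ψ

/-- (Γ, Θ)-disjunction property. -/
def HasDP2 (T : Set Formula) (Γ Θ : Formula → Prop) : Prop :=
  ∀ φ ψ : Formula, Γ φ → Θ ψ → Sentence φ → Sentence ψ →
    Provable T (φ.or ψ) → Provable T φ ∨ Provable T ψ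

/-- Γ-existence property. -/
def HasEP (T : Set Formula) (Γ : Formula → Prop) : Prop :=
  ∀ (x : ℕ) (φ : Formula), Γ φ → φ.fv ⊆ {x} →
    Provable T (Formula.ex x φ) → ∃ n : ℕ, Provable T (φ.subst x (Term.numeral n))

/-- Modal disjunction property. -/
def HasMDP (T : Set Formula) : Prop :=
  ∀ φ ψ : Formula, Sentence φ → Sentence ψ →
    Provable T ((Formula.box φ).or (Formula.box ψ)) → Provable T φ ∨ Provable T ψ

/-- Modal existence property. -/
def HasMEP (T : Set Formula) : Prop :=
  ∀ (x : ℕ) (φ : Formula), φ.fv ⊆ {x} →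
    Provable T (Formula.ex x (Formula.box φ)) →
      ∃ n : ℕ, Provable T (φ.subst x (Term.numeral n))

/-- n-fold B-disjunction property. -/
def HasBnDP (T : Set Formula) (n : ℕ) : Prop :=
  ∀ φ : Fin n → Formula, (∀ i, Sentence (φ i)) →
    Provable T (disj (List.ofFn fun i => Formula.box (φ i))) →
    ∃ i, Provable T (Formula.box (φ i))

/-- Σ₁-soundness. -/
def Sigma1Sound (T : Set Formula) : Prop :=
  ∀ φ : Formula, IsSigma1 φ → Sentence φ → Provable T φ → StdTrue φ

/-- L_A-soundness. -/
def LASound (T : Set Formula) : Prop :=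
  ∀ φ : Formula, φ.noBox → Sentence φ → Provable T φ → StdTrue φ

/-- `T` is recursively enumerable (via the Gödel numbering of formulas). -/
def RE (T : Set Formula) : Prop :=
  Nat.Partrec fun n => Part.assert (∃ φ ∈ T, Formula.code φ = n) fun _ => Part.some 0

/-- A fixed natural Σ₁ provability predicate `Pr_T(x)` for the theory `T`:
a Σ₁ L_A-formula with only the free variable `0` which numerates provability in `T`
in the standard model and satisfies the standard derivability conditions
(provably in PA). -/
structure ProvPred (T : Set Formula) where
  pr : Formula
  noBox : pr.noBox
  sigma1 : IsSigma1 pr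
  fvSub : pr.fv ⊆ {0}
  numerates : ∀ φ : Formula,
    StdTrue (pr.subst 0 (Term.numeral φ.code)) ↔ Provable T φ
  d1 : ∀ φ : Formula, Provable T φ → FOProvable PA (pr.subst 0 (Term.numeral φ.code))
  d2 : ∀ φ ψ : Formula,
    FOProvable PA ((pr.subst 0 (Term.numeral (φ.imp ψ).code)).imp
      ((pr.subst 0 (Term.numeral φ.code)).imp (pr.subst 0 (Term.numeral ψ.code))))
  necClosed : ∀ φ : Formula,
    FOProvable PA ((pr.subst 0 (Term.numeral φ.code)).imp
      (pr.subst 0 (Term.numeral (Formula.box φ).code)))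

/-- `Pr_T(⌜φ⌝)`. -/
def ProvPred.app {T : Set Formula} (P : ProvPred T) (φ : Formula) : Formula :=
  P.pr.subst 0 (Term.numeral φ.code)

/-- Γ-disjunctive correctness (Γ-DC). -/
def DC (T : Set Formula) (P : ProvPred T) (Γ : Formula → Prop) : Prop :=
  ∀ φ : Formula, Γ φ → Sentence φ → Provable T (φ.or (P.app φ)) → Provable T φ

/-- The substitution replacing each variable by the numeral of its value. -/
def numeralSubst (v : ℕ → ℕ) : ℕ → Term := fun x => Term.numeral (v x)

/-- Standard-model satisfaction of the ρ_T-translation: `ρ_T` is the identity on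
L_A-formulas, commutes with connectives and quantifiers, and sends `□φ(x⃗)` to
`Pr_T(⌜□φ(ẋ⃗)⌝)`, whose truth in ℕ (for a natural provability predicate) amounts to
provability in `T` of `□φ(n̄⃗)`. -/
def RhoSat (T : Set Formula) : Formula → (ℕ → ℕ) → Prop
  | .falsum, _ => False
  | .eq t u, v => t.val v = u.val v
  | .le t u, v => t.val v ≤ u.val v
  | .and φ ψ, v => RhoSat T φ v ∧ RhoSat T ψ v
  | .or φ ψ, v => RhoSat T φ v ∨ RhoSat T ψ v
  | .imp φ ψ, v => RhoSat T φ v → RhoSat T ψ v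
  | .neg φ, v => ¬ RhoSat T φ v
  | .all x φ, v => ∀ n : ℕ, RhoSat T φ (Function.update v x n)
  | .ex x φ, v => ∃ n : ℕ, RhoSat T φ (Function.update v x n)
  | .box φ, v => Provable T (Formula.box (φ.substAll (numeralSubst v)))

/-- Standard-model satisfaction of the π_T-translation: `π_T` is the identity on
L_A-formulas, commutes with connectives and quantifiers, and sends `□φ(x⃗)` to
`Pr_T(⌜φ(ẋ⃗)⌝)`, whose truth in ℕ (for a natural provability predicate) amounts to
provability in `T` of `φ(n̄⃗)`. -/
def PiSat (T : Set Formula) : Formula → (ℕ → ℕ) → Prop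
  | .falsum, _ => False
  | .eq t u, v => t.val v = u.val v
  | .le t u, v => t.val v ≤ u.val v
  | .and φ ψ, v => PiSat T φ v ∧ PiSat T ψ v
  | .or φ ψ, v => PiSat T φ v ∨ PiSat T ψ v
  | .imp φ ψ, v => PiSat T φ v → PiSat T ψ v
  | .neg φ, v => ¬ PiSat T φ v
  | .all x φ, v => ∀ n : ℕ, PiSat T φ (Function.update v x n)
  | .ex x φ, v => ∃ n : ℕ, PiSat T φ (Function.update v x n)
  | .box φ, v => Provable T (φ.substAll (numeralSubst v))

/-- Weak ΣB-soundness: every provable ΣB sentence is true in ℕ under ρ_T. -/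
def WeaklySigmaBSound (T : Set Formula) : Prop :=
  ∀ φ : Formula, IsSigmaB φ → Sentence φ → Provable T φ → RhoSat T φ fun _ => 0

/-- ΣB-soundness: every provable ΣB sentence is true in ℕ under π_T. -/
def SigmaBSound (T : Set Formula) : Prop :=
  ∀ φ : Formula, IsSigmaB φ → Sentence φ → Provable T φ → PiSat T φ fun _ => 0

end ModalArith


namespace ModalArith

infix:45 "⊩" => Provable

/-! ### Substitution lemmas -/

theorem Term.substAll_congr (t : Term) (v w : ℕ → Term) (h : ∀ i ∈ t.fv, v i = w i) :
    t.substAll v = t.substAll w := by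
  induction t with
  | var x => exact h x (by simp [Term.fv])
  | zero => rfl
  | succ t ih => simp [Term.substAll, ih h]
  | add t u iht ihu =>
    simp only [Term.substAll]
    rw [iht fun i hi => h i (by simp [Term.fv, hi]), ihu fun i hi => h i (by simp [Term.fv, hi])]
  | mul t u iht ihu =>
    simp only [Term.substAll]
    rw [iht fun i hi => h i (by simp [Term.fv, hi]), ihu fun i hi => h i (by simp [Term.fv, hi])]

theorem Term.substAll_var (t : Term) : t.substAll Term.var = t := by
  induction t <;> simp_all [Term.substAll]

theorem Term.substAll_comp (t : Term) (v w : ℕ → Term) :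
    (t.substAll v).substAll w = t.substAll (fun i => (v i).substAll w) := by
  induction t <;> simp_all [Term.substAll]

theorem Term.subst_not_fv {t : Term} {x : ℕ} (s : Term) (h : x ∉ t.fv) : Term.subst x s t = t := by
  unfold Term.subst
  rw [Term.substAll_congr t _ Term.var, Term.substAll_var]
  intro i hi
  rw [Function.update_of_ne]
  rintro rfl
  exact h hi

theorem Formula.substAll_congr (φ : Formula) : ∀ (v w : ℕ → Term) (_ : ∀ i ∈ φ.fv, v i = w i),
    φ.substAll v = φ.substAll w := by
  induction φ with
  | falsum => intros; rfl
  | eq t u =>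
    intro v w h
    simp only [Formula.substAll]
    rw [t.substAll_congr v w fun i hi => h i (by simp [Formula.fv, hi]),
      u.substAll_congr v w fun i hi => h i (by simp [Formula.fv, hi])]
  | le t u =>
    intro v w h
    simp only [Formula.substAll]
    rw [t.substAll_congr v w fun i hi => h i (by simp [Formula.fv, hi]),
      u.substAll_congr v w fun i hi => h i (by simp [Formula.fv, hi])]
  | and φ ψ ih1 ih2 | or φ ψ ih1 ih2 | imp φ ψ ih1 ih2 =>
    intro v w h
    simp only [Formula.substAll]
    rw [ih1 v w fun i hi => h i (by simp [Formula.fv, hi]),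
      ih2 v w fun i hi => h i (by simp [Formula.fv, hi])]
  | neg φ ih | box φ ih =>
    intro v w h
    simp only [Formula.substAll]
    rw [ih v w h]
  | all x φ ih | ex x φ ih =>
    intro v w h
    simp only [Formula.substAll]
    rw [ih _ (Function.update w x (Term.var x))]
    intro i hi
    by_cases hx : i = x
    · subst hx; simp
    · rw [Function.update_of_ne hx, Function.update_of_ne hx]
      exact h i (by simp [Formula.fv, hi, hx])

theorem Formula.substAll_var (φ : Formula) : φ.substAll Term.var = φ := by
  induction φ <;> simp_all [Formula.substAll, Term.substAll_var]

theorem Formula.subst_self (φ : Formula) (x : ℕ) : φ.subst x (Term.var x) = φ := by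
  unfold Formula.subst
  rw [Function.update_eq_self, Formula.substAll_var]

theorem Formula.subst_not_fv {φ : Formula} {x : ℕ} (s : Term) (h : x ∉ φ.fv) :
    φ.subst x s = φ := by
  unfold Formula.subst
  rw [φ.substAll_congr _ Term.var, Formula.substAll_var]
  intro i hi
  rw [Function.update_of_ne]
  rintro rfl
  exact h hi

theorem Formula.freeFor_self (φ : Formula) (x : ℕ) : φ.freeFor (Term.var x) x := by
  induction φ with
  | all y φ ih | ex y φ ih =>
    by_cases h : x = y
    · exact Or.inl h
    · exact Or.inr (Or.inr ⟨by simp [Term.fv]; exact fun h' => h h'.symm, ih⟩)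
  | _ => simp_all [Formula.freeFor]

theorem Formula.freeFor_not_fv {φ : Formula} {x : ℕ} (s : Term) (h : x ∉ φ.fv) :
    φ.freeFor s x := by
  induction φ with
  | all y φ ih | ex y φ ih =>
    by_cases h' : x = y
    · exact Or.inl h'
    · refine Or.inr (Or.inl ?_)
      intro hx
      exact h (by simp [Formula.fv, hx, h'])
  | _ => simp_all [Formula.freeFor, Formula.fv]

theorem Formula.freeFor_closed (φ : Formula) (x : ℕ) {s : Term} (h : s.fv = ∅) :
    φ.freeFor s x := by
  induction φ with
  | all y φ ih | ex y φ ih => exact Or.inr (Or.inr ⟨by simp [h], ih⟩)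
  | _ => simp_all [Formula.freeFor]

theorem Formula.subst_and (φ ψ : Formula) (x s) :
    (φ.and ψ).subst x s = (φ.subst x s).and (ψ.subst x s) := rfl
theorem Formula.subst_or (φ ψ : Formula) (x s) :
    (φ.or ψ).subst x s = (φ.subst x s).or (ψ.subst x s) := rfl
theorem Formula.subst_imp (φ ψ : Formula) (x s) :
    (φ.imp ψ).subst x s = (φ.subst x s).imp (ψ.subst x s) := rfl
theorem Formula.subst_neg (φ : Formula) (x s) :
    (φ.neg).subst x s = (φ.subst x s).neg := rfl
theorem Formula.subst_box (φ : Formula) (x s) :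
    (φ.box).subst x s = (φ.subst x s).box := rfl
theorem Formula.subst_eq (t u : Term) (x s) :
    (Formula.eq t u).subst x s = Formula.eq (Term.subst x s t) (Term.subst x s u) := rfl
theorem Formula.subst_le (t u : Term) (x s) :
    (Formula.le t u).subst x s = Formula.le (Term.subst x s t) (Term.subst x s u) := rfl
theorem Formula.subst_lt (t u : Term) (x s) :
    (Formula.lt t u).subst x s = Formula.lt (Term.subst x s t) (Term.subst x s u) := rfl
theorem Formula.subst_all_ne (φ : Formula) {x y : ℕ} (s) (h : x ≠ y) :
    (Formula.all y φ).subst x s = Formula.all y (φ.subst x s) := by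
  unfold Formula.subst
  simp only [Formula.substAll]
  congr 2
  funext i
  by_cases hi : i = y
  · subst hi; simp [Function.update_of_ne (Ne.symm h)]
  · rw [Function.update_of_ne hi]
theorem Formula.subst_ex_ne (φ : Formula) {x y : ℕ} (s) (h : x ≠ y) :
    (Formula.ex y φ).subst x s = Formula.ex y (φ.subst x s) := by
  unfold Formula.subst
  simp only [Formula.substAll]
  congr 2
  funext i
  by_cases hi : i = y
  · subst hi; simp [Function.update_of_ne (Ne.symm h)]
  · rw [Function.update_of_ne hi]
theorem Term.subst_var_self (x s) : Term.subst x s (Term.var x) = s := by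
  simp [Term.subst, Term.substAll]
theorem Term.subst_var_ne {x y : ℕ} (s) (h : y ≠ x) : Term.subst x s (Term.var y) = Term.var y := by
  simp [Term.subst, Term.substAll, h]
theorem Term.subst_succ (t : Term) (x s) : Term.subst x s t.succ = (Term.subst x s t).succ := rfl
theorem Term.subst_add (t u : Term) (x s) :
    Term.subst x s (t.add u) = (Term.subst x s t).add (Term.subst x s u) := rfl
theorem Term.numeral_fv (n : ℕ) : (Term.numeral n).fv = ∅ := by
  induction n with
  | zero => rfl
  | succ n ih => exact ih

theorem Formula.fv_ball (x t φ) (h : x ∉ Term.fv t) :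
    (Formula.ball x t φ).fv = t.fv ∪ φ.fv.erase x := by
  ext i
  simp only [Formula.ball, Formula.lt, Formula.fv, Term.fv, Finset.mem_erase, Finset.mem_union,
    Finset.mem_singleton]
  constructor
  · tauto
  · rintro (h1 | h1)
    · refine ⟨?_, by tauto⟩
      rintro rfl; exact h h1
    · tauto

theorem Formula.fv_bex (x t φ) (h : x ∉ Term.fv t) :
    (Formula.bex x t φ).fv = t.fv ∪ φ.fv.erase x := by
  ext i
  simp only [Formula.bex, Formula.lt, Formula.fv, Term.fv, Finset.mem_erase, Finset.mem_union,
    Finset.mem_singleton]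
  constructor
  · tauto
  · rintro (h1 | h1)
    · refine ⟨?_, by tauto⟩
      rintro rfl; exact h h1
    · tauto

/-! ### Propositional completeness -/

/-- Propositional evaluation: everything but connectives is an atom. -/
def pval (a : Formula → Prop) : Formula → Prop
  | .falsum => False
  | .and φ ψ => pval a φ ∧ pval a ψ
  | .or φ ψ => pval a φ ∨ pval a ψ
  | .imp φ ψ => pval a φ → pval a ψ
  | .neg φ => ¬ pval a φ
  | .eq t u => a (.eq t u)
  | .le t u => a (.le t u)
  | .all x φ => a (.all x φ)
  | .ex x φ => a (.ex x φ)
  | .box φ => a (.box φ)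

/-- The list of propositional atoms of a formula. -/
def patoms : Formula → List Formula
  | .falsum => []
  | .and φ ψ => patoms φ ++ patoms ψ
  | .or φ ψ => patoms φ ++ patoms ψ
  | .imp φ ψ => patoms φ ++ patoms ψ
  | .neg φ => patoms φ
  | φ => [φ]

open Classical in
/-- Implication from the literals over a list of atoms. -/
noncomputable def litImp (a : Formula → Prop) : List Formula → Formula → Formula
  | [], φ => φ
  | p :: L, φ => (if a p then p else p.neg).imp (litImp a L φ)

section prop
variable {T : Set Formula}

theorem pr_K {φ ψ : Formula} (h : T ⊩ ψ) : T ⊩ φ.imp ψ := .mp (.logic (.imp1 _ _)) h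
theorem pr_S {φ ψ χ : Formula} (h1 : T ⊩ φ.imp (ψ.imp χ)) (h2 : T ⊩ φ.imp ψ) : T ⊩ φ.imp χ :=
  .mp (.mp (.logic (.imp2 _ _ _)) h1) h2
theorem pr_id (φ : Formula) : T ⊩ φ.imp φ := pr_S (ψ := φ.imp φ) (.logic (.imp1 _ _)) (.logic (.imp1 _ _))
theorem pr_trans {φ ψ χ : Formula} (h1 : T ⊩ φ.imp ψ) (h2 : T ⊩ ψ.imp χ) : T ⊩ φ.imp χ :=
  pr_S (pr_K h2) h1

theorem lit_mp (a : Formula → Prop) (L : List Formula) {φ ψ : Formula}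
    (h1 : T ⊩ litImp a L (φ.imp ψ)) (h2 : T ⊩ litImp a L φ) : T ⊩ litImp a L ψ := by
  have key : ∀ L, T ⊩ (litImp a L (φ.imp ψ)).imp ((litImp a L φ).imp (litImp a L ψ)) := by
    intro L
    induction L with
    | nil => exact pr_id _
    | cons p L ih =>
      simp only [litImp]
      -- (l → A) → (l → B) → (l → C) from A → B → C
      generalize (@ite _ (a p) (Classical.propDecidable _) p p.neg) = l
      have h3 : T ⊩ (l.imp (litImp a L (φ.imp ψ))).imp (l.imp ((litImp a L φ).imp (litImp a L ψ))) :=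
        .mp (.logic (.imp2 _ _ _)) (pr_K ih)
      exact pr_trans h3 (.logic (.imp2 _ _ _))
  exact .mp (.mp (key L) h1) h2

theorem lit_of (a : Formula → Prop) (L : List Formula) {φ : Formula} (h : T ⊩ φ) :
    T ⊩ litImp a L φ := by
  induction L with
  | nil => exact h
  | cons p L ih => exact pr_K ih

theorem lit_mem (a : Formula → Prop) (L : List Formula) {p : Formula} (h : p ∈ L) :
    (a p → T ⊩ litImp a L p) ∧ (¬ a p → T ⊩ litImp a L p.neg) := by
  have weak : ∀ (L : List Formula) (φ : Formula), T ⊩ φ.imp (litImp a L φ) := by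
    intro L φ
    induction L with
    | nil => exact pr_id _
    | cons q L ih => exact pr_trans ih (.logic (.imp1 _ _))
  induction L with
  | nil => simp at h
  | cons q L ih =>
    rcases List.mem_cons.1 h with rfl | h
    · constructor
      · intro ha; simp only [litImp, ha, if_true]; exact weak _ _
      · intro ha; simp only [litImp, ha, if_false]; exact weak _ _
    · exact ⟨fun ha => pr_K ((ih h).1 ha), fun ha => pr_K ((ih h).2 ha)⟩

theorem kalmar (a : Formula → Prop) (L : List Formula) (φ : Formula) (h : ∀ p ∈ patoms φ, p ∈ L) :
    (pval a φ → T ⊩ litImp a L φ) ∧ (¬ pval a φ → T ⊩ litImp a L φ.neg) := by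
  have ax : ∀ {φ}, LogicalAxiom φ → T ⊩ litImp a L φ := fun h => lit_of a L (.logic h)
  have negI : ∀ {φ ψ : Formula}, T ⊩ litImp a L (φ.imp ψ) → T ⊩ litImp a L ψ.neg →
      T ⊩ litImp a L φ.neg := by
    intro φ ψ h1 h2
    exact lit_mp _ _ (lit_mp _ _ (ax (.negI _ _)) h1) (lit_mp _ _ (ax (.imp1 _ _)) h2)
  induction φ with
  | falsum =>
    refine ⟨fun h => h.elim, fun _ => lit_mp _ _ (ax (.negIntro _)) (lit_of _ _ (pr_id _))⟩
  | and φ ψ ih1 ih2 =>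
    have ih1 := ih1 fun p hp => h p (by simp [patoms, hp])
    have ih2 := ih2 fun p hp => h p (by simp [patoms, hp])
    constructor
    · rintro ⟨h1, h2⟩
      exact lit_mp _ _ (lit_mp _ _ (ax (.andI _ _)) (ih1.1 h1)) (ih2.1 h2)
    · intro hn
      by_cases h1 : pval a φ
      · exact negI (ax (.andE2 _ _)) (ih2.2 fun h2 => hn ⟨h1, h2⟩)
      · exact negI (ax (.andE1 _ _)) (ih1.2 h1)
  | or φ ψ ih1 ih2 =>
    have ih1 := ih1 fun p hp => h p (by simp [patoms, hp])
    have ih2 := ih2 fun p hp => h p (by simp [patoms, hp])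
    constructor
    · rintro (h1 | h1)
      · exact lit_mp _ _ (ax (.orI1 _ _)) (ih1.1 h1)
      · exact lit_mp _ _ (ax (.orI2 _ _)) (ih2.1 h1)
    · intro hn
      have h1 := ih1.2 fun h1 => hn (Or.inl h1)
      have h2 := ih2.2 fun h1 => hn (Or.inr h1)
      refine lit_mp _ _ (ax (.negIntro _)) ?_
      exact lit_mp _ _ (lit_mp _ _ (ax (.orE _ _ _)) (lit_mp _ _ (ax (.negElimFalsum _)) h1))
        (lit_mp _ _ (ax (.negElimFalsum _)) h2)
  | imp φ ψ ih1 ih2 =>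
    have ih1 := ih1 fun p hp => h p (by simp [patoms, hp])
    have ih2 := ih2 fun p hp => h p (by simp [patoms, hp])
    constructor
    · intro h1
      by_cases h2 : pval a φ
      · exact lit_mp _ _ (ax (.imp1 _ _)) (ih2.1 (h1 h2))
      · exact lit_mp _ _ (ax (.negE _ _)) (ih1.2 h2)
    · intro hn
      have h1 : pval a φ := by by_contra h'; exact hn fun h => (h' h).elim
      have h2 : ¬ pval a ψ := fun h' => hn fun _ => h'
      refine negI (ψ := ψ) ?_ (ih2.2 h2)
      refine lit_mp _ _ (lit_mp _ _ (ax (.imp2 _ _ _)) (lit_of _ _ (pr_id _))) ?_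
      exact lit_mp _ _ (ax (.imp1 _ _)) (ih1.1 h1)
  | neg φ ih =>
    have ih := ih h
    constructor
    · intro h1; exact ih.2 h1
    · intro h1
      have h1 : pval a φ := by by_contra h'; exact h1 h'
      refine lit_mp _ _ (ax (.negIntro _)) ?_
      refine lit_mp _ _ (lit_mp _ _ (ax (.imp2 _ _ _)) (ax (.negElimFalsum _))) ?_
      exact lit_mp _ _ (ax (.imp1 _ _)) (ih.1 h1)
  | eq t u | le t u | all x φ | ex x φ | box φ =>
    exact lit_mem a L (h _ (by simp [patoms]))

theorem lit_congr (a b : Formula → Prop) (L : List Formula) (φ : Formula)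
    (h : ∀ p ∈ L, a p ↔ b p) : litImp a L φ = litImp b L φ := by
  induction L with
  | nil => rfl
  | cons p L ih =>
    simp only [litImp]
    rw [ih fun q hq => h q (by simp [hq])]
    have := h p (by simp)
    by_cases ha : a p
    · rw [if_pos ha, if_pos (this.1 ha)]
    · rw [if_neg ha, if_neg fun hb => ha (this.2 hb)]

theorem by_cases_rule {p φ : Formula} (h1 : T ⊩ p.imp φ) (h2 : T ⊩ p.neg.imp φ) : T ⊩ φ := by
  have e : ∀ {φ}, LogicalAxiom φ → T ⊩ φ := fun h => .logic h
  refine .mp (e (.dne _)) ?_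
  have c1 : T ⊩ φ.neg.imp p.neg := by
    have : T ⊩ (p.imp φ.neg).imp p.neg := .mp (e (.negI _ _)) h1
    exact pr_trans (e (.imp1 _ _)) this
  have c2 : T ⊩ φ.neg.imp φ := pr_trans c1 h2
  exact .mp (.mp (e (.negI _ _)) c2) (pr_id _)

theorem lit_elim (L : List Formula) (hL : L.Nodup) (φ : Formula)
    (h : ∀ a, T ⊩ litImp a L φ) : T ⊩ φ := by
  induction L with
  | nil => exact h fun _ => True
  | cons p L ih =>
    rw [List.nodup_cons] at hL
    refine ih hL.2 fun a => ?_
    have h1 := h (Function.update a p True)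
    have h2 := h (Function.update a p False)
    simp only [litImp, Function.update_self, if_true, if_false] at h1 h2
    rw [lit_congr _ a L] at h1 h2
    · exact by_cases_rule h1 h2
    all_goals
      intro q hq
      rw [Function.update_of_ne]
      rintro rfl
      exact hL.1 hq

/-- Every propositional tautology is provable. -/
theorem taut {φ : Formula} (h : ∀ a, pval a φ) : T ⊩ φ := by
  refine lit_elim (patoms φ).dedup (List.nodup_dedup _) φ fun a => ?_
  exact (kalmar a _ φ fun p hp => List.mem_dedup.2 hp).1 (h a)

theorem tc1 {A B : Formula} (h1 : T ⊩ A) (h : ∀ a, pval a A → pval a B) : T ⊩ B :=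
  .mp (taut h) h1
theorem tc2 {A B C : Formula} (h1 : T ⊩ A) (h2 : T ⊩ B)
    (h : ∀ a, pval a A → pval a B → pval a C) : T ⊩ C :=
  .mp (.mp (taut (φ := A.imp (B.imp C)) h) h1) h2
theorem tc3 {A B C D : Formula} (h1 : T ⊩ A) (h2 : T ⊩ B) (h3 : T ⊩ C)
    (h : ∀ a, pval a A → pval a B → pval a C → pval a D) : T ⊩ D :=
  .mp (.mp (.mp (taut (φ := A.imp (B.imp (C.imp D))) h) h1) h2) h3
theorem tc4 {A B C D E : Formula} (h1 : T ⊩ A) (h2 : T ⊩ B) (h3 : T ⊩ C) (h4 : T ⊩ D)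
    (h : ∀ a, pval a A → pval a B → pval a C → pval a D → pval a E) : T ⊩ E :=
  .mp (tc3 h1 h2 h3 (D := D.imp E) h) h4
theorem tc5 {A B C D E F : Formula} (h1 : T ⊩ A) (h2 : T ⊩ B) (h3 : T ⊩ C) (h4 : T ⊩ D)
    (h5 : T ⊩ E)
    (h : ∀ a, pval a A → pval a B → pval a C → pval a D → pval a E → pval a F) : T ⊩ F :=
  .mp (tc4 h1 h2 h3 h4 (E := E.imp F) h) h5

/-! ### Quantifier rules -/

theorem all_self (x : ℕ) (φ : Formula) : T ⊩ (Formula.all x φ).imp φ := by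
  have := Provable.logic (T := T) (.allE x (.var x) φ (φ.freeFor_self x))
  rwa [φ.subst_self] at this
theorem ex_self (x : ℕ) (φ : Formula) : T ⊩ φ.imp (Formula.ex x φ) := by
  have := Provable.logic (T := T) (.exI x (.var x) φ (φ.freeFor_self x))
  rwa [φ.subst_self] at this
theorem all_intro {x : ℕ} {χ φ : Formula} (hx : x ∉ χ.fv) (h : T ⊩ χ.imp φ) :
    T ⊩ χ.imp (.all x φ) := .mp (.logic (.allImp x χ φ hx)) (.gen x h)
theorem ex_elim {x : ℕ} {χ φ : Formula} (hx : x ∉ χ.fv) (h : T ⊩ φ.imp χ) :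
    T ⊩ (Formula.ex x φ).imp χ := .mp (.logic (.exE x φ χ hx)) (.gen x h)
/-- existential elimination with a side formula -/
theorem ex_elim2 {x : ℕ} {χ φ ψ : Formula} (hx : x ∉ χ.fv) (hx' : x ∉ ψ.fv)
    (h : T ⊩ ψ.imp (φ.imp χ)) :
    T ⊩ ψ.imp ((Formula.ex x φ).imp χ) := by
  have : T ⊩ (Formula.ex x φ).imp (ψ.imp χ) :=
    ex_elim (by simp [Formula.fv, hx, hx']) (tc1 h (by intro a; simp only [pval]; tauto))
  exact tc1 this (by intro a; simp only [pval]; tauto)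
theorem subst_rule {φ : Formula} (x : ℕ) (t : Term) (hf : φ.freeFor t x) (h : T ⊩ φ) :
    T ⊩ φ.subst x t := .mp (.logic (.allE x t φ hf)) (.gen x h)
theorem all_mono {x : ℕ} {φ ψ : Formula} (h : T ⊩ φ.imp ψ) :
    T ⊩ (Formula.all x φ).imp (.all x ψ) :=
  all_intro (by simp [Formula.fv]) (pr_trans (all_self _ _) h)
theorem ex_mono {x : ℕ} {φ ψ : Formula} (h : T ⊩ φ.imp ψ) :
    T ⊩ (Formula.ex x φ).imp (.ex x ψ) :=
  ex_elim (by simp [Formula.fv]) (pr_trans h (ex_self _ _))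
theorem ball_self (x : ℕ) (t : Term) (φ : Formula) :
    T ⊩ (Formula.ball x t φ).imp ((Formula.lt (.var x) t).imp φ) := all_self _ _
theorem bex_self (x : ℕ) (t : Term) (φ : Formula) :
    T ⊩ (Formula.lt (.var x) t).imp (φ.imp (Formula.bex x t φ)) :=
  tc1 (ex_self x ((Formula.lt (.var x) t).and φ))
    (by intro a; simp only [pval, Formula.bex]; tauto)

/-- Introduce a fresh variable equal to a given term. -/
theorem eq_intro {x : ℕ} {t : Term} {χ : Formula} (hx : x ∉ χ.fv) (ht : x ∉ t.fv)
    (h : T ⊩ (Formula.eq (.var x) t).imp χ) : T ⊩ χ := by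
  refine .mp (ex_elim hx h) ?_
  refine .mp (.logic (.exI x t _ trivial)) ?_
  rw [Formula.subst_eq, Term.subst_var_self, Term.subst_not_fv _ ht]
  exact .logic (.eqRefl t)

/-! ### Instantiation of quantifier-free theorems -/

/-- Quantifier-free formulas (boxes allowed). -/
def QF : Formula → Prop
  | .falsum => True
  | .eq _ _ => True
  | .le _ _ => True
  | .and φ ψ => QF φ ∧ QF ψ
  | .or φ ψ => QF φ ∧ QF ψ
  | .imp φ ψ => QF φ ∧ QF ψ
  | .neg φ => QF φ
  | .all _ _ => False
  | .ex _ _ => False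
  | .box φ => QF φ

theorem QF.freeFor {φ : Formula} (h : QF φ) (t : Term) (x : ℕ) : φ.freeFor t x := by
  induction φ <;> simp_all [QF, Formula.freeFor]
theorem QF.substAll {φ : Formula} (h : QF φ) (v) : QF (φ.substAll v) := by
  induction φ <;> simp_all [QF, Formula.substAll]
theorem QF.comp {φ : Formula} (h : QF φ) (v w) :
    (φ.substAll v).substAll w = φ.substAll (fun i => (v i).substAll w) := by
  induction φ <;> simp_all [QF, Formula.substAll, Term.substAll_comp]

theorem inst_seq {φ : Formula} (h : QF φ) (hp : T ⊩ φ) (c : ℕ) (v : ℕ → Term)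
    (hv : ∀ i j, c ≤ j → j ∈ (v i).fv → False) (N : ℕ) (hN : N ≤ c) :
    T ⊩ φ.substAll (fun i => if i < N then .var (c + i) else .var i) ∧
    ((∀ i ∈ φ.fv, i < c) → ∀ k, k ≤ c → T ⊩ φ.substAll
      (fun i => if i < k then v i else .var (c + i))) := by
  have first : ∀ N ≤ c, T ⊩ φ.substAll (fun i => if i < N then .var (c + i) else .var i) := by
    intro N hN
    induction N with
    | zero =>
      have : (fun i => if i < 0 then Term.var (c + i) else Term.var i) = Term.var := by
        funext i; simp
      rw [this, Formula.substAll_var]; exact hp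
    | succ N ih =>
      have := subst_rule N (.var (c + N)) ((h.substAll _).freeFor _ _) (ih (by omega))
      unfold Formula.subst at this
      rw [h.comp] at this
      convert this using 2
      funext i
      rcases lt_trichotomy i N with h1 | h1 | h1
      · have : c + i ≠ N := by omega
        simp [h1, Nat.lt_succ_of_lt h1, Term.substAll, this]
      · subst h1; simp [Term.substAll]
      · have h2 : ¬ i < N := by omega
        have h3 : ¬ i < N + 1 := by omega
        have h4 : i ≠ N := by omega
        simp [h2, h3, Term.substAll, h4]
  refine ⟨first N hN, fun hφ k hk => ?_⟩
  induction k with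
  | zero =>
    rw [φ.substAll_congr _ (fun i => if i < c then Term.var (c + i) else Term.var i)]
    · exact first c le_rfl
    · intro i hi; simp [hφ i hi]
  | succ k ih =>
    have := subst_rule (c + k) (v k) ((h.substAll _).freeFor _ _) (ih (by omega))
    unfold Formula.subst at this
    rw [h.comp] at this
    convert this using 2
    funext i
    rcases lt_trichotomy i k with h1 | h1 | h1
    · simp only [h1, Nat.lt_succ_of_lt h1, if_true]
      rw [Term.substAll_congr _ _ Term.var, Term.substAll_var]
      intro j hj
      rw [Function.update_of_ne]
      rintro rfl
      exact hv i _ (by omega) hj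
    · subst h1; simp [Term.substAll]
    · have h2 : ¬ i < k := by omega
      have h3 : ¬ i < k + 1 := by omega
      have h4 : i ≠ k := by omega
      simp [h2, h3, Term.substAll, h4]

/-- The valuation of the first three variables. -/
def v3 (t u w : Term) : ℕ → Term
  | 0 => t
  | 1 => u
  | 2 => w
  | _ => .zero

theorem exists_bound (s : Finset ℕ) : ∃ c, ∀ i ∈ s, i < c :=
  ⟨s.sup id + 1, fun i hi => Nat.lt_succ_of_le (Finset.le_sup (f := id) hi)⟩

theorem inst3 {φ : Formula} (hp : T ⊩ φ) (t u w : Term) (h : QF φ) (hf : ∀ i ∈ φ.fv, i < 3) :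
    T ⊩ φ.substAll (v3 t u w) := by
  obtain ⟨c, hc⟩ := exists_bound ({0, 1, 2} ∪ (t.fv ∪ u.fv ∪ w.fv))
  have h2 : 2 < c := hc 2 (by simp)
  have := (inst_seq h hp c (v3 t u w) ?_ 0 (by omega)).2 (fun i hi => by have := hf i hi; omega) c le_rfl
  · rw [φ.substAll_congr _ (fun i => if i < c then v3 t u w i else .var (c + i))]
    · exact this
    · intro i hi
      have := hf i hi
      have : i < c := by omega
      simp [this]
  · intro i j hj hi
    match i with
    | 0 => have := hc j (by simp [v3] at hi; simp [hi]); omega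
    | 1 => have := hc j (by simp [v3] at hi; simp [hi]); omega
    | 2 => have := hc j (by simp [v3] at hi; simp [hi]); omega
    | n + 3 => simp [v3, Term.fv] at hi

end prop

end ModalArith


namespace ModalArith

section arith
variable {T : Set Formula}


theorem ind (hT : Extends T PAK) (x : ℕ) {φ : Formula} (h0 : T ⊩ φ.subst x .zero)
    (h1 : T ⊩ φ.imp (φ.subst x (.succ (.var x)))) : T ⊩ φ := by
  have : T ⊩ inductionAx x φ := hT _ (Or.inl (Or.inr ⟨x, φ, rfl⟩))
  exact .mp (all_self x φ) (.mp this (tc2 h0 (.gen x h1) (by intro a; simp only [pval]; tauto)))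

theorem base (hT : Extends T PAK) {φ : Formula} (h : φ ∈ baseAxioms) : T ⊩ φ :=
  hT _ (Or.inl (Or.inl h))

theorem succ_ne_zero' (hT : Extends T PAK) (t : Term) : T ⊩ (Formula.eq t.succ .zero).neg :=
  inst3 (base hT (φ := succNeZero) (by simp [baseAxioms])) t .zero .zero trivial (by decide)
theorem succ_inj' (hT : Extends T PAK) (t u : Term) :
    T ⊩ (Formula.eq t.succ u.succ).imp (Formula.eq t u) :=
  inst3 (base hT (φ := succInj) (by simp [baseAxioms])) t u .zero ⟨trivial, trivial⟩ (by decide)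
theorem add_zero' (hT : Extends T PAK) (t : Term) : T ⊩ Formula.eq (t.add .zero) t :=
  inst3 (base hT (φ := addZero) (by simp [baseAxioms])) t .zero .zero trivial (by decide)
theorem add_succ' (hT : Extends T PAK) (t u : Term) :
    T ⊩ Formula.eq (t.add u.succ) (t.add u).succ :=
  inst3 (base hT (φ := addSucc) (by simp [baseAxioms])) t u .zero trivial (by decide)
theorem mul_zero' (hT : Extends T PAK) (t : Term) : T ⊩ Formula.eq (t.mul .zero) .zero :=
  inst3 (base hT (φ := mulZero) (by simp [baseAxioms])) t .zero .zero trivial (by decide)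
theorem mul_succ' (hT : Extends T PAK) (t u : Term) :
    T ⊩ Formula.eq (t.mul u.succ) ((t.mul u).add t) :=
  inst3 (base hT (φ := mulSucc) (by simp [baseAxioms])) t u .zero trivial (by decide)

theorem le_intro (hT : Extends T PAK) (t w u : Term) :
    T ⊩ (Formula.eq (t.add w) u).imp (.le t u) := by
  have h : T ⊩ leDef := base hT (by simp [baseAxioms])
  have h2 : T ⊩ (Formula.eq ((Term.var 0).add (Term.var 2)) (Term.var 1)).imp (.le (Term.var 0) (Term.var 1)) :=
    tc2 h (ex_self 2 _) (by intro a; simp only [pval, leDef, Formula.iff]; tauto)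
  exact inst3 h2 t u w ⟨trivial, trivial⟩ (by decide)

theorem le_ex (hT : Extends T PAK) (t u : Term) (z : ℕ) (hz : z ∉ t.fv) (hz' : z ∉ u.fv) :
    T ⊩ (Formula.le t u).imp (.ex z (.eq (t.add (.var z)) u)) := by
  obtain ⟨c, hc⟩ := exists_bound ({0, 1, 2, z} ∪ (t.fv ∪ u.fv))
  have c0 : 0 < c := hc 0 (by simp)
  have c1 : 1 < c := hc 1 (by simp)
  have c2 : 2 < c := hc 2 (by simp)
  have cz : z < c := hc z (by simp)
  have ct : ∀ i, c ≤ i → i ∉ t.fv := fun i hi h => by have := hc i (by simp [h]); omega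
  have h : T ⊩ leDef := base hT (by simp [baseAxioms])
  have h1 : T ⊩ (Formula.le (Term.var 0) (Term.var 1)).imp (.ex 2 (.eq ((Term.var 0).add (Term.var 2)) (Term.var 1))) :=
    tc1 h (by intro a; simp only [pval, leDef, Formula.iff]; tauto)
  have h2 := subst_rule 0 (.var c) (by
    refine ⟨trivial, Or.inr (Or.inr ⟨?_, trivial⟩)⟩
    simp [Term.fv]; omega) h1
  have h3 := subst_rule 1 (.var (c + 1)) (by
    refine ⟨trivial, Or.inr (Or.inr ⟨?_, trivial⟩)⟩
    simp [Term.fv]; omega) h2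
  have e1 : c ≠ 1 := by omega
  have e2 : c ≠ z := by omega
  have e3 : c + 1 ≠ z := by omega
  simp only [Formula.subst_imp, Formula.subst_le, Formula.subst_ex_ne _ _ (show (0:ℕ) ≠ 2 by decide),
    Formula.subst_ex_ne _ _ (show (1:ℕ) ≠ 2 by decide),
    Formula.subst_eq, Term.subst_add, Term.subst_var_self, Term.subst_var_ne _ (show (1:ℕ) ≠ 0 by decide),
    Term.subst_var_ne _ (show (2:ℕ) ≠ 0 by decide), Term.subst_var_ne _ (show (2:ℕ) ≠ 1 by decide),
    Term.subst_var_ne _ e1] at h3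
  have h4 : T ⊩ (Formula.ex 2 (.eq ((Term.var c).add (Term.var 2)) (.var (c + 1)))).imp
      (.ex z (.eq ((Term.var c).add (.var z)) (.var (c + 1)))) := by
    refine ex_elim ?_ ?_
    · simp [Formula.fv, Term.fv]; omega
    · have := Provable.logic (T := T) (.exI z (Term.var 2) (.eq ((Term.var c).add (.var z)) (.var (c + 1))) trivial)
      simpa only [Formula.subst_eq, Term.subst_add, Term.subst_var_self, Term.subst_var_ne _ e2,
        Term.subst_var_ne _ e3] using this
  have h5 := pr_trans h3 h4
  have h6 := subst_rule c t (by
    refine ⟨trivial, Or.inr (Or.inr ⟨hz, trivial⟩)⟩) h5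
  have h7 := subst_rule (c + 1) u (by
    refine ⟨trivial, Or.inr (Or.inr ⟨hz', ?_⟩)⟩
    exact trivial) h6
  simpa only [Formula.subst_imp, Formula.subst_le, Formula.subst_ex_ne _ _ e2,
    Formula.subst_ex_ne _ _ e3, Formula.subst_eq, Term.subst_add, Term.subst_var_self,
    Term.subst_var_ne _ (show c + 1 ≠ c by omega), Term.subst_var_ne _ e2.symm,
    Term.subst_var_ne _ e3.symm, Term.subst_not_fv _ (ct (c + 1) (by omega))] using h7

theorem le_elim (hT : Extends T PAK) {t u : Term} (z : ℕ) {χ : Formula} (hz : z ∉ t.fv)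
    (hz' : z ∉ u.fv) (hχ : z ∉ χ.fv) (h : T ⊩ (Formula.eq (t.add (.var z)) u).imp χ) :
    T ⊩ (Formula.le t u).imp χ :=
  pr_trans (le_ex hT t u z hz hz') (ex_elim hχ h)

theorem er (t : Term) : T ⊩ .eq t t := .logic (.eqRefl t)
theorem es {t u : Term} (h : T ⊩ .eq t u) : T ⊩ .eq u t := .mp (.logic (.eqSymm _ _)) h
theorem et {t u w : Term} (h : T ⊩ .eq t u) (h' : T ⊩ .eq u w) : T ⊩ .eq t w :=
  .mp (.mp (.logic (.eqTrans _ _ _)) h) h'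
theorem ces {χ : Formula} {t u : Term} (h : T ⊩ χ.imp (.eq t u)) : T ⊩ χ.imp (.eq u t) :=
  pr_trans h (.logic (.eqSymm _ _))
theorem cet {χ : Formula} {t u w : Term} (h : T ⊩ χ.imp (.eq t u)) (h' : T ⊩ χ.imp (.eq u w)) :
    T ⊩ χ.imp (.eq t w) := pr_S (pr_trans h (.logic (.eqTrans _ _ _))) h'
theorem cesucc {χ : Formula} {t u : Term} (h : T ⊩ χ.imp (.eq t u)) :
    T ⊩ χ.imp (.eq t.succ u.succ) := pr_trans h (.logic (.eqSucc _ _))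
theorem ceadd {χ : Formula} {t u t' u' : Term} (h : T ⊩ χ.imp (.eq t u))
    (h' : T ⊩ χ.imp (.eq t' u')) : T ⊩ χ.imp (.eq (t.add t') (u.add u')) :=
  pr_S (pr_trans h (.logic (.eqAdd _ _ _ _))) h'
theorem cemul {χ : Formula} {t u t' u' : Term} (h : T ⊩ χ.imp (.eq t u))
    (h' : T ⊩ χ.imp (.eq t' u')) : T ⊩ χ.imp (.eq (t.mul t') (u.mul u')) :=
  pr_S (pr_trans h (.logic (.eqMul _ _ _ _))) h'
theorem cele {χ : Formula} {t u t' u' : Term} (h : T ⊩ χ.imp (.eq t u))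
    (h' : T ⊩ χ.imp (.eq t' u')) (h2 : T ⊩ χ.imp (.le t t')) : T ⊩ χ.imp (.le u u') :=
  pr_S (pr_S (pr_trans h (.logic (.eqLe _ _ _ _))) h') h2

theorem zero_add' (hT : Extends T PAK) (t : Term) : T ⊩ Formula.eq (Term.zero.add t) t := by
  have : T ⊩ Formula.eq (Term.zero.add (Term.var 0)) (Term.var 0) := by
    refine ind hT 0 (add_zero' hT .zero) ?_
    exact cet (pr_K (add_succ' hT .zero (Term.var 0))) (cesucc (pr_id _))
  exact inst3 this t .zero .zero trivial (by decide)

theorem succ_add' (hT : Extends T PAK) (t u : Term) :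
    T ⊩ Formula.eq (t.succ.add u) (t.add u).succ := by
  have : T ⊩ Formula.eq ((Term.var 0).succ.add (Term.var 1)) ((Term.var 0).add (Term.var 1)).succ := by
    refine ind hT 1 (φ := Formula.eq ((Term.var 0).succ.add (Term.var 1)) ((Term.var 0).add (Term.var 1)).succ)
      (et (add_zero' hT (Term.var 0).succ) (.mp (.logic (.eqSucc _ _)) (es (add_zero' hT (Term.var 0))))) ?_
    exact cet (cet (pr_K (add_succ' hT (Term.var 0).succ (Term.var 1))) (cesucc (pr_id _)))
      (pr_K (.mp (.logic (.eqSucc _ _)) (es (add_succ' hT (Term.var 0) (Term.var 1)))))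
  exact inst3 this t u .zero trivial (by decide)

theorem add_assoc' (hT : Extends T PAK) (t u w : Term) :
    T ⊩ Formula.eq ((t.add u).add w) (t.add (u.add w)) := by
  have : T ⊩ Formula.eq (((Term.var 0).add (Term.var 1)).add (Term.var 2)) ((Term.var 0).add ((Term.var 1).add (Term.var 2))) := by
    refine ind hT 2 (φ := Formula.eq (((Term.var 0).add (Term.var 1)).add (Term.var 2)) ((Term.var 0).add ((Term.var 1).add (Term.var 2)))) ?_ ?_
    · exact et (add_zero' hT ((Term.var 0).add (Term.var 1)))
        (.mp (.mp (.logic (.eqAdd _ _ _ _)) (er (Term.var 0))) (es (add_zero' hT (Term.var 1))))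
    · refine cet (cet (pr_K (add_succ' hT ((Term.var 0).add (Term.var 1)) (Term.var 2))) (cesucc (pr_id _))) (pr_K ?_)
      refine es (et ?_ (add_succ' hT (Term.var 0) ((Term.var 1).add (Term.var 2))))
      exact .mp (.mp (.logic (.eqAdd _ _ _ _)) (er (Term.var 0))) (add_succ' hT (Term.var 1) (Term.var 2))
  exact inst3 this t u w trivial (by decide)

theorem le_refl' (hT : Extends T PAK) (t : Term) : T ⊩ Formula.le t t :=
  .mp (le_intro hT t .zero t) (add_zero' hT t)
theorem zero_le' (hT : Extends T PAK) (t : Term) : T ⊩ Formula.le .zero t :=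
  .mp (le_intro hT .zero t t) (zero_add' hT t)
theorem le_succ' (hT : Extends T PAK) (t : Term) : T ⊩ Formula.le t t.succ :=
  .mp (le_intro hT t (.succ .zero) t.succ)
    (et (add_succ' hT t .zero) (.mp (.logic (.eqSucc _ _)) (add_zero' hT t)))

theorem exists_fresh (s : Finset ℕ) : ∃ z, z ∉ s := s.exists_notMem

theorem le_trans' (hT : Extends T PAK) (t u w : Term) :
    T ⊩ (Formula.le t u).imp ((Formula.le u w).imp (.le t w)) := by
  obtain ⟨a, ha⟩ := exists_fresh (t.fv ∪ u.fv ∪ w.fv)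
  obtain ⟨b, hb⟩ := exists_fresh (t.fv ∪ u.fv ∪ w.fv ∪ {a})
  simp only [Finset.mem_union, Finset.mem_singleton, not_or] at ha hb
  refine le_elim hT a ha.1.1 ha.1.2 (by simp [Formula.fv, ha]) ?_
  have : T ⊩ (Formula.le u w).imp ((Formula.eq (t.add (.var a)) u).imp (.le t w)) := by
    refine le_elim hT b hb.1.1.2 hb.1.2 ?_ ?_
    · simp only [Formula.fv, Term.fv, Finset.mem_union, Finset.mem_singleton]; tauto
    · have h1 := le_intro hT t ((Term.var a).add (.var b)) w
      have h2 := add_assoc' hT t (.var a) (.var b)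
      have : T ⊩ ((Formula.eq (u.add (.var b)) w).and (.eq (t.add (.var a)) u)).imp
          (.eq (t.add ((Term.var a).add (.var b))) w) := by
        refine cet (pr_K (es h2)) (cet (u := u.add (.var b)) ?_ (taut ?_))
        · exact ceadd (taut (by intro a; simp only [pval]; tauto)) (pr_K (er _))
        · intro a; simp only [pval]; tauto
      exact tc2 this h1 (by intro a; simp only [pval]; tauto)
  exact tc1 this (by intro a; simp only [pval]; tauto)

theorem not_lt_zero' (hT : Extends T PAK) (t : Term) : T ⊩ (Formula.lt t .zero).neg := by
  obtain ⟨a, ha⟩ := exists_fresh t.fv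
  have : T ⊩ (Formula.lt t .zero).imp .falsum := by
    refine le_elim hT a ha (by simp [Term.fv]) (by simp [Formula.fv]) ?_
    have h1 := succ_ne_zero' hT (t.add (.var a))
    have h2 := cet (pr_K (es (succ_add' hT t (.var a))))
      (pr_id (T := T) (Formula.eq (t.succ.add (.var a)) .zero))
    exact tc2 h1 h2 (by intro a; simp only [pval]; tauto)
  exact tc1 this (by intro a; simp only [pval]; tauto)

theorem le_of_succ (hT : Extends T PAK) (t u : Term) :
    T ⊩ (Formula.le t.succ u.succ).imp (.le t u) := by
  obtain ⟨a, ha⟩ := exists_fresh (t.fv ∪ u.fv)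
  simp only [Finset.mem_union, not_or] at ha
  refine le_elim hT a ha.1 ha.2 (by simp [Formula.fv, ha]) ?_
  have h2 := cet (pr_K (es (succ_add' hT t (.var a))))
      (pr_id (T := T) (Formula.eq (t.succ.add (.var a)) u.succ))
  exact pr_trans (pr_trans h2 (succ_inj' hT _ _)) (le_intro hT _ _ _)

theorem succ_le_succ' (hT : Extends T PAK) (t u : Term) :
    T ⊩ (Formula.le t u).imp (.le t.succ u.succ) := by
  obtain ⟨a, ha⟩ := exists_fresh (t.fv ∪ u.fv)
  simp only [Finset.mem_union, not_or] at ha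
  refine le_elim hT a ha.1 ha.2 (by simp [Formula.fv, Term.fv, ha]) ?_
  exact pr_trans (cet (pr_K (succ_add' hT t (.var a))) (cesucc (pr_id _))) (le_intro hT _ _ _)

/-- Case distinction on a variable. -/
theorem cases0 (hT : Extends T PAK) (x : ℕ) {φ : Formula} (h0 : T ⊩ φ.subst x .zero)
    (h1 : T ⊩ φ.subst x (.succ (.var x))) : T ⊩ φ := ind hT x h0 (pr_K h1)

theorem lt_or_eq (hT : Extends T PAK) (t u : Term) :
    T ⊩ (Formula.le t u).imp ((Formula.lt t u).or (.eq t u)) := by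
  have key : T ⊩ (Formula.eq ((Term.var 0).add (Term.var 2)) (Term.var 1)).imp ((Formula.lt (Term.var 0) (Term.var 1)).or (.eq (Term.var 0) (Term.var 1))) := by
    refine cases0 hT 2 ?_ ?_
    · have : T ⊩ (Formula.eq ((Term.var 0).add .zero) (Term.var 1)).imp (.eq (Term.var 0) (Term.var 1)) :=
        cet (pr_K (es (add_zero' hT (Term.var 0)))) (pr_id _)
      exact tc1 this (by intro a; simp only [pval, Formula.subst, Formula.substAll]; tauto)
    · have : T ⊩ (Formula.eq ((Term.var 0).add (Term.var 2).succ) (Term.var 1)).imp (.eq ((Term.var 0).succ.add (Term.var 2)) (Term.var 1)) :=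
        cet (pr_K (et (succ_add' hT (Term.var 0) (Term.var 2)) (es (add_succ' hT (Term.var 0) (Term.var 2))))) (pr_id _)
      exact tc2 this (le_intro hT (Term.var 0).succ (Term.var 2) (Term.var 1))
        (by intro a; simp only [pval]; exact fun h1 h2 h => Or.inl (h2 (h1 h)))
  have h2 : T ⊩ (Formula.le (Term.var 0) (Term.var 1)).imp ((Formula.lt (Term.var 0) (Term.var 1)).or (.eq (Term.var 0) (Term.var 1))) :=
    le_elim hT 2 (by decide) (by decide) (by decide) key
  exact inst3 h2 t u .zero ⟨trivial, trivial, trivial⟩ (by decide)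

theorem lt_succ (hT : Extends T PAK) (t u : Term) :
    T ⊩ (Formula.lt t u.succ).imp ((Formula.lt t u).or (.eq t u)) :=
  pr_trans (le_of_succ hT t u) (lt_or_eq hT t u)

theorem lt_trans_le (hT : Extends T PAK) (t u w : Term) :
    T ⊩ (Formula.lt t u).imp ((Formula.le u w).imp (.lt t w)) := le_trans' hT t.succ u w

theorem lt_or_le (hT : Extends T PAK) (t u : Term) :
    T ⊩ (Formula.lt t u).or (.le u t) := by
  have : T ⊩ (Formula.lt (Term.var 0) (Term.var 1)).or (.le (Term.var 1) (Term.var 0)) := by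
    refine ind hT 1 ?_ ?_
    · exact tc1 (zero_le' hT (Term.var 0)) (by intro a; exact Or.inr)
    · show T ⊩ ((Formula.lt (Term.var 0) (Term.var 1)).or (.le (Term.var 1) (Term.var 0))).imp ((Formula.lt (Term.var 0) (Term.var 1).succ).or (.lt (Term.var 1) (Term.var 0)))
      have h1 : T ⊩ (Formula.lt (Term.var 0) (Term.var 1)).imp (.lt (Term.var 0) (Term.var 1).succ) :=
        pr_S (lt_trans_le hT (Term.var 0) (Term.var 1) (Term.var 1).succ) (pr_K (le_succ' hT (Term.var 1)))
      have h2 := lt_or_eq hT (Term.var 1) (Term.var 0)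
      have h3 : T ⊩ (Formula.eq (Term.var 1) (Term.var 0)).imp (.lt (Term.var 0) (Term.var 1).succ) := by
        refine cele (t := (Term.var 0).succ) (t' := (Term.var 0).succ) (pr_K (er _)) ?_ (pr_K (le_refl' hT _))
        exact cesucc (.logic (.eqSymm _ _))
      exact tc3 h1 h2 h3 (by intro a; simp only [pval]; tauto)
  exact inst3 this t u .zero ⟨trivial, trivial⟩ (by decide)

theorem lt_irrefl' (hT : Extends T PAK) (t : Term) : T ⊩ (Formula.lt t t).neg := by
  have : T ⊩ (Formula.lt (Term.var 0) (Term.var 0)).neg := by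
    refine ind hT 0 (not_lt_zero' hT .zero) ?_
    show T ⊩ (Formula.lt (Term.var 0) (Term.var 0)).neg.imp (Formula.lt (Term.var 0).succ (Term.var 0).succ).neg
    exact tc1 (le_of_succ hT (Term.var 0).succ (Term.var 0)) (by intro a; simp only [pval, Formula.lt]; tauto)
  exact inst3 this t .zero .zero trivial (by decide)

theorem not_le_of_lt (hT : Extends T PAK) (t u : Term) :
    T ⊩ (Formula.lt t u).imp (Formula.le u t).neg :=
  tc2 (lt_trans_le hT t u t) (lt_irrefl' hT t) (by intro a; simp only [pval]; tauto)

theorem ne_of_lt (hT : Extends T PAK) (t u : Term) :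
    T ⊩ (Formula.lt t u).imp (Formula.eq t u).neg := by
  have : T ⊩ ((Formula.lt t u).and (.eq t u)).imp (.lt t t) :=
    cele (t := t.succ) (t' := u) (pr_K (er _)) (ces (.logic (.andE2 _ _))) (.logic (.andE1 _ _))
  exact tc2 this (lt_irrefl' hT t) (by intro a; simp only [pval]; tauto)

theorem lt_of_eq (hT : Extends T PAK) (t u : Term) :
    T ⊩ (Formula.eq t u).imp (.lt t u.succ) :=
  cele (t := t.succ) (t' := t.succ) (pr_K (er _)) (cesucc (pr_id _)) (pr_K (le_refl' hT _))

/-- Two elements have a common strict upper bound. -/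
theorem ex_bound (hT : Extends T PAK) (a b q : ℕ) (hqa : q ≠ a) (hqb : q ≠ b) {χ : Formula}
    (hχ : q ∉ χ.fv)
    (h : T ⊩ (Formula.lt (.var a) (.var q)).imp ((Formula.lt (.var b) (.var q)).imp χ)) :
    T ⊩ χ := by
  have h1 : T ⊩ (Formula.lt (.var a) (.var b)).imp χ := by
    refine eq_intro (x := q) (t := (Term.var b).succ) ?_ ?_ ?_
    · simp [Formula.lt, Formula.fv, Term.fv, hχ, hqa, hqb]
    · simp [Term.fv, hqb]
    · have e : T ⊩ (Formula.eq (.var q) (Term.var b).succ).imp (.le (Term.var b).succ (.var q)) :=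
        cele (pr_K (er _)) (.logic (.eqSymm _ _)) (pr_K (le_refl' hT _))
      have := lt_trans_le hT (.var a) (.var b) (.var q)
      have h2 := le_trans' hT (.var b) (.succ (.var b)) (.var q)
      have h3 := le_succ' hT (.var b)
      exact tc5 e this h2 h3 h (by intro a; simp only [pval, Formula.lt]; tauto)
  have h2 : T ⊩ (Formula.le (.var b) (.var a)).imp χ := by
    refine eq_intro (x := q) (t := (Term.var a).succ) ?_ ?_ ?_
    · simp [Formula.fv, Term.fv, hχ, hqa, hqb]
    · simp [Term.fv, hqa]
    · have e : T ⊩ (Formula.eq (.var q) (Term.var a).succ).imp (.le (Term.var a).succ (.var q)) :=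
        cele (pr_K (er _)) (.logic (.eqSymm _ _)) (pr_K (le_refl' hT _))
      have h2 := succ_le_succ' hT (.var b) (.var a)
      have h3 := le_trans' hT (Term.var b).succ (.succ (.var a)) (.var q)
      exact tc4 e h2 h3 h (by intro a; simp only [pval, Formula.lt]; tauto)
  exact tc3 h1 h2 (lt_or_le hT (.var a) (.var b)) (by intro a; simp only [pval]; tauto)

/-! ### Modal facts -/

theorem boxK (hT : Extends T PAK) {φ ψ : Formula} (h : T ⊩ φ.imp ψ) :
    T ⊩ φ.box.imp ψ.box :=
  .mp (hT _ (Or.inr ⟨φ, ψ, rfl⟩)) (.nec h)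
theorem boxK2 (hT : Extends T PAK) {φ ψ χ : Formula} (h : T ⊩ φ.imp (ψ.imp χ)) :
    T ⊩ φ.box.imp (ψ.box.imp χ.box) :=
  pr_trans (boxK hT h) (hT _ (Or.inr ⟨ψ, χ, rfl⟩))

theorem eq_box (hT : Extends T PAK) (t u : Term) :
    T ⊩ (Formula.eq t u).imp (Formula.eq t u).box := by
  have : T ⊩ Formula.all 1 ((Formula.eq (Term.var 0) (Term.var 1)).imp (Formula.eq (Term.var 0) (Term.var 1)).box) := by
    refine ind hT 0 ?_ ?_
    · show T ⊩ Formula.all 1 ((Formula.eq .zero (Term.var 1)).imp (Formula.eq .zero (Term.var 1)).box)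
      refine .gen 1 (cases0 hT 1 (pr_K (.nec (er .zero))) ?_)
      show T ⊩ (Formula.eq .zero (Term.var 1).succ).imp (Formula.eq .zero (Term.var 1).succ).box
      have h1 : T ⊩ (Formula.eq .zero (Term.var 1).succ).imp (.eq (Term.var 1).succ .zero) := .logic (.eqSymm _ _)
      exact tc2 h1 (succ_ne_zero' hT (Term.var 1)) (by intro a; simp only [pval]; tauto)
    · show T ⊩ (Formula.all 1 ((Formula.eq (Term.var 0) (Term.var 1)).imp (Formula.eq (Term.var 0) (Term.var 1)).box)).imp
        (Formula.all 1 ((Formula.eq (Term.var 0).succ (Term.var 1)).imp (Formula.eq (Term.var 0).succ (Term.var 1)).box))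
      refine all_intro (by decide) (cases0 hT 1 ?_ ?_)
      · show T ⊩ (Formula.all 1 ((Formula.eq (Term.var 0) (Term.var 1)).imp (Formula.eq (Term.var 0) (Term.var 1)).box)).imp
          ((Formula.eq (Term.var 0).succ .zero).imp (Formula.eq (Term.var 0).succ .zero).box)
        exact tc1 (succ_ne_zero' hT (Term.var 0)) (by intro a; simp only [pval]; tauto)
      · show T ⊩ (Formula.all 1 ((Formula.eq (Term.var 0) (Term.var 1)).imp (Formula.eq (Term.var 0) (Term.var 1)).box)).imp
          ((Formula.eq (Term.var 0).succ (Term.var 1).succ).imp (Formula.eq (Term.var 0).succ (Term.var 1).succ).box)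
        have h1 : T ⊩ (Formula.eq (Term.var 0) (Term.var 1)).box.imp (Formula.eq (Term.var 0).succ (Term.var 1).succ).box :=
          boxK hT (.logic (.eqSucc _ _))
        exact tc3 (all_self 1 ((Formula.eq (Term.var 0) (Term.var 1)).imp (Formula.eq (Term.var 0) (Term.var 1)).box))
          (succ_inj' hT (Term.var 0) (Term.var 1)) h1 (by intro a; simp only [pval]; tauto)
  exact inst3 (.mp (all_self _ _) this) t u .zero ⟨trivial, trivial⟩ (by decide)

theorem le_box (hT : Extends T PAK) (t u : Term) :
    T ⊩ (Formula.le t u).imp (Formula.le t u).box := by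
  obtain ⟨a, ha⟩ := exists_fresh (t.fv ∪ u.fv)
  simp only [Finset.mem_union, not_or] at ha
  refine le_elim hT a ha.1 ha.2 (by simp [Formula.fv, ha]) ?_
  exact pr_trans (eq_box hT _ _) (boxK hT (le_intro hT _ _ _))

theorem nle_box (hT : Extends T PAK) (t u : Term) :
    T ⊩ (Formula.le t u).neg.imp (Formula.le t u).neg.box := by
  have h1 := boxK hT (not_le_of_lt hT u t)
  have h2 : T ⊩ (Formula.lt u t).imp (Formula.lt u t).box := le_box hT u.succ t
  exact tc3 h1 h2 (lt_or_le hT u t) (by intro a; simp only [pval]; tauto)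

theorem neq_box (hT : Extends T PAK) (t u : Term) :
    T ⊩ (Formula.eq t u).neg.imp (Formula.eq t u).neg.box := by
  have h1 : T ⊩ (Formula.lt t u).imp (Formula.eq t u).neg.box :=
    pr_trans (le_box hT t.succ u) (boxK hT (ne_of_lt hT t u))
  have h2 : T ⊩ (Formula.lt u t).imp (Formula.eq t u).neg.box := by
    refine pr_trans (le_box hT u.succ t) (boxK hT ?_)
    exact tc2 (ne_of_lt hT u t) (.logic (.eqSymm t u)) (by intro a; simp only [pval, Formula.lt]; tauto)
  have h3 := lt_or_eq hT u t
  have h4 : T ⊩ (Formula.eq u t).imp (.eq t u) := .logic (.eqSymm _ _)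
  exact tc5 h1 h2 h3 h4 (lt_or_le hT t u) (by intro a; simp only [pval]; tauto)

/-- The Leibniz law for all formulas of modal arithmetic. -/
theorem leibniz (hT : Extends T PAK) (s t : Term) (x : ℕ) (φ : Formula)
    (hs : φ.freeFor s x) (ht : φ.freeFor t x) :
    T ⊩ (Formula.eq s t).imp ((φ.subst x s).iff (φ.subst x t)) := by
  have tm : ∀ u : Term, T ⊩ (Formula.eq s t).imp (.eq (Term.subst x s u) (Term.subst x t u)) := by
    intro u
    induction u with
    | var y =>
      by_cases h : y = x
      · subst h; rw [Term.subst_var_self, Term.subst_var_self]; exact pr_id _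
      · rw [Term.subst_var_ne _ h, Term.subst_var_ne _ h]; exact pr_K (er _)
    | zero => exact pr_K (er _)
    | succ u ih => exact cesucc ih
    | add u w ih1 ih2 => exact ceadd ih1 ih2
    | mul u w ih1 ih2 => exact cemul ih1 ih2
  induction φ with
  | falsum => exact taut (by intro a; simp only [pval, Formula.iff]; tauto)
  | eq u w =>
    have h1 := tm u
    have h2 := tm w
    have h3 : T ⊩ ((Formula.eq s t).and ((Formula.eq u w).subst x s)).imp ((Formula.eq u w).subst x t) := by
      refine cet (ces (pr_trans (.logic (.andE1 _ _)) h1)) (cet (.logic (.andE2 _ _))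
        (pr_trans (.logic (.andE1 _ _)) h2))
    have h4 : T ⊩ ((Formula.eq s t).and ((Formula.eq u w).subst x t)).imp ((Formula.eq u w).subst x s) := by
      refine cet (pr_trans (.logic (.andE1 _ _)) h1) (cet (.logic (.andE2 _ _))
        (ces (pr_trans (.logic (.andE1 _ _)) h2)))
    exact tc2 h3 h4 (by intro a; simp only [pval, Formula.iff]; tauto)
  | le u w =>
    have h1 := tm u
    have h2 := tm w
    have h3 : T ⊩ ((Formula.eq s t).and ((Formula.le u w).subst x s)).imp ((Formula.le u w).subst x t) :=
      cele (pr_trans (.logic (.andE1 _ _)) h1) (pr_trans (.logic (.andE1 _ _)) h2)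
        (.logic (.andE2 _ _))
    have h4 : T ⊩ ((Formula.eq s t).and ((Formula.le u w).subst x t)).imp ((Formula.le u w).subst x s) :=
      cele (ces (pr_trans (.logic (.andE1 _ _)) h1)) (ces (pr_trans (.logic (.andE1 _ _)) h2))
        (.logic (.andE2 _ _))
    exact tc2 h3 h4 (by intro a; simp only [pval, Formula.iff]; tauto)
  | and φ ψ ih1 ih2 =>
    exact tc2 (ih1 hs.1 ht.1) (ih2 hs.2 ht.2) fun a h1 h2 h =>
      ⟨fun h' => ⟨(h1 h).1 h'.1, (h2 h).1 h'.2⟩, fun h' => ⟨(h1 h).2 h'.1, (h2 h).2 h'.2⟩⟩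
  | or φ ψ ih1 ih2 =>
    exact tc2 (ih1 hs.1 ht.1) (ih2 hs.2 ht.2) fun a h1 h2 h =>
      ⟨fun h' => h'.imp (h1 h).1 (h2 h).1, fun h' => h'.imp (h1 h).2 (h2 h).2⟩
  | imp φ ψ ih1 ih2 =>
    exact tc2 (ih1 hs.1 ht.1) (ih2 hs.2 ht.2) fun a h1 h2 h =>
      ⟨fun h' h3 => (h2 h).1 (h' ((h1 h).2 h3)), fun h' h3 => (h2 h).2 (h' ((h1 h).1 h3))⟩
  | neg φ ih =>
    simp only [Formula.subst_neg]
    exact tc1 (ih hs ht) (by intro a; simp only [pval, Formula.iff]; tauto)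
  | box φ ih =>
    simp only [Formula.subst_box]
    have h1 : T ⊩ (Formula.eq s t).imp ((φ.subst x s).imp (φ.subst x t)) :=
      tc1 (ih hs ht) (by intro a; simp only [pval, Formula.iff]; tauto)
    have h2 : T ⊩ (Formula.eq s t).imp ((φ.subst x t).imp (φ.subst x s)) :=
      tc1 (ih hs ht) (by intro a; simp only [pval, Formula.iff]; tauto)
    exact tc3 (boxK2 hT h1) (boxK2 hT h2) (eq_box hT s t)
      (by intro a; simp only [pval, Formula.iff]; tauto)
  | all y φ ih =>
    by_cases hx : x ∉ (Formula.all y φ).fv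
    · rw [Formula.subst_not_fv _ hx, Formula.subst_not_fv _ hx]
      exact taut (by intro a; simp only [pval, Formula.iff]; tauto)
    · rw [not_not] at hx
      simp only [Formula.fv, Finset.mem_erase] at hx
      have hs' : y ∉ s.fv ∧ φ.freeFor s x := by rcases hs with h | h | h <;> tauto
      have ht' : y ∉ t.fv ∧ φ.freeFor t x := by rcases ht with h | h | h <;> tauto
      rw [Formula.subst_all_ne _ _ hx.1, Formula.subst_all_ne _ _ hx.1]
      have ih := ih hs'.2 ht'.2
      have h1 : T ⊩ ((Formula.eq s t).and (.all y (φ.subst x s))).imp (.all y (φ.subst x t)) := by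
        refine all_intro (by simp [Formula.fv, hs', ht']) ?_
        exact tc2 ih (all_self y (φ.subst x s)) (by intro a; simp only [pval, Formula.iff]; tauto)
      have h2 : T ⊩ ((Formula.eq s t).and (.all y (φ.subst x t))).imp (.all y (φ.subst x s)) := by
        refine all_intro (by simp [Formula.fv, hs', ht']) ?_
        exact tc2 ih (all_self y (φ.subst x t)) (by intro a; simp only [pval, Formula.iff]; tauto)
      exact tc2 h1 h2 (by intro a; simp only [pval, Formula.iff]; tauto)
  | ex y φ ih =>
    by_cases hx : x ∉ (Formula.ex y φ).fv
    · rw [Formula.subst_not_fv _ hx, Formula.subst_not_fv _ hx]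
      exact taut (by intro a; simp only [pval, Formula.iff]; tauto)
    · rw [not_not] at hx
      simp only [Formula.fv, Finset.mem_erase] at hx
      have hs' : y ∉ s.fv ∧ φ.freeFor s x := by rcases hs with h | h | h <;> tauto
      have ht' : y ∉ t.fv ∧ φ.freeFor t x := by rcases ht with h | h | h <;> tauto
      rw [Formula.subst_ex_ne _ _ hx.1, Formula.subst_ex_ne _ _ hx.1]
      have ih := ih hs'.2 ht'.2
      have h1 : T ⊩ (Formula.eq s t).imp ((Formula.ex y (φ.subst x s)).imp (.ex y (φ.subst x t))) := by
        refine ex_elim2 (by simp [Formula.fv]) (by simp [Formula.fv, hs', ht']) ?_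
        exact tc2 ih (ex_self y (φ.subst x t)) (by intro a; simp only [pval, Formula.iff]; tauto)
      have h2 : T ⊩ (Formula.eq s t).imp ((Formula.ex y (φ.subst x t)).imp (.ex y (φ.subst x s))) := by
        refine ex_elim2 (by simp [Formula.fv]) (by simp [Formula.fv, hs', ht']) ?_
        exact tc2 ih (ex_self y (φ.subst x s)) (by intro a; simp only [pval, Formula.iff]; tauto)
      exact tc2 h1 h2 (by intro a; simp only [pval, Formula.iff]; tauto)

/-- The Leibniz law, replacing a variable by a term. -/
theorem leibniz_var (hT : Extends T PAK) (t : Term) (x : ℕ) (φ : Formula) (ht : φ.freeFor t x) :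
    T ⊩ (Formula.eq (.var x) t).imp (φ.iff (φ.subst x t)) := by
  have := leibniz hT (.var x) t x φ (φ.freeFor_self x) ht
  rwa [Formula.subst_self] at this

end arith

end ModalArith


namespace ModalArith

section sigmacompl
variable {T : Set Formula}

theorem Term.fv_substAll (t : Term) (v : ℕ → Term) (i : ℕ) (h : i ∈ (t.substAll v).fv) :
    ∃ j ∈ t.fv, i ∈ (v j).fv := by
  induction t with
  | var x => exact ⟨x, by simp [Term.fv], h⟩
  | zero => simp [Term.substAll, Term.fv] at h
  | succ t ih => exact ih h
  | add t u ih1 ih2 | mul t u ih1 ih2 =>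
    simp only [Term.substAll, Term.fv, Finset.mem_union] at h
    rcases h with h | h
    · obtain ⟨j, hj, hi⟩ := ih1 h
      exact ⟨j, by simp [Term.fv, hj], hi⟩
    · obtain ⟨j, hj, hi⟩ := ih2 h
      exact ⟨j, by simp [Term.fv, hj], hi⟩

theorem Formula.fv_substAll (φ : Formula) : ∀ (v : ℕ → Term) (i : ℕ),
    i ∈ (φ.substAll v).fv → ∃ j ∈ φ.fv, i ∈ (v j).fv := by
  induction φ with
  | falsum => intro v i h; simp [Formula.substAll, Formula.fv] at h
  | eq t u | le t u =>
    intro v i h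
    simp only [Formula.substAll, Formula.fv, Finset.mem_union] at h
    rcases h with h | h
    · obtain ⟨j, hj, hi⟩ := Term.fv_substAll _ _ _ h
      exact ⟨j, by simp [Formula.fv, hj], hi⟩
    · obtain ⟨j, hj, hi⟩ := Term.fv_substAll _ _ _ h
      exact ⟨j, by simp [Formula.fv, hj], hi⟩
  | and φ ψ ih1 ih2 | or φ ψ ih1 ih2 | imp φ ψ ih1 ih2 =>
    intro v i h
    simp only [Formula.substAll, Formula.fv, Finset.mem_union] at h
    rcases h with h | h
    · obtain ⟨j, hj, hi⟩ := ih1 _ _ h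
      exact ⟨j, by simp [Formula.fv, hj], hi⟩
    · obtain ⟨j, hj, hi⟩ := ih2 _ _ h
      exact ⟨j, by simp [Formula.fv, hj], hi⟩
  | neg φ ih | box φ ih => intro v i h; exact ih v i h
  | all x φ ih | ex x φ ih =>
    intro v i h
    simp only [Formula.substAll, Formula.fv, Finset.mem_erase] at h
    obtain ⟨j, hj, hi⟩ := ih _ _ h.2
    by_cases hx : j = x
    · subst hx
      simp [Term.fv] at hi
      exact absurd hi h.1
    · rw [Function.update_of_ne hx] at hi
      exact ⟨j, by simp [Formula.fv, hj, hx], hi⟩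

theorem Formula.fv_subst {φ : Formula} {x : ℕ} {s : Term} {i : ℕ} (h : i ∈ (φ.subst x s).fv) :
    (i ∈ φ.fv ∧ i ≠ x) ∨ (i ∈ s.fv ∧ x ∈ φ.fv) := by
  obtain ⟨j, hj, hi⟩ := Formula.fv_substAll _ _ _ h
  by_cases hx : j = x
  · subst hx
    simp at hi
    exact Or.inr ⟨hi, hj⟩
  · rw [Function.update_of_ne hx] at hi
    simp [Term.fv] at hi
    subst hi
    exact Or.inl ⟨hj, hx⟩

theorem exists_freeFor (φ : Formula) : ∃ c, ∀ y, c ≤ y → ∀ x, φ.freeFor (.var y) x := by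
  induction φ with
  | falsum | eq t u | le t u => exact ⟨0, fun y _ x => trivial⟩
  | and φ ψ ih1 ih2 | or φ ψ ih1 ih2 | imp φ ψ ih1 ih2 =>
    obtain ⟨c, hc⟩ := ih1
    obtain ⟨d, hd⟩ := ih2
    exact ⟨c + d, fun y hy x => ⟨hc y (by omega) x, hd y (by omega) x⟩⟩
  | neg φ ih | box φ ih => exact ih
  | all z φ ih | ex z φ ih =>
    obtain ⟨c, hc⟩ := ih
    refine ⟨c + z + 1, fun y hy x => Or.inr (Or.inr ⟨?_, hc y (by omega) x⟩)⟩
    simp [Term.fv]; omega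

theorem ball_subst_var {x y : ℕ} (φ : Formula) (s : Term) (h : y ≠ x) (hy : y ∉ φ.fv) :
    (Formula.ball x (.var y) φ).subst y s = Formula.ball x s φ := by
  unfold Formula.ball
  rw [Formula.subst_all_ne _ _ h, Formula.subst_imp, Formula.subst_lt, Term.subst_var_self,
    Term.subst_var_ne _ (Ne.symm h), Formula.subst_not_fv _ hy]

theorem bex_subst_var {x y : ℕ} (φ : Formula) (s : Term) (h : y ≠ x) (hy : y ∉ φ.fv) :
    (Formula.bex x (.var y) φ).subst y s = Formula.bex x s φ := by
  unfold Formula.bex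
  rw [Formula.subst_ex_ne _ _ h, Formula.subst_and, Formula.subst_lt, Term.subst_var_self,
    Term.subst_var_ne _ (Ne.symm h), Formula.subst_not_fv _ hy]

theorem lt_succ_self (hT : Extends T PAK) (t : Term) : T ⊩ Formula.lt t t.succ :=
  le_refl' hT t.succ
theorem lt_mono_succ (hT : Extends T PAK) (t u : Term) :
    T ⊩ (Formula.lt t u).imp (.lt t u.succ) :=
  pr_S (lt_trans_le hT t u u.succ) (pr_K (le_succ' hT u))

theorem ball_mono_bound (hT : Extends T PAK) (x : ℕ) (t : Term) (φ : Formula) (hx : x ∉ t.fv) :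
    T ⊩ (Formula.ball x t.succ φ).imp (Formula.ball x t φ) := by
  refine all_intro (by rw [Formula.fv_ball _ _ _ (by simpa [Term.fv] using hx)]; simp [Term.fv, hx]) ?_
  exact tc2 (ball_self x t.succ φ) (lt_mono_succ hT (.var x) t)
    (by intro a; simp only [pval]; tauto)

theorem ball_zero (hT : Extends T PAK) (x : ℕ) (φ : Formula) : T ⊩ Formula.ball x .zero φ :=
  .gen x (tc1 (not_lt_zero' hT (.var x)) (by intro a; simp only [pval]; tauto))

theorem ball_box (hT : Extends T PAK) {x : ℕ} {t : Term} {φ : Formula} (hx : x ∉ t.fv)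
    (h : T ⊩ φ.imp φ.box) : T ⊩ (Formula.ball x t φ).imp (Formula.ball x t φ).box := by
  obtain ⟨c, hc⟩ := exists_freeFor φ
  obtain ⟨d, hd⟩ := exists_bound (φ.fv ∪ t.fv ∪ {x})
  let y := c + d
  have hfy := hc y (by omega)
  have hyφ : y ∉ φ.fv := fun h => by have := hd y (by simp [h]); omega
  have hyx : y ≠ x := fun h => by have := hd y (by simp [h]); omega
  have hxy : x ∉ (Term.var y).fv := by simp [Term.fv]; exact hyx.symm
  have key : T ⊩ (Formula.ball x (.var y) φ).imp (Formula.ball x (.var y) φ).box := by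
    refine ind hT y ?_ ?_
    · rw [Formula.subst_imp, Formula.subst_box, ball_subst_var _ _ hyx hyφ]
      exact pr_K (.nec (ball_zero hT x φ))
    · rw [Formula.subst_imp, Formula.subst_box, ball_subst_var _ _ hyx hyφ]
      have h1 := ball_mono_bound hT x (.var y) φ hxy
      have h2 : T ⊩ (Formula.ball x (Term.var y).succ φ).imp (φ.subst x (.var y)) := by
        have h2 := Provable.logic (T := T) (.allE x (.var y)
          ((Formula.lt (.var x) (Term.var y).succ).imp φ) ⟨trivial, hfy x⟩)
        rw [Formula.subst_imp, Formula.subst_lt, Term.subst_var_self, Term.subst_succ,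
          Term.subst_var_ne _ hyx] at h2
        exact tc2 h2 (lt_succ_self hT (.var y)) (by intro a; simp only [pval, Formula.ball]; tauto)
      have h3 : T ⊩ (φ.subst x (.var y)).imp (φ.subst x (.var y)).box :=
        subst_rule (φ := φ.imp φ.box) x (.var y) ⟨hfy x, hfy x⟩ h
      have h4 : T ⊩ (Formula.ball x (.var y) φ).imp ((φ.subst x (.var y)).imp
          (Formula.ball x (Term.var y).succ φ)) := by
        have : T ⊩ ((Formula.ball x (.var y) φ).and (φ.subst x (.var y))).imp
          (Formula.ball x (Term.var y).succ φ) := by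
          refine all_intro ?_ ?_
          · simp only [Formula.fv, Finset.mem_union, not_or]
            refine ⟨by rw [Formula.fv_ball _ _ _ hxy]; simp [hxy], fun hh => ?_⟩
            rcases Formula.fv_subst hh with hh | hh
            · exact hh.2 rfl
            · exact hxy hh.1
          · exact tc3 (ball_self x (.var y) φ) (lt_succ hT (.var x) (.var y))
              (leibniz_var hT (.var y) x φ (hfy x))
              (by intro a; simp only [pval, Formula.iff]; tauto)
        exact tc1 this (by intro a; simp only [pval]; tauto)
      exact tc4 h1 h2 h3 (boxK2 hT h4) (by intro a; simp only [pval]; tauto)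
  have := subst_rule y t (by
    refine ⟨Or.inr (Or.inr ⟨hx, trivial, Formula.freeFor_not_fv _ hyφ⟩),
      Or.inr (Or.inr ⟨hx, trivial, Formula.freeFor_not_fv _ hyφ⟩)⟩) key
  rwa [Formula.subst_imp, Formula.subst_box, ball_subst_var _ _ hyx hyφ] at this

theorem ex_box (hT : Extends T PAK) {x : ℕ} {φ : Formula} (h : T ⊩ φ.imp φ.box) :
    T ⊩ (Formula.ex x φ).imp (Formula.ex x φ).box :=
  ex_elim (by simp [Formula.fv]) (pr_trans h (boxK hT (ex_self x φ)))

theorem and_box (hT : Extends T PAK) {φ ψ : Formula} (h1 : T ⊩ φ.imp φ.box)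
    (h2 : T ⊩ ψ.imp ψ.box) : T ⊩ (φ.and ψ).imp (φ.and ψ).box :=
  tc3 h1 h2 (boxK2 hT (.logic (.andI φ ψ))) (by intro a; simp only [pval]; tauto)

theorem or_box (hT : Extends T PAK) {φ ψ : Formula} (h1 : T ⊩ φ.imp φ.box)
    (h2 : T ⊩ ψ.imp ψ.box) : T ⊩ (φ.or ψ).imp (φ.or ψ).box :=
  tc4 h1 h2 (boxK hT (.logic (.orI1 φ ψ))) (boxK hT (.logic (.orI2 φ ψ)))
    (by intro a; simp only [pval]; tauto)

/-- From provably equivalent formulas. -/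
theorem box_congr (hT : Extends T PAK) {φ ψ : Formula} (h : T ⊩ φ.imp φ.box)
    (h1 : T ⊩ φ.imp ψ) (h2 : T ⊩ ψ.imp φ) : T ⊩ ψ.imp ψ.box :=
  pr_trans (pr_trans h2 h) (boxK hT h1)

theorem ball_mono {x : ℕ} {t : Term} {φ ψ : Formula} (h : T ⊩ φ.imp ψ) :
    T ⊩ (Formula.ball x t φ).imp (Formula.ball x t ψ) :=
  all_mono (tc1 h (by intro a; simp only [pval]; tauto))
theorem bex_mono {x : ℕ} {t : Term} {φ ψ : Formula} (h : T ⊩ φ.imp ψ) :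
    T ⊩ (Formula.bex x t φ).imp (Formula.bex x t ψ) :=
  ex_mono (tc1 h (by intro a; simp only [pval]; tauto))

theorem neg_ball1 (x : ℕ) (t : Term) (φ : Formula) :
    T ⊩ (Formula.ball x t φ).neg.imp (Formula.bex x t φ.neg) := by
  have : T ⊩ (Formula.bex x t φ.neg).neg.imp (Formula.ball x t φ) := by
    refine all_intro (by simp [Formula.fv, Formula.bex]) ?_
    exact tc1 (bex_self x t φ.neg) (by intro a; simp only [pval]; tauto)
  exact tc1 this (by intro a; simp only [pval]; tauto)
theorem neg_ball2 (x : ℕ) (t : Term) (φ : Formula) :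
    T ⊩ (Formula.bex x t φ.neg).imp (Formula.ball x t φ).neg := by
  refine ex_elim (by simp [Formula.fv, Formula.ball]) ?_
  exact tc1 (ball_self x t φ) (by intro a; simp only [pval]; tauto)
theorem neg_bex1 (x : ℕ) (t : Term) (φ : Formula) :
    T ⊩ (Formula.bex x t φ).neg.imp (Formula.ball x t φ.neg) := by
  refine all_intro (by simp [Formula.fv, Formula.bex]) ?_
  exact tc1 (bex_self x t φ) (by intro a; simp only [pval]; tauto)
theorem neg_bex2 (x : ℕ) (t : Term) (φ : Formula) :
    T ⊩ (Formula.ball x t φ.neg).imp (Formula.bex x t φ).neg := by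
  have : T ⊩ (Formula.bex x t φ).imp (Formula.ball x t φ.neg).neg := by
    refine ex_elim (by simp [Formula.fv, Formula.ball]) ?_
    exact tc1 (ball_self x t φ.neg) (by intro a; simp only [pval]; tauto)
  exact tc1 this (by intro a; simp only [pval]; tauto)

theorem delta0_box (hT : Extends T PAK) {φ : Formula} (h : IsDelta0 φ) :
    T ⊩ φ.imp φ.box ∧ T ⊩ φ.neg.imp φ.neg.box := by
  induction h with
  | falsum =>
    refine ⟨.logic (.falsumE _), pr_K (.nec (taut ?_))⟩
    intro a; simp only [pval]; tauto
  | eq t u => exact ⟨eq_box hT t u, neq_box hT t u⟩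
  | le t u => exact ⟨le_box hT t u, nle_box hT t u⟩
  | and h1 h2 ih1 ih2 =>
    refine ⟨and_box hT ih1.1 ih2.1, box_congr hT (or_box hT ih1.2 ih2.2) (taut ?_) (taut ?_)⟩ <;>
    (intro a; simp only [pval]; tauto)
  | or h1 h2 ih1 ih2 =>
    refine ⟨or_box hT ih1.1 ih2.1, box_congr hT (and_box hT ih1.2 ih2.2) (taut ?_) (taut ?_)⟩ <;>
    (intro a; simp only [pval]; tauto)
  | imp h1 h2 ih1 ih2 =>
    refine ⟨box_congr hT (or_box hT ih1.2 ih2.1) (taut ?_) (taut ?_),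
      box_congr hT (and_box hT ih1.1 ih2.2) (taut ?_) (taut ?_)⟩ <;>
    (intro a; simp only [pval]; tauto)
  | neg h ih =>
    refine ⟨ih.2, box_congr hT ih.1 (taut ?_) (taut ?_)⟩ <;>
    (intro a; simp only [pval]; tauto)
  | ball hx h ih =>
    exact ⟨ball_box hT hx ih.1, box_congr hT (ex_box hT (and_box hT (le_box hT _ _) ih.2))
      (neg_ball2 _ _ _) (neg_ball1 _ _ _)⟩
  | bex hx h ih =>
    exact ⟨ex_box hT (and_box hT (le_box hT _ _) ih.1), box_congr hT (ball_box hT hx ih.2)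
      (neg_bex2 _ _ _) (neg_bex1 _ _ _)⟩

theorem sigma1_box (hT : Extends T PAK) {φ : Formula} (h : IsSigma1 φ) : T ⊩ φ.imp φ.box := by
  induction h with
  | delta0 h => exact (delta0_box hT h).1
  | and h1 h2 ih1 ih2 => exact and_box hT ih1 ih2
  | or h1 h2 ih1 ih2 => exact or_box hT ih1 ih2
  | ex h ih => exact ex_box hT ih
  | ball hx h ih => exact ball_box hT hx ih

/-! ### Numerals and completeness -/

theorem num_add (hT : Extends T PAK) (n m : ℕ) :
    T ⊩ Formula.eq ((Term.numeral n).add (.numeral m)) (.numeral (n + m)) := by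
  induction m with
  | zero => exact add_zero' hT _
  | succ m ih => exact et (add_succ' hT _ _) (.mp (.logic (.eqSucc _ _)) ih)

theorem num_mul (hT : Extends T PAK) (n m : ℕ) :
    T ⊩ Formula.eq ((Term.numeral n).mul (.numeral m)) (.numeral (n * m)) := by
  induction m with
  | zero => exact mul_zero' hT _
  | succ m ih =>
    refine et (mul_succ' hT _ _) (et ?_ (num_add hT _ _))
    exact .mp (.mp (.logic (.eqAdd _ _ _ _)) ih) (er _)

theorem num_le (hT : Extends T PAK) {n m : ℕ} (h : n ≤ m) :
    T ⊩ Formula.le (.numeral n) (.numeral m) := by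
  obtain ⟨k, rfl⟩ := Nat.exists_eq_add_of_le h
  exact .mp (le_intro hT _ _ _) (num_add hT n k)

theorem num_lt (hT : Extends T PAK) {n m : ℕ} (h : n < m) :
    T ⊩ Formula.lt (.numeral n) (.numeral m) := num_le hT (n := n + 1) h

theorem num_nle (hT : Extends T PAK) {n m : ℕ} (h : ¬ n ≤ m) :
    T ⊩ (Formula.le (.numeral n) (.numeral m)).neg :=
  .mp (not_le_of_lt hT _ _) (num_lt hT (not_le.1 h))

theorem num_ne (hT : Extends T PAK) {n m : ℕ} (h : n ≠ m) :
    T ⊩ (Formula.eq (.numeral n) (.numeral m)).neg := by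
  rcases lt_or_gt_of_ne h with h | h
  · exact .mp (ne_of_lt hT _ _) (num_lt hT h)
  · exact tc2 (Provable.mp (ne_of_lt hT _ _) (num_lt hT h))
      (.logic (.eqSymm (Term.numeral n) (.numeral m))) (by intro a; simp only [pval]; tauto)

/-- In context `C` the variables in `S` have the values given by `v`. -/
def Ctx (T : Set Formula) (C : Formula) (v : ℕ → ℕ) (S : Finset ℕ) : Prop :=
  ∀ x ∈ S, T ⊩ C.imp (.eq (.var x) (.numeral (v x)))

theorem Ctx.mono {C : Formula} {v : ℕ → ℕ} {S S' : Finset ℕ} (h : Ctx T C v S) (hS : S' ⊆ S) :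
    Ctx T C v S' := fun x hx => h x (hS hx)

theorem ctx_ex {C : Formula} {v : ℕ → ℕ} {S : Finset ℕ} {x : ℕ} (h : Ctx T C v (S.erase x)) :
    Ctx T (.ex x C) v (S.erase x) := by
  intro y hy
  refine ex_elim ?_ (h y hy)
  simp [Formula.fv, Term.fv, Term.numeral_fv]
  rintro rfl; simp at hy

theorem ctx_ext {C : Formula} {v : ℕ → ℕ} {S : Finset ℕ} {x : ℕ} (k : ℕ)
    (h : Ctx T C v (S.erase x)) :
    Ctx T ((Formula.ex x C).and (.eq (.var x) (.numeral k))) (Function.update v x k) S := by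
  intro y hy
  by_cases hx : y = x
  · subst hx; rw [Function.update_self]; exact .logic (.andE2 _ _)
  · rw [Function.update_of_ne hx]
    exact pr_trans (.logic (.andE1 _ _)) (ctx_ex h y (by simp [hx, hy]))

theorem term_eval (hT : Extends T PAK) {C : Formula} {v : ℕ → ℕ} (t : Term)
    (h : Ctx T C v t.fv) : T ⊩ C.imp (.eq t (.numeral (t.val v))) := by
  induction t with
  | var x => exact h x (by simp [Term.fv])
  | zero => exact pr_K (er _)
  | succ t ih => exact cesucc (ih h)
  | add t u ih1 ih2 =>
    exact cet (ceadd (ih1 (h.mono (by simp [Term.fv]))) (ih2 (h.mono (by simp [Term.fv]))))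
      (pr_K (num_add hT _ _))
  | mul t u ih1 ih2 =>
    exact cet (cemul (ih1 (h.mono (by simp [Term.fv]))) (ih2 (h.mono (by simp [Term.fv]))))
      (pr_K (num_mul hT _ _))

theorem lt_num_elim (hT : Extends T PAK) {D χ : Formula} {t : Term} (n : ℕ)
    (h : ∀ k < n, T ⊩ D.imp ((Formula.eq t (.numeral k)).imp χ)) :
    T ⊩ D.imp ((Formula.lt t (.numeral n)).imp χ) := by
  induction n with
  | zero => exact tc1 (not_lt_zero' hT t) (by intro a; simp only [pval, Term.numeral]; tauto)
  | succ n ih =>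
    exact tc3 (ih fun k hk => h k (by omega)) (h n (by omega)) (lt_succ hT t (.numeral n))
      (by intro a; simp only [pval, Term.numeral]; tauto)

/-- `φ` is provable in all contexts evaluating its variables by `v` and implying `H`. -/
def Pos (T : Set Formula) (H φ : Formula) (v : ℕ → ℕ) : Prop :=
  ∀ C, Ctx T C v φ.fv → T ⊩ C.imp H → T ⊩ C.imp φ

theorem term_lt_congr {C : Formula} {s s' t t' : Term}
    (h : T ⊩ C.imp (.eq s s')) (h' : T ⊩ C.imp (.eq t t')) :
    T ⊩ C.imp ((Formula.lt s t).imp (.lt s' t')) :=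
  pr_S (pr_trans (cesucc h) (.logic (.eqLe _ _ _ _))) h'

section pos
variable {H : Formula} {v : ℕ → ℕ}

theorem pos_ball (hT : Extends T PAK) (hH : H.fv = ∅) {x : ℕ} {t : Term} {φ : Formula}
    (hx : x ∉ t.fv)
    (h : ∀ k < t.val v, Pos T H φ (Function.update v x k)) : Pos T H (.ball x t φ) v := by
  intro C hC hCH
  rw [Formula.fv_ball _ _ _ hx] at hC
  have hC1 : Ctx T C v (φ.fv.erase x) := hC.mono (by simp)
  have ht : T ⊩ (Formula.ex x C).imp (.eq t (.numeral (t.val v))) :=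
    ex_elim (by simp [Formula.fv, Term.numeral_fv, hx]) (term_eval hT t (hC.mono (by simp)))
  have hH1 : T ⊩ (Formula.ex x C).imp H := ex_elim (by simp [hH]) hCH
  refine pr_trans (ex_self x C) (all_intro (by simp [Formula.fv]) ?_)
  have h1 : T ⊩ (Formula.ex x C).imp ((Formula.lt (.var x) (.numeral (t.val v))).imp φ) := by
    refine lt_num_elim hT _ fun k hk => ?_
    have := h k hk _ (ctx_ext k hC1) (pr_trans (.logic (.andE1 _ _)) hH1)
    exact tc1 this (by intro a; simp only [pval]; tauto)
  exact tc2 h1 (term_lt_congr (pr_K (er (.var x))) ht) (by intro a; simp only [pval]; tauto)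

theorem pos_ex (hH : H.fv = ∅) {x : ℕ} {φ : Formula}
    (k : ℕ) (h : Pos T H φ (Function.update v x k)) : Pos T H (.ex x φ) v := by
  intro C hC hCH
  have hH1 : T ⊩ (Formula.ex x C).imp H := ex_elim (by simp [hH]) hCH
  refine pr_trans (ex_self x C) ?_
  refine eq_intro (x := x) (t := .numeral k) (by simp [Formula.fv]) (by simp [Term.numeral_fv]) ?_
  have := h _ (ctx_ext k hC) (pr_trans (.logic (.andE1 _ _)) hH1)
  exact tc2 this (ex_self x φ) (by intro a; simp only [pval]; tauto)

theorem pos_and {φ ψ : Formula} (h1 : Pos T H φ v) (h2 : Pos T H ψ v) : Pos T H (φ.and ψ) v :=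
  fun C hC hCH => tc2 (h1 C (hC.mono (by simp [Formula.fv])) hCH)
    (h2 C (hC.mono (by simp [Formula.fv])) hCH) (by intro a; simp only [pval]; tauto)
theorem pos_or1 {φ ψ : Formula} (h1 : Pos T H φ v) : Pos T H (φ.or ψ) v :=
  fun C hC hCH => tc1 (h1 C (hC.mono (by simp [Formula.fv])) hCH)
    (by intro a; simp only [pval]; tauto)
theorem pos_or2 {φ ψ : Formula} (h1 : Pos T H ψ v) : Pos T H (φ.or ψ) v :=
  fun C hC hCH => tc1 (h1 C (hC.mono (by simp [Formula.fv])) hCH)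
    (by intro a; simp only [pval]; tauto)
theorem pos_lt (hT : Extends T PAK) {t u : Term} (h : t.val v < u.val v) :
    Pos T H (.lt t u) v := by
  intro C hC _
  have h1 := term_lt_congr (ces (term_eval hT t (hC.mono (by simp [Formula.lt, Formula.fv, Term.fv]))))
    (ces (term_eval hT u (hC.mono (by simp [Formula.lt, Formula.fv]))))
  exact tc2 h1 (num_lt hT h) (by intro a; simp only [pval]; tauto)
theorem pos_bex (hT : Extends T PAK) (hH : H.fv = ∅) {x : ℕ} {t : Term} {φ : Formula}
    {k : ℕ} (hk : k < t.val (Function.update v x k))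
    (h : Pos T H φ (Function.update v x k)) : Pos T H (.bex x t φ) v :=
  pos_ex hH k (pos_and (pos_lt hT (by simpa [Term.val] using hk)) h)
theorem pos_congr {φ ψ : Formula} (h : Pos T H φ v) (hf : φ.fv ⊆ ψ.fv) (hp : T ⊩ φ.imp ψ) :
    Pos T H ψ v := fun C hC hCH => pr_trans (h C (hC.mono hf) hCH) hp

end pos

theorem Term.val_update {t : Term} {x : ℕ} (hx : x ∉ t.fv) (v : ℕ → ℕ) (k : ℕ) :
    t.val (Function.update v x k) = t.val v := by
  induction t with
  | var y => simp [Term.fv] at hx; simp [Term.val, Ne.symm hx]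
  | zero => rfl
  | succ t ih => simp only [Term.val]; rw [ih (by simpa [Term.fv] using hx)]
  | add t u ih1 ih2 | mul t u ih1 ih2 =>
    simp only [Term.fv, Finset.mem_union, not_or] at hx
    simp only [Term.val]; rw [ih1 hx.1, ih2 hx.2]

theorem val_ball {x : ℕ} {t : Term} {φ : Formula} (hx : x ∉ t.fv) (v : ℕ → ℕ) :
    (Formula.ball x t φ).val v ↔ ∀ k < t.val v, φ.val (Function.update v x k) := by
  simp [Formula.ball, Formula.lt, Formula.val, Term.val, Term.val_update hx]
theorem val_bex {x : ℕ} {t : Term} {φ : Formula} (hx : x ∉ t.fv) (v : ℕ → ℕ) :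
    (Formula.bex x t φ).val v ↔ ∃ k < t.val v, φ.val (Function.update v x k) := by
  simp [Formula.bex, Formula.lt, Formula.val, Term.val, Term.val_update hx]

theorem delta0_pos (hT : Extends T PAK) {H : Formula} (hH : H.fv = ∅) {φ : Formula}
    (h : IsDelta0 φ) : ∀ v, (φ.val v → Pos T H φ v) ∧ (¬ φ.val v → Pos T H φ.neg v) := by
  induction h with
  | falsum =>
    refine fun v => ⟨fun h => h.elim, fun _ C _ _ => pr_K (taut ?_)⟩
    intro a; simp only [pval]; tauto
  | eq t u =>
    have : ∀ {C v}, Ctx T C v (Formula.eq t u).fv → T ⊩ C.imp (.eq t (.numeral (t.val v))) ∧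
      T ⊩ C.imp (.eq u (.numeral (u.val v))) := fun hC =>
      ⟨term_eval hT t (hC.mono (by simp [Formula.fv])), term_eval hT u (hC.mono (by simp [Formula.fv]))⟩
    refine fun v => ⟨fun h C hC _ => ?_, fun h C hC _ => ?_⟩
    · have h1 := this hC
      rw [show t.val v = u.val v from h] at h1
      exact cet h1.1 (ces h1.2)
    · have h1 := this hC
      have h2 : T ⊩ (C.and (.eq t u)).imp (.eq (.numeral (t.val v)) (.numeral (u.val v))) :=
        cet (ces (pr_trans (.logic (.andE1 _ _)) h1.1)) (cet (.logic (.andE2 _ _))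
          (pr_trans (.logic (.andE1 _ _)) h1.2))
      exact tc2 h2 (num_ne hT h) (by intro a; simp only [pval]; tauto)
  | le t u =>
    have : ∀ {C v}, Ctx T C v (Formula.eq t u).fv → T ⊩ C.imp (.eq t (.numeral (t.val v))) ∧
      T ⊩ C.imp (.eq u (.numeral (u.val v))) := fun hC =>
      ⟨term_eval hT t (hC.mono (by simp [Formula.fv])), term_eval hT u (hC.mono (by simp [Formula.fv]))⟩
    refine fun v => ⟨fun h C hC _ => ?_, fun h C hC _ => ?_⟩
    · have h1 := this hC
      exact cele (ces h1.1) (ces h1.2) (pr_K (num_le hT h))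
    · have h1 := this hC
      have h2 : T ⊩ (C.and (.le t u)).imp (.le (.numeral (t.val v)) (.numeral (u.val v))) :=
        cele (pr_trans (.logic (.andE1 _ _)) h1.1) (pr_trans (.logic (.andE1 _ _)) h1.2)
          (.logic (.andE2 _ _))
      exact tc2 h2 (num_nle hT h) (by intro a; simp only [pval]; tauto)
  | @and φ ψ h1 h2 ih1 ih2 =>
    refine fun v => ⟨fun h => pos_and ((ih1 v).1 h.1) ((ih2 v).1 h.2), fun h => ?_⟩
    by_cases h1 : φ.val v
    · exact pos_congr ((ih2 v).2 fun h2 => h ⟨h1, h2⟩) (by simp [Formula.fv])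
        (taut (by intro a; simp only [pval]; tauto))
    · exact pos_congr ((ih1 v).2 h1) (by simp [Formula.fv])
        (taut (by intro a; simp only [pval]; tauto))
  | @or φ ψ h1 h2 ih1 ih2 =>
    refine fun v => ⟨fun h => h.elim (fun h => pos_or1 ((ih1 v).1 h))
      (fun h => pos_or2 ((ih2 v).1 h)), fun h => ?_⟩
    exact pos_congr (pos_and ((ih1 v).2 fun h1 => h (Or.inl h1)) ((ih2 v).2 fun h1 => h (Or.inr h1)))
      (by simp [Formula.fv]) (taut (by intro a; simp only [pval]; tauto))
  | @imp φ ψ h1 h2 ih1 ih2 =>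
    refine fun v => ⟨fun h => ?_, fun h => ?_⟩
    · by_cases h1 : φ.val v
      · exact pos_congr ((ih2 v).1 (h h1)) (by simp [Formula.fv])
          (taut (by intro a; simp only [pval]; tauto))
      · exact pos_congr ((ih1 v).2 h1) (by simp [Formula.fv])
          (taut (by intro a; simp only [pval]; tauto))
    · have h1 : φ.val v := by by_contra h'; exact h fun h => (h' h).elim
      have h2 : ¬ ψ.val v := fun h' => h fun _ => h'
      exact pos_congr (pos_and ((ih1 v).1 h1) ((ih2 v).2 h2)) (by simp [Formula.fv])
          (taut (by intro a; simp only [pval]; tauto))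
  | @neg φ h ih =>
    refine fun v => ⟨fun h => (ih v).2 h, fun h => ?_⟩
    exact pos_congr ((ih v).1 (by by_contra h'; exact h h')) (by simp [Formula.fv])
          (taut (by intro a; simp only [pval]; tauto))
  | @ball x t φ hx h ih =>
    refine fun v => ⟨fun h => ?_, fun h => ?_⟩
    · rw [val_ball hx] at h
      exact pos_ball hT hH hx fun k hk => (ih _).1 (h k hk)
    · rw [val_ball hx] at h
      push Not at h
      obtain ⟨k, hk, h⟩ := h
      refine pos_congr (pos_bex hT hH (x := x) (t := t) (k := k) (by rwa [Term.val_update hx])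
        ((ih _).2 h)) ?_ (neg_ball2 _ _ _)
      rw [Formula.fv_bex _ _ _ hx]
      simp only [Formula.fv]
      rw [Formula.fv_ball _ _ _ hx]
  | @bex x t φ hx h ih =>
    refine fun v => ⟨fun h => ?_, fun h => ?_⟩
    · rw [val_bex hx] at h
      obtain ⟨k, hk, h⟩ := h
      exact pos_bex hT hH (by rwa [Term.val_update hx]) ((ih _).1 h)
    · rw [val_bex hx] at h
      push Not at h
      refine pos_congr (pos_ball hT hH hx fun k hk => (ih _).2 (h k hk)) ?_ (neg_bex2 _ _ _)
      rw [Formula.fv_ball _ _ _ hx]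
      simp only [Formula.fv]
      rw [Formula.fv_bex _ _ _ hx]

theorem sigma1_pos (hT : Extends T PAK) {H : Formula} (hH : H.fv = ∅) {φ : Formula}
    (h : IsSigma1 φ) : ∀ v, φ.val v → Pos T H φ v := by
  induction h with
  | delta0 h => exact fun v => (delta0_pos hT hH h v).1
  | and h1 h2 ih1 ih2 => exact fun v h => pos_and (ih1 v h.1) (ih2 v h.2)
  | or h1 h2 ih1 ih2 =>
    exact fun v h => h.elim (fun h => pos_or1 (ih1 v h)) (fun h => pos_or2 (ih2 v h))
  | ex h ih => rintro v ⟨k, hk⟩; exact pos_ex hH k (ih _ hk)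
  | ball hx h ih =>
    intro v h
    rw [val_ball hx] at h
    exact pos_ball hT hH hx fun k hk => ih _ (h k hk)

/-- Truth. -/
def top : Formula := Formula.falsum.neg
theorem pr_top : T ⊩ top := taut (by intro a; simp only [pval, top]; tauto)
theorem top_fv : top.fv = ∅ := rfl

theorem pos_sentence {φ : Formula} (hs : φ.fv = ∅) {v : ℕ → ℕ} (h : Pos T top φ v) : T ⊩ φ :=
  .mp (h top (by intro x hx; simp [hs] at hx) (pr_id _)) pr_top

theorem sigma1_complete (hT : Extends T PAK) {φ : Formula} (h : IsSigma1 φ) (hs : Sentence φ)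
    (ht : StdTrue φ) : T ⊩ φ :=
  pos_sentence hs (sigma1_pos hT top_fv h _ ht)

theorem deltaB_dec_aux (hT : Extends T PAK) {φ : Formula} (h : IsDeltaB φ) : ∀ v,
    Pos T (Formula.box .falsum) φ v ∨ Pos T top φ.neg v := by
  have hH : (Formula.box .falsum).fv = ∅ := rfl
  induction h with
  | @delta0 φ h =>
    intro v
    by_cases hv : φ.val v
    · exact Or.inl ((delta0_pos hT hH h v).1 hv)
    · exact Or.inr ((delta0_pos hT top_fv h v).2 hv)
  | b ψ => exact fun v => Or.inl fun C _ hC => pr_trans hC (boxK hT (.logic (.falsumE _)))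
  | and h1 h2 ih1 ih2 =>
    intro v
    rcases ih1 v with h1 | h1
    · rcases ih2 v with h2 | h2
      · exact Or.inl (pos_and h1 h2)
      · exact Or.inr (pos_congr h2 (by simp [Formula.fv])
          (taut (by intro a; simp only [pval]; tauto)))
    · exact Or.inr (pos_congr h1 (by simp [Formula.fv])
          (taut (by intro a; simp only [pval]; tauto)))
  | or h1 h2 ih1 ih2 =>
    intro v
    rcases ih1 v with h1 | h1
    · exact Or.inl (pos_or1 h1)
    · rcases ih2 v with h2 | h2
      · exact Or.inl (pos_or2 h2)
      · exact Or.inr (pos_congr (pos_and h1 h2) (by simp [Formula.fv])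
          (taut (by intro a; simp only [pval]; tauto)))
  | @ball x t φ hx h ih =>
    intro v
    by_cases hh : ∀ k < t.val v, Pos T (Formula.box .falsum) φ (Function.update v x k)
    · exact Or.inl (pos_ball hT hH hx hh)
    · push Not at hh
      obtain ⟨k, hk, hh⟩ := hh
      right
      refine pos_congr (pos_bex hT top_fv (x := x) (t := t) (k := k) (by rwa [Term.val_update hx])
        ((ih _).resolve_left hh)) ?_ (neg_ball2 _ _ _)
      rw [Formula.fv_bex _ _ _ hx]
      simp only [Formula.fv]
      rw [Formula.fv_ball _ _ _ hx]
  | @bex x t φ hx h ih =>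
    intro v
    by_cases hh : ∀ k < t.val v, Pos T top φ.neg (Function.update v x k)
    · right
      refine pos_congr (pos_ball hT top_fv hx hh) ?_ (neg_bex2 _ _ _)
      rw [Formula.fv_ball _ _ _ hx]
      simp only [Formula.fv]
      rw [Formula.fv_bex _ _ _ hx]
    · push Not at hh
      obtain ⟨k, hk, hh⟩ := hh
      exact Or.inl (pos_bex hT hH (by rwa [Term.val_update hx]) ((ih _).resolve_right hh))

theorem deltaB_dec (hT : Extends T PAK) {φ : Formula} (h : IsDeltaB φ) (hs : Sentence φ) :
    T ⊩ (Formula.box .falsum).imp φ ∨ T ⊩ φ.neg := by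
  rcases deltaB_dec_aux hT h (fun _ => 0) with h | h
  · exact Or.inl (h _ (by intro x hx; simp [show φ.fv = ∅ from hs] at hx) (pr_id _))
  · exact Or.inr (pos_sentence hs h)

end sigmacompl

end ModalArith


namespace ModalArith

section normalform
variable {T : Set Formula}

theorem Term.val_congr (t : Term) {v w : ℕ → ℕ} (h : ∀ i ∈ t.fv, v i = w i) :
    t.val v = t.val w := by
  induction t with
  | var x => exact h x (by simp [Term.fv])
  | zero => rfl
  | succ t ih => simp only [Term.val]; rw [ih h]
  | add t u ih1 ih2 | mul t u ih1 ih2 =>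
    simp only [Term.val]
    rw [ih1 fun i hi => h i (by simp [Term.fv, hi]), ih2 fun i hi => h i (by simp [Term.fv, hi])]

theorem Formula.val_congr (φ : Formula) : ∀ {v w : ℕ → ℕ} (_ : ∀ i ∈ φ.fv, v i = w i),
    (φ.val v ↔ φ.val w) := by
  induction φ with
  | falsum => intros; rfl
  | eq t u | le t u =>
    intro v w h
    simp only [Formula.val]
    rw [t.val_congr fun i hi => h i (by simp [Formula.fv, hi]),
      u.val_congr fun i hi => h i (by simp [Formula.fv, hi])]
  | and φ ψ ih1 ih2 | or φ ψ ih1 ih2 | imp φ ψ ih1 ih2 =>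
    intro v w h
    simp only [Formula.val]
    rw [ih1 fun i hi => h i (by simp [Formula.fv, hi]), ih2 fun i hi => h i (by simp [Formula.fv, hi])]
  | neg φ ih =>
    intro v w h
    simp only [Formula.val]
    rw [ih h]
  | box φ ih => intros; rfl
  | all x φ ih =>
    intro v w h
    simp only [Formula.val]
    refine forall_congr' fun n => ih fun i hi => ?_
    by_cases hx : i = x
    · subst hx; simp
    · rw [Function.update_of_ne hx, Function.update_of_ne hx]
      exact h i (by simp [Formula.fv, hi, hx])
  | ex x φ ih =>
    intro v w h
    simp only [Formula.val]
    refine exists_congr fun n => ih fun i hi => ?_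
    by_cases hx : i = x
    · subst hx; simp
    · rw [Function.update_of_ne hx, Function.update_of_ne hx]
      exact h i (by simp [Formula.fv, hi, hx])

theorem Formula.val_update {φ : Formula} {x : ℕ} (hx : x ∉ φ.fv) (v : ℕ → ℕ) (k : ℕ) :
    φ.val (Function.update v x k) ↔ φ.val v :=
  φ.val_congr fun i hi => Function.update_of_ne (by rintro rfl; exact hx hi) _ _

/-- `δ` is a Δ₀ normal form matrix of `φ` with witness variable `p`. -/
structure NF (T : Set Formula) (φ : Formula) (p : ℕ) (δ : Formula) : Prop where
  d0 : IsDelta0 δ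
  fv : δ.fv ⊆ insert p φ.fv
  imp : T ⊩ δ.imp φ
  ex : T ⊩ φ.imp (.ex p δ)
  val : ∀ v, φ.val v ↔ ∃ n, δ.val (Function.update v p n)

theorem NF.notMem {φ δ : Formula} {p i : ℕ} (h : NF T φ p δ) (hi : i ≠ p) (hi' : i ∉ φ.fv) :
    i ∉ δ.fv := fun hh => by
  have := h.fv hh
  simp at this
  tauto

theorem lt_ex_bound (hT : Extends T PAK) (a q : ℕ) (hqa : q ≠ a) {χ : Formula}
    (hχ : q ∉ χ.fv) (h : T ⊩ (Formula.lt (.var a) (.var q)).imp χ) : T ⊩ χ :=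
  ex_bound hT a a q hqa hqa hχ (tc1 h (by intro a; simp only [pval]; tauto))

theorem nf_wrap (hT : Extends T PAK) {φ δ : Formula} {q p : ℕ} (hq : q ∉ φ.fv) (hp : p ∉ φ.fv)
    (h : NF T φ q δ) : ∃ δ, NF T φ p δ := by
  by_cases hpq : p = q
  · subst hpq; exact ⟨δ, h⟩
  have hqp : q ∉ (Term.var p).fv := by simp [Term.fv]; exact fun h => hpq h.symm
  have hpδ := h.notMem hpq hp
  refine ⟨.bex q (.var p) δ, .bex hqp h.d0, ?_, ?_, ?_, ?_⟩
  · rw [Formula.fv_bex _ _ _ hqp]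
    intro i hi
    simp only [Finset.mem_union, Term.fv, Finset.mem_singleton, Finset.mem_erase,
      Finset.mem_insert] at hi ⊢
    rcases hi with hi | hi
    · exact Or.inl hi
    · have := h.fv hi.2
      simp at this
      tauto
  · exact ex_elim hq (tc1 h.imp (by intro a; simp only [pval]; tauto))
  · refine pr_trans h.ex (ex_elim ?_ ?_)
    · simp [Formula.fv, Formula.bex]
    · refine lt_ex_bound hT q p hpq ?_ ?_
      · simp [Formula.fv, hpδ]
      · exact tc2 (bex_self q (.var p) δ) (ex_self p (.bex q (.var p) δ))
          (by intro a; simp only [pval]; tauto)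
  · intro v
    rw [h.val]
    simp only [val_bex hqp, Term.val, Function.update_self]
    have : ∀ n k, δ.val (Function.update (Function.update v p n) q k) ↔
        δ.val (Function.update v q k) := by
      intro n k
      rw [Function.update_comm hpq, Formula.val_update hpδ]
    simp only [this]
    constructor
    · rintro ⟨n, hn⟩; exact ⟨n + 1, n, by omega, hn⟩
    · rintro ⟨n, k, _, hk⟩; exact ⟨k, hk⟩

set_option maxHeartbeats 2000000 in
theorem collection (hT : Extends T PAK) {x p q : ℕ} {t : Term} {δ : Formula} (hx : x ∉ t.fv)
    (hxp : x ≠ p) (hqt : q ∉ t.fv) (hqx : q ≠ x) (hqp : q ≠ p) (hqδ : q ∉ δ.fv) :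
    T ⊩ (Formula.ball x t (.ex p δ)).imp (.ex q (.ball x t (.bex p (.var q) δ))) := by
  obtain ⟨c, hc⟩ := exists_freeFor δ
  obtain ⟨d, hd⟩ := exists_bound (δ.fv ∪ t.fv ∪ {x, p, q})
  let y := c + d
  let r := c + d + 1
  have hfy := hc y (by omega)
  have hyδ : y ∉ δ.fv := fun h => by have := hd y (by simp [h]); omega
  have hyx : y ≠ x := fun h => by have := hd y (by simp [h]); omega
  have hyp : y ≠ p := fun h => by have := hd y (by simp [h]); omega
  have hyq : y ≠ q := fun h => by have := hd y (by simp [h]); omega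
  have hrδ : r ∉ δ.fv := fun h => by have := hd r (by simp [h]); omega
  have hrx : r ≠ x := fun h => by have := hd r (by simp [h]); omega
  have hrp : r ≠ p := fun h => by have := hd r (by simp [h]); omega
  have hrq : r ≠ q := fun h => by have := hd r (by simp [h]); omega
  have hry : r ≠ y := by omega
  have hxy : x ∉ (Term.var y).fv := by simp [Term.fv]; exact hyx.symm
  have hpq : p ∉ (Term.var q).fv := by simp [Term.fv]; exact hqp.symm
  have hpr : p ∉ (Term.var r).fv := by simp [Term.fv]; exact hrp.symm
  have hyE : y ∉ (Formula.ex p δ).fv := by simp [Formula.fv, hyδ]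
  have hyB : y ∉ (Formula.bex p (.var q) δ).fv := by
    rw [Formula.fv_bex _ _ _ hpq]; simp [Term.fv, hyδ, hyq]
  have sub : ∀ s : Term, ((Formula.ball x (.var y) (.ex p δ)).imp
      (.ex q (.ball x (.var y) (.bex p (.var q) δ)))).subst y s =
      (Formula.ball x s (.ex p δ)).imp (.ex q (.ball x s (.bex p (.var q) δ))) := by
    intro s
    rw [Formula.subst_imp, ball_subst_var _ _ hyx hyE, Formula.subst_ex_ne _ _ hyq,
      ball_subst_var _ _ hyx hyB]
  have key : T ⊩ (Formula.ball x (.var y) (.ex p δ)).imp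
      (.ex q (.ball x (.var y) (.bex p (.var q) δ))) := by
    refine ind hT y ?_ ?_
    · rw [sub]
      exact pr_K (.mp (ex_self q _) (ball_zero hT x _))
    · rw [sub]
      have h1 := ball_mono_bound hT x (.var y) (.ex p δ) hxy
      have h2 : T ⊩ (Formula.ball x (Term.var y).succ (.ex p δ)).imp
          (.ex p (δ.subst x (.var y))) := by
        have h2 := Provable.logic (T := T) (.allE x (.var y)
          ((Formula.lt (.var x) (Term.var y).succ).imp (.ex p δ))
          ⟨trivial, Or.inr (Or.inr ⟨by simp [Term.fv]; exact hyp.symm, hfy x⟩)⟩)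
        rw [Formula.subst_imp, Formula.subst_lt, Term.subst_var_self, Term.subst_succ,
          Term.subst_var_ne _ hyx, Formula.subst_ex_ne _ _ hxp] at h2
        exact tc2 h2 (lt_succ_self hT (.var y)) (by intro a; simp only [pval, Formula.ball]; tauto)
      let δy := δ.subst x (.var y)
      let W := Formula.ex q (.ball x (Term.var y).succ (.bex p (.var q) δ))
      have hxδy : x ∉ δy.fv := fun hh => by
        rcases Formula.fv_subst hh with hh | hh
        · exact hh.2 rfl
        · exact hxy hh.1
      have hrδy : r ∉ δy.fv := fun hh => by
        rcases Formula.fv_subst hh with hh | hh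
        · exact hrδ hh.1
        · simp [Term.fv] at hh; omega
      have hqδy : q ∉ δy.fv := fun hh => by
        rcases Formula.fv_subst hh with hh | hh
        · exact hqδ hh.1
        · simp only [Term.fv, Finset.mem_singleton] at hh; exact hyq hh.1.symm
      have hpW : p ∉ W.fv := by
        simp [W, Formula.ball, Formula.bex, Formula.lt, Formula.fv, Term.fv, hyp.symm]
      have h3 : T ⊩ (((Formula.ball x (.var y) (.bex p (.var q) δ)).and δy).and
          ((Formula.lt (.var q) (.var r)).and (.lt (.var p) (.var r)))).imp
          (.ball x (Term.var y).succ (.bex p (.var r) δ)) := by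
        refine all_intro ?_ ?_
        · simp only [Formula.fv, Formula.lt, Term.fv, Formula.fv_ball _ _ _ hxy, Finset.mem_union,
            Finset.mem_singleton, Finset.mem_erase, not_or]
          exact ⟨⟨⟨hyx.symm, by simp⟩, hxδy⟩, ⟨hqx.symm, hrx.symm⟩, hxp, hrx.symm⟩
        · have e1 : T ⊩ (Formula.lt (.var q) (.var r)).imp
              ((Formula.bex p (.var q) δ).imp (Formula.bex p (.var r) δ)) := by
            refine ex_elim2 ?_ ?_ ?_
            · simp [Formula.bex, Formula.fv]
            · simp [Formula.lt, Formula.fv, Term.fv, hqp.symm, hrp.symm]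
            · have a1 := le_trans' hT (.var q) (Term.var q).succ (.var r)
              have a2 := lt_trans_le hT (.var p) (.var q) (.var r)
              exact tc4 a1 a2 (le_succ' hT (.var q)) (bex_self p (.var r) δ)
                (by intro a; simp only [pval, Formula.lt]; tauto)
          have e2 := ball_self (T := T) x (.var y) (.bex p (.var q) δ)
          have e3 := lt_succ hT (.var x) (.var y)
          have e4 := leibniz_var hT (.var y) x δ (hfy x)
          have e5 := bex_self (T := T) p (.var r) δ
          refine tc5 e1 e2 e3 e4 e5 (fun a h1 h2 h3 h4 h5 h6 h7 => ?_)
          rcases h3 h7 with h8 | h8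
          · exact h1 h6.2.1 (h2 h6.1.1 h8)
          · exact h5 h6.2.2 ((h4 h8).2 h6.1.2)
      have h4 : T ⊩ (Formula.ball x (Term.var y).succ (.bex p (.var r) δ)).imp W := by
        have := Provable.logic (T := T) (.exI q (.var r)
          (.ball x (Term.var y).succ (.bex p (.var q) δ)) ?_)
        · have e : (Formula.ball x (Term.var y).succ (.bex p (.var q) δ)).subst q (.var r) =
              (Formula.ball x (Term.var y).succ (.bex p (.var r) δ)) := by
            rw [Formula.ball, Formula.subst_all_ne _ _ hqx, Formula.subst_imp, Formula.subst_lt,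
              bex_subst_var _ _ hqp hqδ, Term.subst_var_ne _ hqx.symm, Term.subst_succ,
              Term.subst_var_ne _ hyq]
            rfl
          rwa [e] at this
        · refine Or.inr (Or.inr ⟨by simp [Term.fv]; exact hrx.symm, trivial, ?_⟩)
          exact Or.inr (Or.inr ⟨by simp [Term.fv]; exact hrp.symm, trivial,
            Formula.freeFor_not_fv _ hqδ⟩)
      have h5 : T ⊩ (Formula.ball x (.var y) (.bex p (.var q) δ)).imp (δy.imp W) := by
        refine ex_bound hT q p r hrq hrp ?_ (tc2 h3 h4 (fun a h1 h2 h3 h3' h4 h5 => h2 (h1 ⟨⟨h4, h5⟩, h3, h3'⟩)))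
        have : r ∉ W.fv := by
          simp [W, Formula.ball, Formula.bex, Formula.lt, Formula.fv, Term.fv, hrδ]
          omega
        simp [Formula.fv, Formula.fv_ball _ _ _ hxy,
            Formula.fv_bex _ _ _ hpq, Term.fv, hrδ, hrδy, this, hry, hrq]
      have h6 : T ⊩ (Formula.ball x (.var y) (.bex p (.var q) δ)).imp ((Formula.ex p δy).imp W) := by
        refine ex_elim2 hpW ?_ h5
        simp [Formula.fv, Formula.fv_ball _ _ _ hxy,
            Formula.fv_bex _ _ _ hpq, Term.fv, hyp.symm, hqp.symm]
      have h7 : T ⊩ (Formula.ex q (.ball x (.var y) (.bex p (.var q) δ))).imp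
          ((Formula.ex p δy).imp W) := by
        refine ex_elim ?_ h6
        simp [Formula.fv, W, hqδy]
      exact tc3 h1 h2 h7 (fun a h1 h2 h3 h4 h5 => h3 (h4 (h1 h5)) (h2 h5))
  have := subst_rule y t (by
    refine ⟨Or.inr (Or.inr ⟨hx, trivial, Formula.freeFor_not_fv _ hyE⟩),
      Or.inr (Or.inr ⟨hqt, Or.inr (Or.inr ⟨hx, trivial, Formula.freeFor_not_fv _ hyB⟩)⟩)⟩) key
  rwa [sub] at this

theorem exists_bound_nat (n : ℕ) (P : ℕ → ℕ → Prop) (h : ∀ k < n, ∃ m, P k m) :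
    ∃ N, ∀ k < n, ∃ m < N, P k m := by
  induction n with
  | zero => exact ⟨0, by omega⟩
  | succ n ih =>
    obtain ⟨N, hN⟩ := ih fun k hk => h k (by omega)
    obtain ⟨m, hm⟩ := h n (by omega)
    refine ⟨N + m + 1, fun k hk => ?_⟩
    rcases Nat.lt_succ_iff_lt_or_eq.1 hk with h1 | h1
    · obtain ⟨m', h2, h3⟩ := hN k h1
      exact ⟨m', by omega, h3⟩
    · subst h1; exact ⟨m, by omega, hm⟩

theorem exists_fresh2 (s : Finset ℕ) : ∃ p q, p ∉ s ∧ q ∉ s ∧ p ≠ q := by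
  obtain ⟨p, hp⟩ := exists_fresh s
  obtain ⟨q, hq⟩ := exists_fresh (insert p s)
  simp at hq
  exact ⟨p, q, hp, hq.2, fun h => hq.1 h.symm⟩

set_option maxHeartbeats 4000000 in
theorem exists_nf (hT : Extends T PAK) {φ : Formula} (h : IsSigma1 φ) :
    ∀ p ∉ φ.fv, ∃ δ, NF T φ p δ := by
  suffices hh : ∃ q, q ∉ φ.fv ∧ ∃ δ, NF T φ q δ by
    obtain ⟨q, hq, δ, hδ⟩ := hh
    exact fun p hp => nf_wrap hT hq hp hδ
  induction h with
  | @delta0 φ h =>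
    obtain ⟨q, hq⟩ := exists_fresh φ.fv
    exact ⟨q, hq, φ, h, by simp, pr_id _, ex_self _ _, fun v => by simp [Formula.val_update hq]⟩
  | @and φ ψ h1 h2 ih1 ih2 =>
    obtain ⟨p1', hp1', δ1', hδ1'⟩ := ih1
    obtain ⟨p2', hp2', δ2', hδ2'⟩ := ih2
    obtain ⟨p1, p2, hp1, hp2, h12⟩ := exists_fresh2 (φ.fv ∪ ψ.fv)
    simp only [Finset.mem_union, not_or] at hp1 hp2
    obtain ⟨δ1, hδ1⟩ := nf_wrap hT hp1' hp1.1 hδ1'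
    obtain ⟨δ2, hδ2⟩ := nf_wrap hT hp2' hp2.2 hδ2'
    obtain ⟨q, hq⟩ := exists_fresh (φ.fv ∪ ψ.fv ∪ {p1, p2})
    simp only [Finset.mem_union, Finset.mem_insert, Finset.mem_singleton, not_or] at hq
    have k1 : p1 ∉ (Term.var q).fv := by simp [Term.fv]; exact fun h => hq.2.1 h.symm
    have k2 : p2 ∉ (Term.var q).fv := by simp [Term.fv]; exact fun h => hq.2.2 h.symm
    have hqδ1 := hδ1.notMem hq.2.1 hq.1.1
    have hqδ2 := hδ2.notMem hq.2.2 hq.1.2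
    have hp1δ2 := hδ2.notMem h12 hp1.2
    refine ⟨q, by simp [Formula.fv, hq], (Formula.bex p1 (.var q) δ1).and (.bex p2 (.var q) δ2),
      .and (.bex k1 hδ1.d0) (.bex k2 hδ2.d0), ?_, ?_, ?_, ?_⟩
    · intro i
      simp only [Formula.fv, Formula.fv_bex _ _ _ k1, Formula.fv_bex _ _ _ k2, Term.fv]
      have a1 := @hδ1.fv i
      have a2 := @hδ2.fv i
      simp only [Finset.mem_union, Finset.mem_insert, Finset.mem_singleton, Finset.mem_erase] at *
      tauto
    · have e1 : T ⊩ (Formula.bex p1 (.var q) δ1).imp φ :=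
        ex_elim hp1.1 (tc1 hδ1.imp (by intro a; simp only [pval]; tauto))
      have e2 : T ⊩ (Formula.bex p2 (.var q) δ2).imp ψ :=
        ex_elim hp2.2 (tc1 hδ2.imp (by intro a; simp only [pval]; tauto))
      exact tc2 e1 e2 (by intro a; simp only [pval]; tauto)
    · let W := Formula.ex q ((Formula.bex p1 (.var q) δ1).and (.bex p2 (.var q) δ2))
      have hW1 : p1 ∉ W.fv := by
        simp only [W, Formula.fv, Formula.fv_bex _ _ _ k1, Formula.fv_bex _ _ _ k2, Term.fv,
          Finset.mem_union, Finset.mem_singleton, Finset.mem_erase]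
        tauto
      have hW2 : p2 ∉ W.fv := by
        have := hδ1.notMem h12.symm hp2.1
        simp only [W, Formula.fv, Formula.fv_bex _ _ _ k1, Formula.fv_bex _ _ _ k2, Term.fv,
          Finset.mem_union, Finset.mem_singleton, Finset.mem_erase]
        tauto
      have e1 : T ⊩ δ1.imp (δ2.imp W) := by
        refine ex_bound hT p1 p2 q hq.2.1 hq.2.2 ?_ ?_
        · simp [Formula.fv, W, hqδ1, hqδ2]
        · exact tc3 (bex_self p1 (.var q) δ1) (bex_self p2 (.var q) δ2)
            (ex_self q ((Formula.bex p1 (.var q) δ1).and (.bex p2 (.var q) δ2)))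
            (fun a h1 h2 h3 h4 h4' h5 h6 => h3 ⟨h1 h4 h5, h2 h4' h6⟩)
      have e2 := ex_elim2 (x := p2) hW2 (hδ1.notMem h12.symm hp2.1) e1
      have e3 : T ⊩ (Formula.ex p1 δ1).imp ((Formula.ex p2 δ2).imp W) :=
        ex_elim (by simp only [Formula.fv, Finset.mem_union, Finset.mem_erase, not_or, not_and]; exact ⟨fun _ => hp1δ2, hW1⟩) e2
      exact tc3 hδ1.ex hδ2.ex e3 (fun a h1 h2 h3 h => h3 (h1 h.1) (h2 h.2))
    · intro v
      have a1 : ∀ n k, δ1.val (Function.update (Function.update v q n) p1 k) ↔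
        δ1.val (Function.update v p1 k) := fun n k => by
        rw [Function.update_comm hq.2.1, Formula.val_update hqδ1]
      have a2 : ∀ n k, δ2.val (Function.update (Function.update v q n) p2 k) ↔
        δ2.val (Function.update v p2 k) := fun n k => by
        rw [Function.update_comm hq.2.2, Formula.val_update hqδ2]
      simp only [Formula.val, hδ1.val, hδ2.val, val_bex k1, val_bex k2, Term.val,
        Function.update_self, a1, a2]
      constructor
      · rintro ⟨⟨n, hn⟩, m, hm⟩
        exact ⟨n + m + 1, ⟨n, by omega, hn⟩, m, by omega, hm⟩
      · rintro ⟨_, ⟨n, _, hn⟩, m, _, hm⟩; exact ⟨⟨n, hn⟩, m, hm⟩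
  | @or φ ψ h1 h2 ih1 ih2 =>
    obtain ⟨p1', hp1', δ1', hδ1'⟩ := ih1
    obtain ⟨p2', hp2', δ2', hδ2'⟩ := ih2
    obtain ⟨p, hp⟩ := exists_fresh (φ.fv ∪ ψ.fv)
    simp only [Finset.mem_union, not_or] at hp
    obtain ⟨δ1, hδ1⟩ := nf_wrap hT hp1' hp.1 hδ1'
    obtain ⟨δ2, hδ2⟩ := nf_wrap hT hp2' hp.2 hδ2'
    refine ⟨p, by simp [Formula.fv, hp], δ1.or δ2, .or hδ1.d0 hδ2.d0, ?_, ?_, ?_, ?_⟩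
    · intro i
      have a1 := @hδ1.fv i
      have a2 := @hδ2.fv i
      simp only [Formula.fv, Finset.mem_union, Finset.mem_insert] at *
      tauto
    · exact tc2 hδ1.imp hδ2.imp (by intro a; simp only [pval]; tauto)
    · have e1 : T ⊩ (Formula.ex p δ1).imp (.ex p (δ1.or δ2)) := ex_mono (.logic (.orI1 _ _))
      have e2 : T ⊩ (Formula.ex p δ2).imp (.ex p (δ1.or δ2)) := ex_mono (.logic (.orI2 _ _))
      exact tc4 hδ1.ex hδ2.ex e1 e2 (by intro a; simp only [pval]; tauto)
    · intro v
      simp only [Formula.val, hδ1.val, hδ2.val, exists_or]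
  | @ex x φ h ih =>
    obtain ⟨p', hp', δ', hδ'⟩ := ih
    obtain ⟨p, q, hp, hq, hpq⟩ := exists_fresh2 (φ.fv ∪ {x})
    simp only [Finset.mem_union, Finset.mem_singleton, not_or] at hp hq
    obtain ⟨δ, hδ⟩ := nf_wrap hT hp' hp.1 hδ'
    have k1 : p ∉ (Term.var q).fv := by simp [Term.fv]; exact hpq
    have k2 : x ∉ (Term.var q).fv := by simp [Term.fv]; exact fun h => hq.2 h.symm
    have hqδ := hδ.notMem hpq.symm hq.1
    refine ⟨q, by simp [Formula.fv, hq], .bex x (.var q) (.bex p (.var q) δ),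
      .bex k2 (.bex k1 hδ.d0), ?_, ?_, ?_, ?_⟩
    · intro i
      have a1 := @hδ.fv i
      simp only [Formula.fv, Formula.fv_bex _ _ _ k1, Formula.fv_bex _ _ _ k2, Term.fv]
      simp only [Finset.mem_union, Finset.mem_insert, Finset.mem_singleton, Finset.mem_erase] at *
      tauto
    · refine ex_mono ?_
      have : T ⊩ (Formula.bex p (.var q) δ).imp φ :=
        ex_elim hp.1 (tc1 hδ.imp (by intro a; simp only [pval]; tauto))
      exact tc1 this (by intro a; simp only [pval]; tauto)
    · let W := Formula.ex q (.bex x (.var q) (.bex p (.var q) δ))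
      have e1 : T ⊩ δ.imp W := by
        refine ex_bound hT x p q hq.2 hpq.symm ?_ ?_
        · simp [Formula.fv, W, hqδ]
        · exact tc3 (bex_self p (.var q) δ) (bex_self x (.var q) (.bex p (.var q) δ))
            (ex_self q (.bex x (.var q) (.bex p (.var q) δ)))
            (fun a h1 h2 h3 h4 h4' h5 => h3 (h2 h4 (h1 h4' h5)))
      have hWp : p ∉ W.fv := by
        simp only [W, Formula.fv, Formula.fv_bex _ _ _ k1, Formula.fv_bex _ _ _ k2, Term.fv,
          Finset.mem_union, Finset.mem_singleton, Finset.mem_erase]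
        tauto
      have hWx : x ∉ W.fv := by
        simp only [W, Formula.fv, Formula.fv_bex _ _ _ k1, Formula.fv_bex _ _ _ k2, Term.fv,
          Finset.mem_union, Finset.mem_singleton, Finset.mem_erase]
        tauto
      exact ex_elim hWx (pr_trans hδ.ex (ex_elim hWp e1))
    · intro v
      have a1 : ∀ n k m, δ.val (Function.update (Function.update (Function.update v q n) x k) p m) ↔
        δ.val (Function.update (Function.update v x k) p m) := fun n k m => by
        rw [Function.update_comm hq.2, Function.update_comm hpq.symm, Formula.val_update hqδ]
      simp only [Formula.val, hδ.val, val_bex k1, val_bex k2, Term.val,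
        Function.update_self, Function.update_of_ne hq.2, a1]
      constructor
      · rintro ⟨n, m, hm⟩
        exact ⟨n + m + 1, n, by omega, m, by omega, hm⟩
      · rintro ⟨_, n, _, m, _, hm⟩; exact ⟨n, m, hm⟩
  | @ball x t φ hx h ih =>
    obtain ⟨p', hp', δ', hδ'⟩ := ih
    obtain ⟨p, q, hp, hq, hpq⟩ := exists_fresh2 (φ.fv ∪ t.fv ∪ {x})
    simp only [Finset.mem_union, Finset.mem_singleton, not_or] at hp hq
    obtain ⟨δ, hδ⟩ := nf_wrap hT hp' hp.1.1 hδ'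
    have k1 : p ∉ (Term.var q).fv := by simp [Term.fv]; exact hpq
    have hqδ := hδ.notMem hpq.symm hq.1.1
    refine ⟨q, by simp [Formula.fv_ball _ _ _ hx, hq], .ball x t (.bex p (.var q) δ),
      .ball hx (.bex k1 hδ.d0), ?_, ?_, ?_, ?_⟩
    · intro i
      have a1 := @hδ.fv i
      simp only [Formula.fv_bex _ _ _ k1, Formula.fv_ball _ _ _ hx, Term.fv]
      have a2 : i = x → i ∉ t.fv := by rintro rfl; exact hx
      simp only [Finset.mem_union, Finset.mem_insert, Finset.mem_singleton, Finset.mem_erase] at *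
      tauto
    · exact ball_mono (ex_elim hp.1.1 (tc1 hδ.imp (by intro a; simp only [pval]; tauto)))
    · exact pr_trans (ball_mono hδ.ex)
        (collection hT hx (Ne.symm hp.2) hq.1.2 hq.2 hpq.symm hqδ)
    · intro v
      have a1 : ∀ n k m, δ.val (Function.update (Function.update (Function.update v q n) x k) p m) ↔
        δ.val (Function.update (Function.update v x k) p m) := fun n k m => by
        rw [Function.update_comm hq.2, Function.update_comm hpq.symm, Formula.val_update hqδ]
      simp only [val_ball hx, hδ.val, val_bex k1, Term.val,
        Function.update_self, Function.update_of_ne hq.2, a1, Term.val_update hq.1.2]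
      constructor
      · intro h
        exact exists_bound_nat _ _ h
      · rintro ⟨_, h⟩ k hk
        obtain ⟨m, _, hm⟩ := h k hk
        exact ⟨m, hm⟩

end normalform

end ModalArith


namespace ModalArith

section sdef

/-- Substitutions that can never capture a variable. -/
def GoodSubst (σ : ℕ → Term) : Prop := ∀ i, (σ i).fv ⊆ {i}

theorem GoodSubst.update {σ : ℕ → Term} (h : GoodSubst σ) (x : ℕ) :
    GoodSubst (Function.update σ x (.var x)) := by
  intro i
  by_cases hx : i = x
  · subst hx; simp [Term.fv]
  · rw [Function.update_of_ne hx]; exact h i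

theorem GoodSubst.single (x : ℕ) {s : Term} (hs : s.fv = ∅) :
    GoodSubst (Function.update Term.var x s) := by
  intro i
  by_cases hx : i = x
  · subst hx; simp [hs]
  · rw [Function.update_of_ne hx]; simp [Term.fv]

theorem Term.val_substAll (t : Term) (σ : ℕ → Term) (v : ℕ → ℕ) :
    (t.substAll σ).val v = t.val fun i => (σ i).val v := by
  induction t with
  | var x => rfl
  | zero => rfl
  | succ t ih => simp only [Term.substAll, Term.val, ih]
  | add t u ih1 ih2 | mul t u ih1 ih2 => simp only [Term.substAll, Term.val, ih1, ih2]

theorem good_update {σ : ℕ → Term} (h : GoodSubst σ) (x n : ℕ) (v : ℕ → ℕ) :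
    (fun i => (Function.update σ x (.var x) i).val (Function.update v x n)) =
      Function.update (fun i => (σ i).val v) x n := by
  funext i
  by_cases hx : i = x
  · subst hx; simp [Term.val]
  · rw [Function.update_of_ne hx, Function.update_of_ne hx, Term.val_update]
    intro hh
    have := h i hh
    simp at this
    exact hx this.symm

theorem Formula.val_substAll (φ : Formula) : ∀ (σ : ℕ → Term) (_ : GoodSubst σ) (v : ℕ → ℕ),
    (φ.substAll σ).val v ↔ φ.val fun i => (σ i).val v := by
  induction φ with
  | falsum | box => intros; rfl
  | eq t u | le t u => intros; simp only [Formula.substAll, Formula.val, Term.val_substAll]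
  | and φ ψ ih1 ih2 | or φ ψ ih1 ih2 | imp φ ψ ih1 ih2 =>
    intro σ h v
    simp only [Formula.substAll, Formula.val, ih1 σ h, ih2 σ h]
  | neg φ ih =>
    intro σ h v
    simp only [Formula.substAll, Formula.val, ih σ h]
  | all x φ ih | ex x φ ih =>
    intro σ h v
    simp only [Formula.substAll, Formula.val, ih _ (h.update x), good_update h]

theorem good_bound {σ : ℕ → Term} (h : GoodSubst σ) {x : ℕ} {t : Term} (hx : x ∉ t.fv) :
    x ∉ (t.substAll σ).fv := by
  intro hh
  obtain ⟨j, hj, hi⟩ := Term.fv_substAll _ _ _ hh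
  have := h j hi
  simp at this
  exact hx (this ▸ hj)

theorem good_bound_update {σ : ℕ → Term} {x : ℕ} {t : Term} (hx : x ∉ t.fv) :
    t.substAll (Function.update σ x (.var x)) = t.substAll σ :=
  Term.substAll_congr _ _ _ fun i hi => Function.update_of_ne (by rintro rfl; exact hx hi) _ _

theorem ball_substAll {σ : ℕ → Term} {x : ℕ} {t : Term} (hx : x ∉ t.fv) (φ : Formula) :
    (Formula.ball x t φ).substAll σ =
      .ball x (t.substAll σ) (φ.substAll (Function.update σ x (.var x))) := by
  simp [Formula.ball, Formula.lt, Formula.substAll, Term.substAll, good_bound_update hx]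

theorem bex_substAll {σ : ℕ → Term} {x : ℕ} {t : Term} (hx : x ∉ t.fv) (φ : Formula) :
    (Formula.bex x t φ).substAll σ =
      .bex x (t.substAll σ) (φ.substAll (Function.update σ x (.var x))) := by
  simp [Formula.bex, Formula.lt, Formula.substAll, Term.substAll, good_bound_update hx]

theorem delta0_substAll {φ : Formula} (h : IsDelta0 φ) :
    ∀ {σ : ℕ → Term} (_ : GoodSubst σ), IsDelta0 (φ.substAll σ) := by
  induction h with
  | falsum => intros; exact .falsum
  | eq => intros; exact .eq _ _
  | le => intros; exact .le _ _
  | and _ _ ih1 ih2 => intro σ h; exact .and (ih1 h) (ih2 h)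
  | or _ _ ih1 ih2 => intro σ h; exact .or (ih1 h) (ih2 h)
  | imp _ _ ih1 ih2 => intro σ h; exact .imp (ih1 h) (ih2 h)
  | neg _ ih => intro σ h; exact .neg (ih h)
  | ball hx _ ih => intro σ h; rw [ball_substAll hx]; exact .ball (good_bound h hx) (ih (h.update _))
  | bex hx _ ih => intro σ h; rw [bex_substAll hx]; exact .bex (good_bound h hx) (ih (h.update _))

theorem sigma1_substAll {φ : Formula} (h : IsSigma1 φ) :
    ∀ {σ : ℕ → Term} (_ : GoodSubst σ), IsSigma1 (φ.substAll σ) := by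
  induction h with
  | delta0 h => intro σ hσ; exact .delta0 (delta0_substAll h hσ)
  | and _ _ ih1 ih2 => intro σ h; exact .and (ih1 h) (ih2 h)
  | or _ _ ih1 ih2 => intro σ h; exact .or (ih1 h) (ih2 h)
  | ex _ ih => intro σ h; exact .ex (ih (h.update _))
  | ball hx _ ih => intro σ h; rw [ball_substAll hx]; exact .ball (good_bound h hx) (ih (h.update _))

/-- Σ₁-definable predicates on valuations. -/
def SDef (A : (ℕ → ℕ) → Prop) : Prop := ∃ φ, IsSigma1 φ ∧ ∀ v, φ.val v ↔ A v

theorem SDef.restrict {A : (ℕ → ℕ) → Prop} (h : SDef A) (s : Finset ℕ)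
    (hs : ∀ v w : ℕ → ℕ, (∀ i ∈ s, v i = w i) → (A v ↔ A w)) :
    ∃ φ, IsSigma1 φ ∧ φ.fv ⊆ s ∧ ∀ v, φ.val v ↔ A v := by
  obtain ⟨φ, h1, h2⟩ := h
  let σ : ℕ → Term := fun i => if i ∈ s then .var i else .zero
  have hσ : GoodSubst σ := by
    intro i
    by_cases hi : i ∈ s <;> simp [σ, hi, Term.fv]
  refine ⟨φ.substAll σ, sigma1_substAll h1 hσ, ?_, ?_⟩
  · intro i hi
    obtain ⟨j, hj, hi⟩ := Formula.fv_substAll _ _ _ hi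
    by_cases hj : j ∈ s
    · simp [σ, hj, Term.fv] at hi; rwa [hi]
    · simp [σ, hj, Term.fv] at hi
  · intro v
    rw [Formula.val_substAll _ _ hσ, h2]
    refine hs _ _ fun i hi => ?_
    simp [σ, hi, Term.val]

theorem SDef.congr {A B : (ℕ → ℕ) → Prop} (h : SDef A) (hh : ∀ v, B v ↔ A v) : SDef B := by
  obtain ⟨φ, h1, h2⟩ := h
  exact ⟨φ, h1, fun v => (h2 v).trans (hh v).symm⟩

theorem SDef.eq (t u : Term) : SDef fun v => t.val v = u.val v :=
  ⟨.eq t u, .delta0 (.eq _ _), fun _ => Iff.rfl⟩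

theorem SDef.le (t u : Term) : SDef fun v => t.val v ≤ u.val v :=
  ⟨.le t u, .delta0 (.le _ _), fun _ => Iff.rfl⟩

theorem SDef.and {A B : (ℕ → ℕ) → Prop} (h : SDef A) (h' : SDef B) : SDef fun v => A v ∧ B v := by
  obtain ⟨φ, h1, h2⟩ := h
  obtain ⟨ψ, h3, h4⟩ := h'
  exact ⟨φ.and ψ, .and h1 h3, fun v => and_congr (h2 v) (h4 v)⟩

theorem SDef.or {A B : (ℕ → ℕ) → Prop} (h : SDef A) (h' : SDef B) : SDef fun v => A v ∨ B v := by
  obtain ⟨φ, h1, h2⟩ := h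
  obtain ⟨ψ, h3, h4⟩ := h'
  exact ⟨φ.or ψ, .or h1 h3, fun v => or_congr (h2 v) (h4 v)⟩

theorem SDef.ex (x : ℕ) {A : (ℕ → ℕ) → Prop} (h : SDef A) :
    SDef fun v => ∃ n, A (Function.update v x n) := by
  obtain ⟨φ, h1, h2⟩ := h
  exact ⟨φ.ex x, .ex h1, fun v => exists_congr fun n => h2 _⟩

theorem SDef.ball {x y : ℕ} (hxy : x ≠ y) {A : (ℕ → ℕ) → Prop} (h : SDef A) :
    SDef fun v => ∀ n < v y, A (Function.update v x n) := by
  obtain ⟨φ, h1, h2⟩ := h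
  have hx : x ∉ (Term.var y).fv := by simpa [Term.fv] using hxy
  exact ⟨φ.ball x (.var y), .ball hx h1, fun v => by simp only [val_ball hx, h2, Term.val]⟩

theorem sdef_pair (x y z : ℕ) : SDef fun v => Nat.pair (v x) (v y) = v z := by
  refine (((SDef.le (Term.var x).succ (.var y)).and
    (SDef.eq (((Term.var y).mul (.var y)).add (.var x)) (.var z))).or
    ((SDef.le (.var y) (.var x)).and
    (SDef.eq ((((Term.var x).mul (.var x)).add (.var x)).add (.var y)) (.var z)))).congr fun v => ?_
  simp only [Term.val, Nat.pair]
  split_ifs <;> omega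

/-- c mod ((i+1) d + 1) = r -/
theorem sdef_beta (c d i r : ℕ) : SDef fun v => v c % ((v i + 1) * v d + 1) = v r := by
  let q := c + d + i + r + 1
  let m : Term := ((Term.var i).succ.mul (.var d)).succ
  refine ((SDef.le (Term.var r).succ m).and ((SDef.eq (.var c)
    (((Term.var q).mul m).add (.var r))).ex q)).congr fun v => ?_
  have h1 : c ≠ q := by omega
  have h2 : d ≠ q := by omega
  have h3 : i ≠ q := by omega
  have h4 : r ≠ q := by omega
  simp only [m, Term.val, Function.update_self, Function.update_of_ne h1, Function.update_of_ne h2,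
    Function.update_of_ne h3, Function.update_of_ne h4]
  have hM : 0 < (v i + 1) * v d + 1 := by omega
  generalize (v i + 1) * v d + 1 = M at *
  constructor
  · intro h
    exact ⟨by rw [← h]; exact Nat.mod_lt _ hM, v c / M, by rw [← h, Nat.div_add_mod']⟩
  · rintro ⟨h, k, hk⟩
    rw [hk, Nat.mul_add_mod', Nat.mod_eq_of_lt h]

/-- Functions with Σ₁-definable graphs. -/
def FDef (f : ℕ → ℕ) : Prop := ∀ x y, SDef fun v => f (v x) = v y

theorem fdef_left : FDef fun n => n.unpair.1 := by
  intro x y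
  have h1 : x ≠ x + y + 1 := by omega
  have h2 : y ≠ x + y + 1 := by omega
  refine ((sdef_pair y (x + y + 1) x).ex (x + y + 1)).congr fun v => ?_
  simp only [Function.update_self, Function.update_of_ne h1, Function.update_of_ne h2]
  constructor
  · intro h; exact ⟨(v x).unpair.2, by rw [← h, Nat.pair_unpair]⟩
  · rintro ⟨n, hn⟩; rw [← hn, Nat.unpair_pair]

theorem fdef_right : FDef fun n => n.unpair.2 := by
  intro x y
  have h1 : x ≠ x + y + 1 := by omega
  have h2 : y ≠ x + y + 1 := by omega
  refine ((sdef_pair (x + y + 1) y x).ex (x + y + 1)).congr fun v => ?_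
  simp only [Function.update_self, Function.update_of_ne h1, Function.update_of_ne h2]
  constructor
  · intro h; exact ⟨(v x).unpair.1, by rw [← h, Nat.pair_unpair]⟩
  · rintro ⟨n, hn⟩; rw [← hn, Nat.unpair_pair]

theorem FDef.comp {f g : ℕ → ℕ} (hf : FDef f) (hg : FDef g) : FDef fun n => f (g n) := by
  intro x y
  have h1 : x ≠ x + y + 1 := by omega
  have h2 : y ≠ x + y + 1 := by omega
  refine (((hg x (x + y + 1)).and (hf (x + y + 1) y)).ex (x + y + 1)).congr fun v => ?_
  simp only [Function.update_self, Function.update_of_ne h1, Function.update_of_ne h2,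
    exists_eq_left']

theorem FDef.pair {f g : ℕ → ℕ} (hf : FDef f) (hg : FDef g) :
    FDef fun n => Nat.pair (f n) (g n) := by
  intro x y
  have h1 : x ≠ x + y + 1 := by omega
  have h2 : y ≠ x + y + 1 := by omega
  have h3 : x ≠ x + y + 2 := by omega
  have h4 : y ≠ x + y + 2 := by omega
  have h5 : x + y + 1 ≠ x + y + 2 := by omega
  refine ((((hf x (x + y + 1)).and ((hg x (x + y + 2)).and
    (sdef_pair (x + y + 1) (x + y + 2) y))).ex (x + y + 2)).ex (x + y + 1)).congr fun v => ?_
  simp only [Function.update_self, Function.update_of_ne h1, Function.update_of_ne h2,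
    Function.update_of_ne h3, Function.update_of_ne h4, Function.update_of_ne h5]
  constructor
  · intro h; exact ⟨_, _, rfl, rfl, h⟩
  · rintro ⟨_, _, rfl, rfl, h⟩; exact h

theorem beta_seq (s : ℕ → ℕ) (n : ℕ) : ∃ c d, ∀ i ≤ n, c % ((i + 1) * d + 1) = s i := by
  let l := (List.range (n + 1)).map s
  refine ⟨(Nat.unbeta l).unpair.1, (Nat.unbeta l).unpair.2, fun i hi => ?_⟩
  have := Nat.beta_unbeta_coe l ⟨i, by simp [l]; omega⟩
  simpa [Nat.beta, l] using this

theorem rec_char (a0 : ℕ) (G : ℕ → ℕ → ℕ) (n u : ℕ) :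
    Nat.rec (motive := fun _ => ℕ) a0 G n = u ↔ ∃ c d, c % ((0 + 1) * d + 1) = a0 ∧
      c % ((n + 1) * d + 1) = u ∧
      ∀ i < n, G i (c % ((i + 1) * d + 1)) = c % ((i + 1 + 1) * d + 1) := by
  constructor
  · intro h
    obtain ⟨c, d, hcd⟩ := beta_seq (fun i => Nat.rec (motive := fun _ => ℕ) a0 G i) n
    refine ⟨c, d, hcd 0 (by omega), (hcd n le_rfl).trans h, fun i hi => ?_⟩
    rw [hcd i (by omega), hcd (i + 1) (by omega)]
  · rintro ⟨c, d, h1, h2, h3⟩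
    rw [← h2]
    clear h2
    induction n with
    | zero => exact h1.symm
    | succ n ih =>
      have := ih fun i hi => h3 i (by omega)
      rw [← h3 n (by omega), ← this]

theorem FDef.prec {f g : ℕ → ℕ} (hf : FDef f) (hg : FDef g) :
    FDef (Nat.unpaired fun z n => n.rec (f z) fun y IH => g <| Nat.pair z <| Nat.pair y IH) := by
  intro x y
  have key : SDef fun v => ∃ a n c d w0 zz, Nat.pair a n = v x ∧ zz = 0 ∧ f a = w0 ∧
      c % ((zz + 1) * d + 1) = w0 ∧ c % ((n + 1) * d + 1) = v y ∧
      ∀ i < n, ∃ j w w' p p', j = i + 1 ∧ c % ((i + 1) * d + 1) = w ∧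
        c % ((j + 1) * d + 1) = w' ∧ Nat.pair i w = p ∧ Nat.pair a p = p' ∧ g p' = w' := by
    obtain ⟨N, hx, hy⟩ : ∃ N, x < N ∧ y < N := ⟨x + y + 1, by omega, by omega⟩
    have h1 : ∀ k, x ≠ N + k := fun k => by omega
    have h2 : ∀ k, y ≠ N + k := fun k => by omega
    refine (SDef.ex (N + 0) <| SDef.ex (N + 1) <| SDef.ex (N + 2) <| SDef.ex (N + 3) <|
      SDef.ex (N + 4) <| SDef.ex (N + 5) <| (sdef_pair (N + 0) (N + 1) x).and <|
      (SDef.eq (.var (N + 5)) .zero).and <| (hf (N + 0) (N + 4)).and <|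
      (sdef_beta (N + 2) (N + 3) (N + 5) (N + 4)).and <|
      (sdef_beta (N + 2) (N + 3) (N + 1) y).and <| SDef.ball (x := N + 6) (y := N + 1) (by omega) <|
      SDef.ex (N + 7) <| SDef.ex (N + 8) <| SDef.ex (N + 9) <| SDef.ex (N + 10) <|
      SDef.ex (N + 11) <| (SDef.eq (.var (N + 7)) (Term.var (N + 6)).succ).and <|
      (sdef_beta (N + 2) (N + 3) (N + 6) (N + 8)).and <|
      (sdef_beta (N + 2) (N + 3) (N + 7) (N + 9)).and <|
      (sdef_pair (N + 6) (N + 8) (N + 10)).and <| (sdef_pair (N + 0) (N + 10) (N + 11)).and <|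
      hg (N + 11) (N + 9)).congr fun v => ?_
    simp only [Function.update_apply, Nat.add_left_cancel_iff, h1, h2, if_true, if_false, Term.val,
      reduceCtorEq, Nat.reduceEqDiff]
  refine key.congr fun v => ?_
  simp only [Nat.unpaired, rec_char]
  constructor
  · rintro ⟨c, d, h1, h2, h3⟩
    exact ⟨_, _, c, d, _, 0, Nat.pair_unpair _, rfl, rfl, h1, h2, fun i hi =>
      ⟨_, _, _, _, _, rfl, rfl, rfl, rfl, rfl, h3 i hi⟩⟩
  · rintro ⟨a, n, c, d, w0, zz, h0, rfl, rfl, h1, h2, h3⟩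
    rw [← h0, Nat.unpair_pair]
    refine ⟨c, d, h1, h2, fun i hi => ?_⟩
    obtain ⟨_, _, _, _, _, rfl, rfl, rfl, rfl, rfl, h⟩ := h3 i hi
    exact h

theorem fdef_primrec {f : ℕ → ℕ} (h : Nat.Primrec f) : FDef f := by
  induction h with
  | zero => intro x y; exact (SDef.eq .zero (.var y))
  | succ => intro x y; exact (SDef.eq (Term.var x).succ (.var y))
  | left => exact fdef_left
  | right => exact fdef_right
  | pair _ _ ih1 ih2 => exact ih1.pair ih2
  | comp _ _ ih1 ih2 => exact ih1.comp ih2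
  | prec _ _ ih1 ih2 => exact ih1.prec ih2

end sdef

end ModalArith


namespace ModalArith

section qlemma
variable {T : Set Formula}

theorem numeral_val_eq (n : ℕ) (v : ℕ → ℕ) : (Term.numeral n).val v = n := by
  induction n with
  | zero => rfl
  | succ n ih => simp [Term.numeral, Term.val, ih]

theorem val_subst_numeral {pr : Formula} (hfv : pr.fv ⊆ {0}) (m : ℕ) (v : ℕ → ℕ) :
    (pr.subst 0 (.numeral m)).val v ↔ pr.val fun _ => m := by
  unfold Formula.subst
  rw [Formula.val_substAll _ _ (GoodSubst.single 0 (Term.numeral_fv m))]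
  refine Formula.val_congr _ fun i hi => ?_
  have := hfv hi
  simp at this
  subst this
  simp [numeral_val_eq]

theorem mem_or {a b c : ℕ} {φ : Formula} (h : φ.fv ⊆ {a, b, c}) {i : ℕ} (h1 : i ≠ a) (h2 : i ≠ b)
    (h3 : i ≠ c) : i ∉ φ.fv := fun hi => by
  have := h hi
  simp at this
  omega

theorem exists_graph (hT : Extends T PAK) {f : ℕ → ℕ} (hf : Nat.Primrec f) (y r : ℕ) (hr1 : r ≠ 1)
    (hry : r ≠ y) (hy : y ≠ 1) : ∃ δ, IsDelta0 δ ∧ δ.fv ⊆ {1, y, r} ∧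
      ∀ v, f (v 1) = v y ↔ ∃ k, δ.val (Function.update v r k) := by
  obtain ⟨G, g1, g2, g3⟩ := (fdef_primrec hf 1 y).restrict {1, y} (by
    intro v w h
    rw [h 1 (by simp), h y (by simp)])
  have hr : r ∉ G.fv := fun h => by
    have := g2 h
    simp at this
    omega
  obtain ⟨δ, hδ⟩ := exists_nf hT g1 r hr
  refine ⟨δ, hδ.d0, ?_, fun v => ((g3 v).symm.trans (hδ.val v))⟩
  intro i hi
  have := hδ.fv hi
  simp at this ⊢
  rcases this with h | h
  · simp [h]
  · have := g2 h
    simp at this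
    tauto

/-- The matrix saying that `x0 = f x1`, with bound `x4`, uniquely. -/
def Theta (δ δ' : Formula) : Formula :=
  (Formula.bex 3 (.var 4) δ).and (.ball 2 (.var 4) ((Formula.bex 3 (.var 4) δ').imp
    (.eq (.var 2) (.var 0))))

theorem theta_fv {δ δ' : Formula} (h : δ.fv ⊆ {1, 0, 3}) (h' : δ'.fv ⊆ {1, 2, 3}) :
    (Theta δ δ').fv ⊆ {0, 1, 4} := by
  have k3 : 3 ∉ (Term.var 4).fv := by simp [Term.fv]
  have k2 : 2 ∉ (Term.var 4).fv := by simp [Term.fv]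
  intro i
  simp only [Theta, Formula.fv, Formula.fv_bex _ _ _ k3, Formula.fv_ball _ _ _ k2, Term.fv,
    Finset.mem_union, Finset.mem_singleton, Finset.mem_erase, Finset.mem_insert]
  have a1 := @h i
  have a2 := @h' i
  simp only [Finset.mem_singleton, Finset.mem_insert] at a1 a2
  rintro ((h | h) | (h | ⟨h1, (h | ⟨h2, h⟩) | h | h⟩))
  · omega
  · have := a1 h.2; omega
  · omega
  · omega
  · have := a2 h; omega
  · omega
  · omega

theorem theta_val {f : ℕ → ℕ} {δ δ' : Formula} (hd : δ.fv ⊆ {1, 0, 3})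
    (hv : ∀ v, f (v 1) = v 0 ↔ ∃ k, δ.val (Function.update v 3 k))
    (hv' : ∀ v, f (v 1) = v 2 ↔ ∃ k, δ'.val (Function.update v 3 k)) (v : ℕ → ℕ) :
    ((Theta δ δ').val v → f (v 1) = v 0) ∧
    (f (v 1) = v 0 → ∃ q > v 0, (Theta δ δ').val (Function.update v 4 q)) := by
  have k3 : 3 ∉ (Term.var 4).fv := by simp [Term.fv]
  have k2 : 2 ∉ (Term.var 4).fv := by simp [Term.fv]
  simp only [Theta, Formula.val, val_bex k3, val_ball k2, Term.val]
  constructor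
  · rintro ⟨⟨k, _, hk⟩, -⟩
    exact (hv v).2 ⟨k, hk⟩
  · intro h
    obtain ⟨k, hk⟩ := (hv v).1 h
    refine ⟨v 0 + k + 1, by omega, ⟨k, by simp, ?_⟩, ?_⟩
    · rw [Function.update_comm (by omega), Formula.val_update]
      · exact hk
      · exact mem_or hd (by omega) (by omega) (by omega)
    · rintro z _ ⟨r, _, hr⟩
      have := (hv' _).2 ⟨r, hr⟩
      simp at this ⊢
      rw [← this, h]

set_option maxHeartbeats 1000000 in
theorem exists_Q (hT : Extends T PAK) {pr : Formula} (h1 : IsSigma1 pr) (hfv : pr.fv ⊆ {0})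
    {f : ℕ → ℕ} (hf : Nat.Primrec f) : ∃ Q, IsSigma1 Q ∧ Q.fv ⊆ {1} ∧
      (∀ v, Q.val v ↔ pr.val fun _ => f (v 1)) ∧
      ∀ n, T ⊩ (Formula.eq (.var 1) (.numeral n)).imp (Q.imp (pr.subst 0 (.numeral (f n)))) := by
  obtain ⟨δ, d1, d2, d3⟩ := exists_graph hT hf 0 3 (by omega) (by omega) (by omega)
  obtain ⟨δ', e1, e2, e3⟩ := exists_graph hT hf 2 3 (by omega) (by omega) (by omega)
  have k3 : 3 ∉ (Term.var 4).fv := by simp [Term.fv]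
  have k2 : 2 ∉ (Term.var 4).fv := by simp [Term.fv]
  have k0 : 0 ∉ (Term.var 4).fv := by simp [Term.fv]
  have hΘ := theta_fv d2 e2
  have hΘ0 : IsDelta0 (Theta δ δ') := .and (.bex k3 d1) (.ball k2 (.imp (.bex k3 e1) (.eq _ _)))
  have hΘv := theta_val d2 d3 e3
  have hpr : ∀ v : ℕ → ℕ, pr.val v ↔ pr.val fun _ => v 0 := fun v =>
    Formula.val_congr _ fun i hi => by
      have := hfv hi
      simp at this
      rw [this]
  have hprm : ∀ i ≠ 0, i ∉ pr.fv := fun i hi h => hi (by simpa using hfv h)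
  refine ⟨.ex 4 (.ex 0 (((Formula.lt (.var 0) (.var 4)).and (Theta δ δ')).and pr)),
    .ex (.ex (.and (.delta0 (.and (.le _ _) hΘ0)) h1)), ?_, ?_, ?_⟩
  · intro i
    simp only [Formula.fv, Formula.lt, Term.fv, Finset.mem_erase, Finset.mem_union,
      Finset.mem_singleton]
    rintro ⟨a, b, ((h | h) | h) | h⟩
    · omega
    · omega
    · have := hΘ h
      simp at this
      omega
    · exact absurd h (hprm _ b)
  · intro v
    simp only [Formula.val, Formula.lt, Term.val]
    constructor
    · rintro ⟨q, m, ⟨_, h⟩, h'⟩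
      have := (hΘv _).1 h
      rw [hpr] at h'
      rw [← this] at h'
      simpa using h'
    · intro h
      obtain ⟨q, hq, hq'⟩ := (hΘv (Function.update v 0 (f (v 1)))).2 (by simp)
      refine ⟨q, f (v 1), ⟨?_, ?_⟩, ?_⟩
      · simpa using hq
      · rw [Function.update_comm (by omega)]; exact hq'
      · rw [hpr]; simpa using h
  · intro n
    have kn : ∀ k i, i ∉ (Term.numeral k).fv := fun k i => by simp [Term.numeral_fv]
    obtain ⟨w, hw⟩ := (e3 (Function.update (fun _ => n) 2 (f n))).1 (by simp)
    let K := f n + w + 1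
    let C := Formula.eq (.var 1) (.numeral n)
    let D := Formula.eq (.var 0) (.numeral (f n))
    have s1 : T ⊩ C.imp (.ball 4 (.numeral K) (.ball 0 (.var 4) ((Theta δ δ').imp D))) := by
      refine (delta0_pos hT top_fv (.ball (kn _ _) (.ball k0 (.imp hΘ0 (.eq _ _)))) (fun _ => n)).1
        ?_ C ?_ (pr_K pr_top)
      · simp only [val_ball (kn K 4), val_ball k0, Formula.val, Term.val, numeral_val_eq]
        intro k _ m _ h
        have := (hΘv _).1 h
        simpa using this.symm
      · intro i hi
        have : i = 1 := by
          simp only [Formula.fv_ball _ _ _ (kn K 4), Formula.fv_ball _ _ _ k0, Formula.fv, Term.fv,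
            Term.numeral_fv, Finset.mem_union, Finset.mem_erase, Finset.mem_singleton] at hi
          rcases hi with hi | ⟨a, hi | ⟨b, hi | hi | hi⟩⟩
          · simp at hi
          · omega
          · have := hΘ hi
            simp at this
            omega
          · omega
          · simp at hi
        subst this
        exact pr_id _
    have s2 : T ⊩ C.imp (.bex 2 (.numeral K) ((Formula.eq (.var 2) (.numeral (f n))).and
        (.bex 3 (.numeral K) δ'))) := by
      refine (delta0_pos hT top_fv (.bex (kn _ _) (.and (.eq _ _) (.bex (kn _ _) e1)))
        (fun _ => n)).1 ?_ C ?_ (pr_K pr_top)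
      · simp only [val_bex (kn K 2), val_bex (kn K 3), Formula.val, Term.val, numeral_val_eq]
        exact ⟨f n, by omega, by simp, w, by omega, hw⟩
      · intro i hi
        have : i = 1 := by
          simp only [Formula.fv_bex _ _ _ (kn K 2), Formula.fv_bex _ _ _ (kn K 3), Formula.fv,
            Term.fv, Term.numeral_fv, Finset.mem_union, Finset.mem_erase,
            Finset.mem_singleton] at hi
          rcases hi with hi | ⟨a, (hi | hi) | hi | ⟨b, hi⟩⟩
          · simp at hi
          · omega
          · simp at hi
          · simp at hi
          · have := e2 hi
            simp at this
            omega
        subst this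
        exact pr_id _
    have s3 : T ⊩ (Formula.le (.numeral K) (.var 4)).imp ((Theta δ δ').imp
        ((Formula.bex 2 (.numeral K) ((Formula.eq (.var 2) (.numeral (f n))).and
        (.bex 3 (.numeral K) δ'))).imp D)) := by
      let ψ := (Formula.le (.numeral K) (.var 4)).and (Theta δ δ')
      let ψ' := ψ.and ((Formula.lt (.var 2) (.numeral K)).and (.eq (.var 2) (.numeral (f n))))
      have q1 : T ⊩ ψ'.imp (((Formula.lt (.var 3) (.numeral K)).and δ').imp D) := by
        have a1 := lt_trans_le hT (.var 3) (.numeral K) (.var 4)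
        have a2 := lt_trans_le hT (.var 2) (.numeral K) (.var 4)
        have a3 := bex_self (T := T) 3 (.var 4) δ'
        have a4 := ball_self (T := T) 2 (.var 4) ((Formula.bex 3 (.var 4) δ').imp
          (.eq (.var 2) (.var 0)))
        have a5 : T ⊩ ((Formula.eq (.var 2) (.var 0)).and (.eq (.var 2) (.numeral (f n)))).imp D :=
          cet (ces (.logic (.andE1 _ _))) (.logic (.andE2 _ _))
        exact tc5 a1 a2 a3 a4 a5 (fun a h1 h2 h3 h4 h5 h6 h7 =>
          h5 ⟨h4 h6.1.2.2 (h2 h6.2.1 h6.1.1) (h3 (h1 h7.1 h6.1.1) h7.2), h6.2.2⟩)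
      have hψ : ∀ i, i ≠ 0 → i ≠ 1 → i ≠ 4 → i ∉ ψ.fv := by
        intro i h0 h1 h4
        simp [ψ, Formula.fv, Term.fv, Term.numeral_fv, h4, mem_or hΘ h0 h1 h4]
      have hD : ∀ i ≠ 0, i ∉ D.fv := by
        intro i hi
        simp [D, Formula.fv, Term.fv, Term.numeral_fv, hi]
      have q2 : T ⊩ ψ'.imp ((Formula.bex 3 (.numeral K) δ').imp D) := by
        refine ex_elim2 (hD 3 (by omega)) ?_ q1
        have := hψ 3 (by omega) (by omega) (by omega)
        simp [ψ', Formula.fv, Formula.lt, Term.fv, Term.numeral_fv, this]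
      have q3 : T ⊩ ψ.imp ((Formula.bex 2 (.numeral K) ((Formula.eq (.var 2)
          (.numeral (f n))).and (.bex 3 (.numeral K) δ'))).imp D) := by
        refine ex_elim2 (hD 2 (by omega)) (hψ 2 (by omega) (by omega) (by omega)) ?_
        exact tc1 q2 (fun a h1 h2 h3 => h1 ⟨h2, h3.1, h3.2.1⟩ h3.2.2)
      exact tc1 q3 (fun a h1 h2 h3 => h1 ⟨h2, h3⟩)
    have s4 : T ⊩ C.imp ((Formula.lt (.var 0) (.var 4)).imp ((Theta δ δ').imp D)) := by
      refine tc5 s1 (tc2 s2 s3 (C := (Formula.le (.numeral K) (.var 4)).imp ((Theta δ δ').imp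
        (C.imp D))) (fun a h1 h2 h3 h4 h5 => h2 h3 h4 (h1 h5)))
        (lt_or_le hT (.var 4) (.numeral K)) (ball_self 4 (.numeral K)
          (.ball 0 (.var 4) ((Theta δ δ').imp D))) (ball_self 0 (.var 4) ((Theta δ δ').imp D))
        (fun a h1 h2 h3 h4 h5 h6 h7 h8 => ?_)
      rcases h3 with h | h
      · exact h5 (h4 (h1 h6) h) h7 h8
      · exact h2 h h8 h6
    have s5 := leibniz_var hT (.numeral (f n)) 0 pr (Formula.freeFor_closed _ _ (Term.numeral_fv _))
    have hC : ∀ i ≠ 1, i ∉ C.fv := by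
      intro i hi
      simp [C, Formula.fv, Term.fv, Term.numeral_fv, hi]
    have hP : ∀ i, i ∉ (pr.subst 0 (.numeral (f n))).fv := by
      intro i hi
      rcases Formula.fv_subst hi with h | h
      · exact hprm _ h.2 h.1
      · simp [Term.numeral_fv] at h
    refine ex_elim2 (hP 4) (hC 4 (by omega)) (ex_elim2 (hP 0) (hC 0 (by omega)) ?_)
    exact tc2 s4 s5 (fun a h1 h2 h3 h4 => (h2 (h1 h3 h4.1.1 h4.1.2)).1 h4.2)

end qlemma

end ModalArith


namespace ModalArith

section key
variable {T : Set Formula}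

def cInner (a c : ℕ) : ℕ :=
  Nat.pair 8 (Nat.pair 1 (Nat.pair 3 (Nat.pair
    (Nat.pair 2 (Nat.pair (Term.var 1).succ.code (Nat.pair 2 c)))
    (Nat.pair 3 (Nat.pair (Nat.pair 1 (Nat.pair (Term.var 1).code c)) a)))))

def cR (a b c : ℕ) : ℕ :=
  Nat.pair 8 (Nat.pair 2 (Nat.pair 3 (Nat.pair (Formula.lt (.var 2) (Term.var 3).succ).code
    (Nat.pair 3 (Nat.pair (cInner b c) (Nat.pair 6 (Nat.pair 8 (Nat.pair 4 (Nat.pair 3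
      (Nat.pair (Formula.lt (.var 4) (.var 2)).code (cInner a c)))))))))))

def cS (d r : ℕ) : ℕ := Nat.pair 8 (Nat.pair 3 (Nat.pair 3 (Nat.pair d (Nat.pair 6 r))))
def cS' (d r : ℕ) : ℕ := Nat.pair 8 (Nat.pair 3 (Nat.pair 3 (Nat.pair d r)))

def cNum (n : ℕ) : ℕ := Nat.rec (Nat.pair 1 0) (fun _ ih => Nat.pair 2 ih) n

theorem code_numeral (n : ℕ) : (Term.numeral n).code = cNum n := by
  induction n with
  | zero => rfl
  | succ n ih => simp only [Term.numeral, Term.code, ih]; rfl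

theorem primrec_cNum : Primrec cNum :=
  Primrec.nat_rec₁ _ (Primrec₂.natPair.comp₂ (Primrec₂.const 2) Primrec₂.right)

theorem primrec_pair {f g : ℕ → ℕ} (hf : Primrec f) (hg : Primrec g) :
    Primrec fun n => Nat.pair (f n) (g n) := Primrec₂.natPair.comp hf hg

theorem primrec_pc {f : ℕ → ℕ} (k : ℕ) (hf : Primrec f) :
    Primrec fun n => Nat.pair k (f n) := Primrec₂.natPair.comp (.const k) hf

theorem primrec_cInner {f g : ℕ → ℕ} (hf : Primrec f) (hg : Primrec g) :
    Primrec fun n => cInner (f n) (g n) :=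
  primrec_pc _ <| primrec_pc _ <| primrec_pc _ <| primrec_pair
    (primrec_pc _ <| primrec_pc _ <| primrec_pc _ hg)
    (primrec_pc _ <| primrec_pair (primrec_pc _ <| primrec_pc _ hg) hf)

theorem primrec_cR {f g h : ℕ → ℕ} (hf : Primrec f) (hg : Primrec g) (hh : Primrec h) :
    Primrec fun n => cR (f n) (g n) (h n) :=
  primrec_pc _ <| primrec_pc _ <| primrec_pc _ <| primrec_pc _ <| primrec_pc _ <| primrec_pair
    (primrec_cInner hg hh) <| primrec_pc _ <| primrec_pc _ <| primrec_pc _ <| primrec_pc _ <|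
    primrec_pc _ <| primrec_cInner hf hh

def fixR (e : ℕ) : ℕ := cR e.unpair.1 e.unpair.2 (cNum e)

theorem primrec_fixR : Primrec fixR :=
  primrec_cR (Primrec.fst.comp Primrec.unpair) (Primrec.snd.comp Primrec.unpair) primrec_cNum

def fixF (d : ℕ) (g : ℕ → ℕ) (e : ℕ) : ℕ := g (Nat.pair (cS d (fixR e)) (cS' d (fixR e)))

theorem primrec_fixF (d : ℕ) {g : ℕ → ℕ} (hg : Nat.Primrec g) : Nat.Primrec (fixF d g) := by
  rw [← Primrec.nat_iff] at hg ⊢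
  refine hg.comp (primrec_pair ?_ ?_)
  · exact primrec_pc _ <| primrec_pc _ <| primrec_pc _ <| primrec_pc _ <| primrec_pc _ primrec_fixR
  · exact primrec_pc _ <| primrec_pc _ <| primrec_pc _ <| primrec_pc _ primrec_fixR

/-- `χ` with the numeral of `n` put in for the variable 1. -/
def inner (χ : Formula) (n : ℕ) : Formula :=
  .bex 1 (Term.numeral n).succ ((Formula.eq (.var 1) (.numeral n)).and χ)

def RR (χA χB : Formula) (n : ℕ) : Formula :=
  .bex 2 (Term.var 3).succ ((inner χB n).and (Formula.bex 4 (.var 2) (inner χA n)).neg)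

def SS (δ R : Formula) : Formula := .ex 3 (δ.and R.neg)
def SS' (δ R : Formula) : Formula := .ex 3 (δ.and R)

theorem code_inner (χ : Formula) (n : ℕ) : (inner χ n).code = cInner χ.code (cNum n) := by
  simp only [inner, Formula.bex, Formula.lt, Formula.code, cInner, ← code_numeral, Term.code]

theorem code_RR (χA χB : Formula) (n : ℕ) : (RR χA χB n).code = cR χA.code χB.code (cNum n) := by
  simp only [RR, Formula.bex, Formula.lt, Formula.code, cR, code_inner, Term.code]

theorem code_RR_fix (χA χB : Formula) :
    (RR χA χB (Nat.pair χA.code χB.code)).code = fixR (Nat.pair χA.code χB.code) := by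
  rw [code_RR, fixR, Nat.unpair_pair]

theorem code_SS (δ R : Formula) : (SS δ R).code = cS δ.code R.code := rfl
theorem code_SS' (δ R : Formula) : (SS' δ R).code = cS' δ.code R.code := rfl

theorem code_fix {F : Formula → Formula → Formula} {g : ℕ → ℕ}
    (h : ∀ σ σ', (F σ σ').code = g (Nat.pair σ.code σ'.code)) (δ χA χB : Formula) (e : ℕ)
    (he : e = Nat.pair χA.code χB.code) :
    (F (SS δ (RR χA χB e)) (SS' δ (RR χA χB e))).code = fixF δ.code g e := by
  rw [h, code_SS, code_SS', he, code_RR_fix]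
  rfl

/-- truth of the instance -/
def WW (χ : Formula) (n k : ℕ) : Prop := χ.val (Function.update (fun _ => k) 1 n)

theorem nfv (n i : ℕ) : i ∉ (Term.numeral n).fv := by simp [Term.numeral_fv]
theorem nfv' (n i : ℕ) : i ∉ (Term.numeral n).succ.fv := by simp [Term.numeral_fv, Term.fv]

theorem inner_val {χ : Formula} {p : ℕ} (hp : p ≠ 1) (h : χ.fv ⊆ {p, 1}) (n : ℕ) (v : ℕ → ℕ) :
    (inner χ n).val v ↔ WW χ n (v p) := by
  simp only [inner, val_bex (nfv' n 1), Formula.val, Term.val, numeral_val_eq,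
    Function.update_self]
  have : ∀ k, χ.val (Function.update v 1 k) ↔ WW χ k (v p) := by
    intro k
    refine Formula.val_congr _ fun i hi => ?_
    have := h hi
    simp at this
    rcases this with h | h
    · subst h; simp [hp]
    · subst h; simp
  simp only [this]
  constructor
  · rintro ⟨k, _, rfl, h⟩; exact h
  · intro h; exact ⟨n, by omega, rfl, h⟩

theorem inner_fv {χ : Formula} {p : ℕ} (h : χ.fv ⊆ {p, 1}) (n : ℕ) :
    (inner χ n).fv ⊆ {p} := by
  intro i
  simp only [inner, Formula.fv_bex _ _ _ (nfv' n 1), Formula.fv, Term.fv, Term.numeral_fv]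
  simp
  intro h1 h2
  have := h h2
  simp at this
  tauto

theorem inner_d0 {χ : Formula} (h : IsDelta0 χ) (n : ℕ) : IsDelta0 (inner χ n) :=
  .bex (nfv' n 1) (.and (.eq _ _) h)

/-- Package of properties of a witness formula. -/
structure Wit (T : Set Formula) (pr : Formula) (f : ℕ → ℕ) (p : ℕ) (χ : Formula) : Prop where
  d0 : IsDelta0 χ
  fv : χ.fv ⊆ {p, 1}
  imp : ∀ n, T ⊩ (inner χ n).imp (pr.subst 0 (.numeral (f n)))
  val : ∀ n, (∃ k, WW χ n k) ↔ pr.val fun _ => f n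

theorem exists_wit (hT : Extends T PAK) {pr : Formula} (h1 : IsSigma1 pr) (hfv : pr.fv ⊆ {0})
    {f : ℕ → ℕ} (hf : Nat.Primrec f) (p : ℕ) (hp : p ≠ 1) : ∃ χ, Wit T pr f p χ := by
  obtain ⟨Q, q1, q2, q3, q4⟩ := exists_Q hT h1 hfv hf
  have hpQ : p ∉ Q.fv := fun h => hp (by simpa using q2 h)
  obtain ⟨χ, hχ⟩ := exists_nf hT q1 p hpQ
  have hfvχ : χ.fv ⊆ {p, 1} := by
    intro i hi
    have := hχ.fv hi
    simp at this ⊢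
    rcases this with h | h
    · exact Or.inl h
    · exact Or.inr (by simpa using q2 h)
  refine ⟨χ, hχ.d0, hfvχ, fun n => ?_, fun n => ?_⟩
  · refine ex_elim ?_ ?_
    · intro hi
      rcases Formula.fv_subst hi with h | h
      · have := hfv h.1; simp at this
      · simp [Term.numeral_fv] at h
    · exact tc2 hχ.imp (q4 n) (fun a h1 h2 h3 => h2 h3.2.1 (h1 h3.2.2))
  · have := hχ.val (fun _ => n)
    rw [q3] at this
    rw [this]
    refine exists_congr fun k => Formula.val_congr _ fun i hi => ?_
    have := hfvχ hi
    simp at this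
    rcases this with h | h
    · subst h; simp [hp]
    · subst h; simp [Ne.symm hp]

theorem bex_mono_bound {x : ℕ} {s t : Term} (hs : x ∉ s.fv) (ht : x ∉ t.fv) (hT : Extends T PAK)
    (φ : Formula) : T ⊩ (Formula.le s t).imp ((Formula.bex x s φ).imp (Formula.bex x t φ)) := by
  refine ex_elim2 (by simp [Formula.bex, Formula.fv]) (by simp [Formula.fv, hs, ht]) ?_
  exact tc2 (lt_trans_le hT (.var x) s t) (bex_self x t φ)
    (fun a h1 h2 h3 h4 => h2 (h1 h4.1 h3) h4.2)

theorem delta0_sentence (hT : Extends T PAK) {φ : Formula} (h : IsDelta0 φ) (hs : φ.fv ⊆ ∅)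
    (ht : φ.val fun _ => 0) : T ⊩ φ :=
  sigma1_complete hT (.delta0 h) (Finset.subset_empty.1 hs) ht

theorem case_B (hT : Extends T PAK) {δ χA χB : Formula} (hδ : IsDelta0 δ) (hδf : δ.fv ⊆ {3})
    (hδv : ∀ v, ¬ δ.val v) (hA : IsDelta0 χA) (hAf : χA.fv ⊆ {4, 1}) (hB : IsDelta0 χB)
    (hBf : χB.fv ⊆ {2, 1}) (e k : ℕ) (hk : WW χB e k) (hk' : ∀ j < k, ¬ WW χA e j) :
    T ⊩ (SS δ (RR χA χB e)).neg := by
  have k4 : 4 ∉ (Term.var 2).fv := by simp [Term.fv]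
  have s1 : T ⊩ .ball 3 (.numeral (k + 1)) δ.neg := by
    refine delta0_sentence hT (.ball (nfv _ _) (.neg hδ)) ?_ ?_
    · intro i
      simp only [Formula.fv_ball _ _ _ (nfv (k + 1) 3), Formula.fv, Term.numeral_fv]
      simp
      intro h1 h2
      exact h1 (by simpa using hδf h2)
    · simp [val_ball (nfv (k + 1) 3), Formula.val, hδv]
  have s2 : T ⊩ .bex 2 (.numeral (k + 1)) ((inner χB e).and
      (Formula.bex 4 (.var 2) (inner χA e)).neg) := by
    refine delta0_sentence hT (.bex (nfv _ _) (.and (inner_d0 hB e) (.neg (.bex k4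
      (inner_d0 hA e))))) ?_ ?_
    · intro i
      simp only [Formula.fv_bex _ _ _ (nfv (k + 1) 2), Formula.fv, Term.numeral_fv,
        Formula.fv_bex _ _ _ k4, Term.fv]
      simp
      intro h1
      exact ⟨fun h => h1 (by simpa using inner_fv hBf e h),
        fun h2 h => h2 (by simpa using inner_fv hAf e h)⟩
    · simp only [val_bex (nfv (k + 1) 2), val_bex k4, Formula.val, numeral_val_eq, Term.val,
        inner_val (by omega : 2 ≠ 1) hBf, inner_val (by omega : 4 ≠ 1) hAf, Function.update_self]
      exact ⟨k, by omega, hk, fun ⟨j, hj, h⟩ => hk' j hj h⟩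
  have s3 := bex_mono_bound (x := 2) (nfv (k + 1) 2) (t := (Term.var 3).succ) (by simp [Term.fv]) hT
    ((inner χB e).and (Formula.bex 4 (.var 2) (inner χA e)).neg)
  have s4 : T ⊩ δ.imp (RR χA χB e) := by
    have a1 := ball_self (T := T) 3 (.numeral (k + 1)) δ.neg
    have a2 := lt_or_le hT (.var 3) (.numeral (k + 1))
    have a3 := tc2 (le_trans' hT (.numeral (k + 1)) (.var 3) (Term.var 3).succ)
      (le_succ' hT (.var 3)) (C := (Formula.le (.numeral (k + 1)) (.var 3)).imp
        (.le (.numeral (k + 1)) (Term.var 3).succ)) (fun a h1 h2 h3 => h1 h3 h2)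
    have a4 := tc3 s2 s3 a3 (D := (Formula.le (.numeral (k + 1)) (.var 3)).imp (RR χA χB e))
      (fun a h1 h2 h3 h4 => h2 (h3 h4) h1)
    refine tc4 s1 a1 a2 a4 (fun a h1 h2 h3 h4 h5 => ?_)
    rcases h3 with h | h
    · exact absurd h5 (h2 h1 h)
    · exact h4 h
  have s5 : T ⊩ (SS δ (RR χA χB e)).imp .falsum :=
    ex_elim (by simp [Formula.fv]) (tc1 s4 (fun a h1 h2 => h2.2 (h1 h2.1)))
  exact tc1 s5 (fun a h1 h2 => h1 h2)

theorem case_A (hT : Extends T PAK) {δ χA χB : Formula} (hA : IsDelta0 χA) (hAf : χA.fv ⊆ {4, 1})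
    (hB : IsDelta0 χB) (hBf : χB.fv ⊆ {2, 1}) (e k : ℕ) (hk : WW χA e k)
    (hk' : ∀ j ≤ k, ¬ WW χB e j) : T ⊩ (SS' δ (RR χA χB e)).neg := by
  have s1 : T ⊩ .ball 2 (.numeral (k + 1)) (inner χB e).neg := by
    refine delta0_sentence hT (.ball (nfv _ _) (.neg (inner_d0 hB e))) ?_ ?_
    · intro i
      simp only [Formula.fv_ball _ _ _ (nfv (k + 1) 2), Formula.fv, Term.numeral_fv]
      simp
      intro h1 h2
      exact h1 (by simpa using inner_fv hBf e h2)
    · simp only [val_ball (nfv (k + 1) 2), Formula.val, inner_val (by omega : 2 ≠ 1) hBf,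
        numeral_val_eq, Function.update_self]
      exact fun j hj => hk' j (by omega)
  have s2 : T ⊩ .bex 4 (.numeral (k + 1)) (inner χA e) := by
    refine delta0_sentence hT (.bex (nfv _ _) (inner_d0 hA e)) ?_ ?_
    · intro i
      simp only [Formula.fv_bex _ _ _ (nfv (k + 1) 4), Term.numeral_fv]
      simp
      intro h1 h2
      exact h1 (by simpa using inner_fv hAf e h2)
    · simp only [val_bex (nfv (k + 1) 4), inner_val (by omega : 4 ≠ 1) hAf,
        numeral_val_eq, Function.update_self]
      exact ⟨k, by omega, hk⟩
  have s3 := bex_mono_bound (x := 4) (nfv (k + 1) 4) (t := .var 2) (by simp [Term.fv]) hT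
    (inner χA e)
  have s4 : T ⊩ (RR χA χB e).imp .falsum := by
    refine ex_elim (by simp [Formula.fv]) ?_
    refine tc5 s1 s2 s3 (ball_self (T := T) 2 (.numeral (k + 1)) (inner χB e).neg)
      (lt_or_le hT (.var 2) (.numeral (k + 1))) (fun a h1 h2 h3 h4 h5 h6 => ?_)
    rcases h5 with h | h
    · exact h4 h1 h h6.2.1
    · exact h6.2.2 (h3 h h2)
  have s5 : T ⊩ (SS' δ (RR χA χB e)).imp .falsum :=
    ex_elim (by simp [Formula.fv]) (tc1 s4 (fun a h1 h2 => h1 h2.2))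
  exact tc1 s5 (fun a h1 h2 => h1 h2)

theorem RR_d0 {χA χB : Formula} (hA : IsDelta0 χA) (hB : IsDelta0 χB) (e : ℕ) :
    IsDelta0 (RR χA χB e) :=
  .bex (by simp [Term.fv]) (.and (inner_d0 hB e) (.neg (.bex (by simp [Term.fv]) (inner_d0 hA e))))

theorem RR_fv {χA χB : Formula} (hAf : χA.fv ⊆ {4, 1}) (hBf : χB.fv ⊆ {2, 1}) (e : ℕ) :
    (RR χA χB e).fv ⊆ {3} := by
  have k4 : 4 ∉ (Term.var 2).fv := by simp [Term.fv]
  have k2 : 2 ∉ (Term.var 3).succ.fv := by simp [Term.fv]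
  intro i
  simp only [RR, Formula.fv_bex _ _ _ k2, Formula.fv, Formula.fv_bex _ _ _ k4, Term.fv]
  simp
  rintro (h | ⟨h1, h | ⟨h2, h⟩⟩)
  · exact h
  · exact absurd (by simpa using inner_fv hBf e h) h1
  · exact absurd (by simpa using inner_fv hAf e h) h2

theorem key (hT : Extends T PAK) (P : ProvPred T) {ψ : Formula} (hψ : IsSigma1 ψ)
    (hs : Sentence ψ) (hf : ¬ StdTrue ψ) (FA FB : Formula → Formula → Formula) (gA gB : ℕ → ℕ)
    (hgA : Nat.Primrec gA) (hgB : Nat.Primrec gB)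
    (hA : ∀ σ σ', (FA σ σ').code = gA (Nat.pair σ.code σ'.code))
    (hB : ∀ σ σ', (FB σ σ').code = gB (Nat.pair σ.code σ'.code)) :
    ∃ σ σ', IsSigma1 σ ∧ Sentence σ ∧ IsSigma1 σ' ∧ Sentence σ' ∧ T ⊩ ψ.imp (σ.or σ') ∧
      T ⊩ σ'.imp (P.app (FB σ σ')) ∧
      ((T ⊩ FA σ σ' ∨ T ⊩ FB σ σ') →
        (T ⊩ FB σ σ' ∧ T ⊩ σ.neg) ∨ (T ⊩ FA σ σ' ∧ T ⊩ σ'.neg)) := by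
  have hs' : ψ.fv = ∅ := hs
  obtain ⟨δ, hδ⟩ := exists_nf hT hψ 3 (by simp [hs'])
  have hδf : δ.fv ⊆ {3} := by simpa [hs'] using hδ.fv
  have hδv : ∀ v, ¬ δ.val v := by
    intro v hv
    refine hf ((hδ.val _).2 ⟨v 3, (Formula.val_congr _ fun i hi => ?_).1 hv⟩)
    have := hδf hi
    simp at this
    subst this
    simp
  obtain ⟨χA, wA⟩ := exists_wit hT P.sigma1 P.fvSub (primrec_fixF δ.code hgA) 4 (by omega)
  obtain ⟨χB, wB⟩ := exists_wit hT P.sigma1 P.fvSub (primrec_fixF δ.code hgB) 2 (by omega)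
  obtain ⟨e, he⟩ : ∃ e, e = Nat.pair χA.code χB.code := ⟨_, rfl⟩
  have cA := code_fix hA δ χA χB e he
  have cB := code_fix hB δ χA χB e he
  have hRf := RR_fv wA.fv wB.fv e
  have hRd := RR_d0 wA.d0 wB.d0 e
  have vA : (∃ k, WW χA e k) ↔ T ⊩ FA (SS δ (RR χA χB e)) (SS' δ (RR χA χB e)) := by
    rw [wA.val, ← P.numerates, cA]
    exact (val_subst_numeral P.fvSub _ _).symm
  have vB : (∃ k, WW χB e k) ↔ T ⊩ FB (SS δ (RR χA χB e)) (SS' δ (RR χA χB e)) := by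
    rw [wB.val, ← P.numerates, cB]
    exact (val_subst_numeral P.fvSub _ _).symm
  refine ⟨SS δ (RR χA χB e), SS' δ (RR χA χB e), .ex (.delta0 (.and hδ.d0 (.neg hRd))), ?_,
    .ex (.delta0 (.and hδ.d0 hRd)), ?_, ?_, ?_, ?_⟩
  · refine Finset.subset_empty.1 fun i hi => ?_
    simp only [SS, Formula.fv, Finset.mem_erase, Finset.mem_union] at hi
    rcases hi with ⟨h, h1 | h1⟩
    · exact absurd (by simpa using hδf h1) h
    · exact absurd (by simpa using hRf h1) h
  · refine Finset.subset_empty.1 fun i hi => ?_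
    simp only [SS', Formula.fv, Finset.mem_erase, Finset.mem_union] at hi
    rcases hi with ⟨h, h1 | h1⟩
    · exact absurd (by simpa using hδf h1) h
    · exact absurd (by simpa using hRf h1) h
  · refine pr_trans hδ.ex (ex_elim (by simp [SS, SS', Formula.fv]) ?_)
    refine tc2 (ex_self 3 (δ.and (RR χA χB e).neg)) (ex_self 3 (δ.and (RR χA χB e)))
      (fun a h1 h2 h3 => ?_)
    by_cases h : pval a (RR χA χB e)
    · exact Or.inr (h2 ⟨h3, h⟩)
    · exact Or.inl (h1 ⟨h3, h⟩)
  · unfold ProvPred.app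
    rw [cB]
    have hcl : ∀ i, i ∉ (P.pr.subst 0 (.numeral (fixF δ.code gB e))).fv := by
      intro i hi
      rcases Formula.fv_subst hi with h | h
      · exact h.2 (by simpa using P.fvSub h.1)
      · simp [Term.numeral_fv] at h
    have b1 := wB.imp e
    have b2 : T ⊩ (RR χA χB e).imp (P.pr.subst 0 (.numeral (fixF δ.code gB e))) :=
      ex_elim (hcl 2) (tc1 b1 (fun a h1 h2 => h1 h2.2.1))
    exact ex_elim (hcl 3) (tc1 b2 (fun a h1 h2 => h1 h2.2))
  · rw [← vA, ← vB]
    intro h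
    classical
    by_cases hb : ∃ k, WW χB e k ∧ ∀ j < k, ¬ WW χA e j
    · obtain ⟨k, hk, hk'⟩ := hb
      exact Or.inl ⟨⟨k, hk⟩, case_B hT hδ.d0 hδf hδv wA.d0 wA.fv wB.d0 wB.fv e k hk hk'⟩
    · have ha : ∃ k, WW χA e k := by
        rcases h with h | ⟨k, hk⟩
        · exact h
        · by_contra hh
          exact hb ⟨k, hk, fun j _ hj => hh ⟨j, hj⟩⟩
      refine Or.inr ⟨ha, case_A hT wA.d0 wA.fv wB.d0 wB.fv e (Nat.find ha) (Nat.find_spec ha) ?_⟩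
      intro j hj hj'
      exact hb ⟨j, hj', fun i hi => Nat.find_min ha (by omega)⟩

end key

end ModalArith

namespace ModalArith

section final
variable {T : Set Formula}

theorem app_sigma1 (P : ProvPred T) (φ : Formula) : IsSigma1 (P.app φ) :=
  sigma1_substAll P.sigma1 (GoodSubst.single 0 (Term.numeral_fv _))

theorem app_sentence (P : ProvPred T) (φ : Formula) : Sentence (P.app φ) := by
  refine Finset.subset_empty.1 fun i hi => ?_
  rcases Formula.fv_subst hi with h | h
  · exact absurd (by simpa using P.fvSub h.1) h.2
  · simp [Term.numeral_fv] at h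

theorem primrec_left : Primrec fun n : ℕ => n.unpair.1 := Primrec.fst.comp Primrec.unpair

theorem contra (hcon : Consistent T) {φ : Formula} (h1 : T ⊩ φ) (h2 : T ⊩ φ.neg) : False :=
  hcon (tc2 h1 h2 (fun _ a b => b a))

/-- From the disjunction property to disjunctive correctness, up to provability of `□⊥`. -/
theorem dp_to (hT : Extends T PAK) (hcon : Consistent T) (P : ProvPred T) {Γ : Formula → Prop}
    (hΓ : ∀ σ, Γ (Formula.box σ)) (h : HasDP2 T Γ IsSigma1) {φ : Formula} (hφ : Γ φ)
    (hs : Sentence φ) (hp : T ⊩ φ.or (P.app φ)) :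
    T ⊩ φ ∨ T ⊩ Formula.box .falsum := by
  rcases h _ _ hφ (app_sigma1 P φ) hs (app_sentence P φ) hp with h1 | h1
  · exact Or.inl h1
  by_cases ht : StdTrue (P.app φ)
  · exact Or.inl ((P.numerates φ).1 ht)
  obtain ⟨σ, σ', s1, c1, s2, c2, k1, -, k3⟩ := key hT P (app_sigma1 P φ) (app_sentence P φ) ht
    (fun _ σ' => σ') (fun σ _ => σ.box) (fun n => n.unpair.2)
    (fun n => Nat.pair 9 n.unpair.1) .right (Primrec.nat_iff.1 (primrec_pc 9 primrec_left))
    (by intro σ σ'; simp) (by intro σ σ'; simp [Formula.code])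
  have d : T ⊩ σ.box.or σ' := by
    refine tc3 h1 k1 (sigma1_box hT s1) (fun a x y z => ?_)
    rcases y x with u | u
    · exact Or.inl (z u)
    · exact Or.inr u
  rcases k3 (h _ _ (hΓ σ) s2 c1 c2 d).symm with ⟨b1, b2⟩ | ⟨b1, b2⟩
  · exact Or.inr (.mp (boxK hT (tc1 b2 (fun a x y => x y))) b1)
  · exact (contra hcon b1 b2).elim

/-- From disjunctive correctness to the disjunction property, given a suitable `F`. -/
theorem dc_to (hT : Extends T PAK) (hcon : Consistent T) (P : ProvPred T) {Γ : Formula → Prop}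
    (h : DC T P Γ) {φ ψ : Formula} (hψ : IsSigma1 ψ) (cψ : Sentence ψ) (hp : T ⊩ φ.or ψ)
    (F : Formula → Formula) (g : ℕ → ℕ) (hg : Primrec g)
    (hF : ∀ σ, (F σ).code = g σ.code) (hFΓ : ∀ σ, Γ (F σ))
    (hFs : ∀ σ, Sentence σ → Sentence (F σ))
    (h1 : ∀ σ, IsSigma1 σ → T ⊩ (φ.or σ).imp (F σ))
    (h2 : ∀ σ, T ⊩ σ.neg → T ⊩ F σ → T ⊩ φ) : T ⊩ φ ∨ T ⊩ ψ := by
  by_cases ht : StdTrue ψ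
  · exact Or.inr (sigma1_complete hT hψ cψ ht)
  obtain ⟨σ, σ', s1, c1, s2, c2, k1, k2, k3⟩ := key hT P hψ cψ ht
    (fun _ _ => .falsum) (fun σ _ => F σ) (fun _ => Nat.pair 0 0)
    (fun n => g n.unpair.1) (Primrec.nat_iff.1 (Primrec.const _))
    (Primrec.nat_iff.1 (hg.comp primrec_left))
    (by intro σ σ'; simp [Formula.code]) (by intro σ σ'; simp [hF])
  have d : T ⊩ (F σ).or (P.app (F σ)) := by
    refine tc4 hp k1 k2 (h1 σ s1) (fun a x y z w => ?_)
    rcases x with x | x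
    · exact Or.inl (w (Or.inl x))
    · rcases y x with u | u
      · exact Or.inl (w (Or.inr u))
      · exact Or.inr (z u)
  have e := h _ (hFΓ σ) (hFs σ c1) d
  rcases k3 (Or.inr e) with ⟨b1, b2⟩ | ⟨b1, -⟩
  · exact Or.inl (h2 σ b2 b1)
  · exact (hcon b1).elim

end final

/-- For a consistent r.e. extension T of PA(K) (with natural provability predicate P):
(1) if T ⊬ □⊥, then T has (ΔB, Σ₁)-DP iff T is ΔB-DC;
(2) T has (B, Σ₁)-DP iff T is B-DC. -/
theorem statement12 (T : Set Formula) (hre : RE T) (hT : Extends T PAK)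
    (hcon : Consistent T) (P : ProvPred T) :
    ((¬ Provable T (Formula.box Formula.falsum)) →
      (HasDP2 T IsDeltaB IsSigma1 ↔ DC T P IsDeltaB)) ∧
    (HasDP2 T IsB IsSigma1 ↔ DC T P IsB) := by
  refine ⟨fun hb => ⟨fun h φ hφ hs hp => ?_, fun h φ ψ hφ hψ cφ cψ hp => ?_⟩,
    fun h φ hφ hs hp => ?_, fun h φ ψ hφ hψ cφ cψ hp => ?_⟩
  · exact (dp_to hT hcon P .b h hφ hs hp).resolve_right hb
  · rcases deltaB_dec hT hφ cφ with hd | hd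
    · refine dc_to hT hcon P h hψ cψ hp (fun σ => φ.or σ.box)
        (fun n => Nat.pair 4 (Nat.pair φ.code (Nat.pair 9 n)))
        (primrec_pc _ <| primrec_pc _ <| primrec_pc _ Primrec.id) (fun σ => rfl)
        (fun σ => .or hφ (.b σ)) (fun σ hσ => ?_) (fun σ hσ => ?_) (fun σ hn hf => ?_)
      · simp only [Sentence] at hσ cφ ⊢
        simp [Formula.fv, hσ, cφ]
      · refine tc1 (sigma1_box hT hσ) (fun a x y => ?_)
        rcases y with y | y
        · exact Or.inl y
        · exact Or.inr (x y)
      · have : T ⊩ σ.box.imp (Formula.box .falsum) := boxK hT (tc1 hn (fun a x y => x y))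
        refine tc3 hf this hd (fun a x y z => ?_)
        rcases x with x | x
        · exact x
        · exact z (y x)
    · refine Or.inr (tc2 hp hd (fun a x y => ?_))
      rcases x with x | x
      · exact absurd x y
      · exact x
  · rcases dp_to hT hcon P (fun σ => ⟨σ, rfl⟩) h hφ hs hp with h1 | h1
    · exact h1
    · obtain ⟨A, rfl⟩ := hφ
      exact .mp (boxK hT (taut (φ := Formula.falsum.imp A) (fun a x => False.elim x))) h1
  · obtain ⟨A, rfl⟩ := hφ
    refine dc_to hT hcon P h hψ cψ hp (fun σ => (A.or σ).box)
      (fun n => Nat.pair 9 (Nat.pair 4 (Nat.pair A.code n)))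
      (primrec_pc _ <| primrec_pc _ <| primrec_pc _ Primrec.id) (fun σ => rfl)
      (fun σ => ⟨_, rfl⟩) (fun σ hσ => ?_) (fun σ hσ => ?_) (fun σ hn hf => ?_)
    · simp only [Sentence, Formula.fv] at hσ cφ ⊢
      simp [hσ, cφ]
    · have b1 : T ⊩ A.box.imp (A.or σ).box := boxK hT (taut (fun a x => Or.inl x))
      have b2 : T ⊩ σ.box.imp (A.or σ).box := boxK hT (taut (fun a x => Or.inr x))
      refine tc3 (sigma1_box hT hσ) b1 b2 (fun a x y z w => ?_)
      rcases w with w | w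
      · exact y w
      · exact z (x w)
    · refine .mp (boxK hT (tc1 hn (fun a x y => ?_))) hf
      rcases y with y | y
      · exact y
      · exact absurd y x

end ModalArith
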